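/- Let α > 0 be fixed and let f : ℝ → ℝ be bounded and continuous. With E_N(m) the expected number of real eigenvalues of the product of m independent N×N Gaussian matrices, for any sequence of positive integers (m_N) indexed by even N with m_N/N → α as N → ∞, one has (1/E_N(m_N)) · E[ Σ_x f( sgn(x)·|x|^{1/m_N} ) ] → ∫_{−1}^{1} f(λ) ρ̃_α(λ) dλ as N → ∞, where the sum runs over the real roots x of the characteristic polynomial of the product matrix counted with multiplicity, and ρ̃_α(λ) := (1/c(α)) · |λ| · erf( √(α/8) / |λ| ) for λ ∈ (−1,1), λ ≠ 0, with c(α) := ∫₀¹ erf(√(α/(8t))) dt. -/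

import Mathlib

open MeasureTheory ProbabilityTheory Filter

/-- The error function `erf x = (2/√π) ∫_0^x e^{-s²} ds`. -/
noncomputable def erf (x : ℝ) : ℝ :=
  (2 / Real.sqrt Real.pi) * ∫ s in (0:ℝ)..x, Real.exp (-s ^ 2)

/-- `c(α) = ∫_0^1 erf(√(α/(8t))) dt`. -/
noncomputable def cFun (α : ℝ) : ℝ :=
  ∫ t in (0:ℝ)..1, erf (Real.sqrt (α / (8 * t)))

/-- The joint law of `m` independent `N × N` matrices with i.i.d. real Gaussian
entries of mean `0` and variance `1/N`. -/
noncomputable def ensembleMeasure (N m : ℕ) :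
    Measure (Fin m → Fin N → Fin N → ℝ) :=
  Measure.pi fun _ =>
    Measure.pi fun _ => Measure.pi fun _ => gaussianReal 0 (1 / N)

/-- The product matrix `P = X_1 ⋯ X_m`. -/
noncomputable def prodMatrix (N m : ℕ) (ω : Fin m → Fin N → Fin N → ℝ) :
    Matrix (Fin N) (Fin N) ℝ :=
  (List.ofFn fun i => Matrix.of (ω i)).prod

/-- The number of real eigenvalues of a matrix, i.e. the number of real roots of
its characteristic polynomial counted with multiplicity. -/
noncomputable def numRealEigs (N : ℕ) (P : Matrix (Fin N) (Fin N) ℝ) : ℕ :=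
  (Matrix.charpoly P).roots.card

/-- The expected number of real eigenvalues of the product of `m` independent
`N × N` Gaussian matrices. -/
noncomputable def EN (N m : ℕ) : ℝ :=
  ∫ ω, (numRealEigs N (prodMatrix N m ω) : ℝ) ∂(ensembleMeasure N m)

/-- The variance of the number of real eigenvalues. -/
noncomputable def VN (N m : ℕ) : ℝ :=
  variance (fun ω => (numRealEigs N (prodMatrix N m ω) : ℝ)) (ensembleMeasure N m)

/-- The linear statistic `Σ_x g(x)` over the multiset of real roots of the
characteristic polynomial of `P`, counted with multiplicity. -/
noncomputable def linearStat (N : ℕ) (g : ℝ → ℝ) (P : Matrix (Fin N) (Fin N) ℝ) : ℝ :=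
  ((Matrix.charpoly P).roots.map g).sum

/-- The limiting rescaled density `ρ̃_α(λ) = (1/c(α)) |λ| erf(√(α/8)/|λ|)` for
`0 < |λ| < 1`, and `0` otherwise. -/
noncomputable def rhoTilde (α : ℝ) (l : ℝ) : ℝ :=
  if 0 < |l| ∧ |l| < 1 then (1 / cFun α) * |l| * erf (Real.sqrt (α / 8) / |l|) else 0

section AreaFormula

variable {E : Type*} [NormedAddCommGroup E] [NormedSpace ℝ E] [FiniteDimensional ℝ E]
  [MeasurableSpace E] [BorelSpace E] (μ : Measure E) [μ.IsAddHaarMeasure]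

/-- Sard's lemma in equal dimensions: almost every point is a regular value. -/
lemma ae_forall_fiber_det_fderiv_ne_zero {f : E → E} (hf : ContDiff ℝ 1 f) :
    ∀ᵐ c ∂μ, ∀ y, f y = c → (fderiv ℝ f y).det ≠ 0 := by
  have h := addHaar_image_eq_zero_of_det_fderivWithin_eq_zero μ
    (s := {x | (fderiv ℝ f x).det = 0}) (f := f) (f' := fderiv ℝ f)
    (fun x _ => ((hf.differentiable one_ne_zero) x).hasFDerivAt.hasFDerivWithinAt)
    (fun x hx => hx)
  filter_upwards [measure_eq_zero_iff_ae_notMem.1 h] with c hc y hy h0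
  exact hc ⟨y, h0, hy⟩

lemma exists_countable_injOn_cover {f : E → E} (hf : ContDiff ℝ 1 f) :
    ∃ s : ℕ → Set E, (∀ k, MeasurableSet (s k)) ∧ Pairwise (Function.onFun Disjoint s) ∧
      (∀ k, Set.InjOn f (s k)) ∧ (⋃ k, s k) = {x | (fderiv ℝ f x).det ≠ 0} := by
  set S : Set E := {x | (fderiv ℝ f x).det ≠ 0} with hS
  have hSopen : IsOpen S :=
    isOpen_ne_fun (ContinuousLinearMap.continuous_det.comp (hf.continuous_fderiv one_ne_zero))
      continuous_const
  have hloc : ∀ x : S, ∃ U : Set E, IsOpen U ∧ (x : E) ∈ U ∧ Set.InjOn f U := by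
    rintro ⟨x, hx⟩
    have h1 : HasStrictFDerivAt f
        (((fderiv ℝ f x).toContinuousLinearEquivOfDetNeZero hx : E ≃L[ℝ] E) : E →L[ℝ] E) x := by
      simpa using (hf.contDiffAt.hasStrictFDerivAt one_ne_zero)
    exact ⟨(h1.toOpenPartialHomeomorph f).source, (h1.toOpenPartialHomeomorph f).open_source,
      h1.mem_toOpenPartialHomeomorph_source, (h1.toOpenPartialHomeomorph f).injOn⟩
  choose U hUo hxU hUi using hloc
  obtain ⟨T, hT, hTU⟩ := TopologicalSpace.isOpen_iUnion_countable U hUo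
  have hScov : S ⊆ ⋃ i ∈ T, U i := by
    rw [hTU]
    exact fun x hx => Set.mem_iUnion.2 ⟨⟨x, hx⟩, hxU ⟨x, hx⟩⟩
  rcases T.eq_empty_or_nonempty with hTe | hTn
  · refine ⟨fun _ => ∅, by simp, ?_, by simp, ?_⟩
    · intro i j _; simp [Function.onFun]
    · have : S = ∅ := by simpa [hTe] using hScov
      simp [this]
  obtain ⟨e, he⟩ := hT.exists_eq_range hTn
  refine ⟨fun k => S ∩ disjointed (fun k => U (e k)) k, ?_, ?_, ?_, ?_⟩
  · intro k
    exact hSopen.measurableSet.inter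
      (MeasurableSet.disjointed (fun k => (hUo (e k)).measurableSet) k)
  · intro i j hij
    exact ((disjoint_disjointed _) hij).mono Set.inter_subset_right Set.inter_subset_right
  · intro k
    exact (hUi (e k)).mono (Set.inter_subset_right.trans (disjointed_subset _ _))
  · rw [← Set.inter_iUnion, iUnion_disjointed]
    refine Set.inter_eq_left.2 (hScov.trans ?_)
    rw [he]
    simp

/-- The area formula with multiplicities for `C¹` self-maps of a finite-dimensional space. -/
theorem area_formula {f : E → E} (hf : ContDiff ℝ 1 f) {φ : E → ENNReal} (hφ : Measurable φ) :
    AEMeasurable (fun c => ∑' y : f ⁻¹' {c}, φ y) μ ∧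
    ∫⁻ c, ∑' y : f ⁻¹' {c}, φ y ∂μ = ∫⁻ y, ENNReal.ofReal |(fderiv ℝ f y).det| * φ y ∂μ := by
  obtain ⟨s, hsm, hsd, hsi, hsu⟩ := exists_countable_injOn_cover hf
  have hder : ∀ k, ∀ x ∈ s k, HasFDerivWithinAt f (fderiv ℝ f x) (s k) x := fun k x _ =>
    ((hf.differentiable one_ne_zero) x).hasFDerivAt.hasFDerivWithinAt
  have hext : ∀ k, ∃ g : E → ENNReal, Measurable g ∧ ∀ x ∈ s k, g (f x) = φ x := by
    intro k
    have hemb := measurableEmbedding_of_fderivWithin (hsm k) (hder k) (hsi k)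
    obtain ⟨g, hg, hgf⟩ := hemb.exists_measurable_extend (hφ.comp measurable_subtype_coe)
      (fun _ => ⟨0⟩)
    exact ⟨g, hg, fun x hx => congrFun hgf ⟨x, hx⟩⟩
  choose g hgm hgf using hext
  have himg : ∀ k, MeasurableSet (f '' s k) := fun k =>
    measurable_image_of_fderivWithin (hsm k) (hder k) (hsi k)
  have hae : (fun c => ∑' y : f ⁻¹' {c}, φ y) =ᵐ[μ]
      fun c => ∑' k, (f '' s k).indicator (g k) c := by
    filter_upwards [ae_forall_fiber_det_fderiv_ne_zero μ hf] with c hc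
    have hcov : f ⁻¹' {c} = ⋃ k, (f ⁻¹' {c} ∩ s k) := by
      rw [← Set.inter_iUnion, hsu]
      exact (Set.inter_eq_left.2 fun y hy => hc y hy).symm
    have hdisj : Pairwise (Function.onFun Disjoint fun k => f ⁻¹' {c} ∩ s k) := fun i j hij =>
      (hsd hij).mono Set.inter_subset_right Set.inter_subset_right
    rw [hcov, ENNReal.tsum_biUnion (f := φ) fun i _ j _ hij => hdisj hij]
    refine tsum_congr fun k => ?_
    by_cases hck : c ∈ f '' s k
    · obtain ⟨x, hx, hxc⟩ := hck
      have hsing : f ⁻¹' {c} ∩ s k = {x} := by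
        ext y
        constructor
        · rintro ⟨hy, hys⟩
          exact hsi k hys hx ((show f y = c from hy).trans hxc.symm)
        · rintro rfl
          exact ⟨hxc, hx⟩
      rw [hsing, Set.indicator_of_mem (show c ∈ f '' s k from ⟨x, hx, hxc⟩), tsum_singleton x φ, ← hxc, hgf k x hx]
    · have hemp : f ⁻¹' {c} ∩ s k = ∅ := by
        ext y
        simp only [Set.mem_inter_iff, Set.mem_preimage, Set.mem_singleton_iff,
          Set.mem_empty_iff_false, iff_false, not_and]
        exact fun h1 h2 => hck ⟨y, h2, h1⟩
      rw [hemp, Set.indicator_of_notMem hck]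
      simp
  refine ⟨⟨_, Measurable.tsum fun k => (hgm k).indicator (himg k), hae⟩, ?_⟩
  rw [lintegral_congr_ae hae, lintegral_tsum
    fun k => ((hgm k).indicator (himg k)).aemeasurable]
  have hk : ∀ k, ∫⁻ c, (f '' s k).indicator (g k) c ∂μ
      = ∫⁻ y in s k, ENNReal.ofReal |(fderiv ℝ f y).det| * φ y ∂μ := by
    intro k
    rw [lintegral_indicator (himg k),
      lintegral_image_eq_lintegral_abs_det_fderiv_mul μ (hsm k) (hder k) (hsi k)]
    exact setLIntegral_congr_fun (hsm k) fun x hx => by simp only [hgf k x hx]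
  simp_rw [hk]
  rw [← lintegral_iUnion hsm hsd, hsu]
  refine setLIntegral_eq_of_support_subset ?_
  intro y hy h0
  exact hy (by simp [h0])

end AreaFormula

section CyclicDeterminant

variable {k d : ℕ}

/-- The block-cyclic matrix of the map `(y_i) ↦ (x_i y_i - A_i y_{i+1})`. -/
def cyclicMatrix (x : Fin (k + 1) → ℝ) (A : Fin (k + 1) → Matrix (Fin d) (Fin d) ℝ) :
    Matrix (Fin (k + 1) × Fin d) (Fin (k + 1) × Fin d) ℝ :=
  fun p q => (if p = q then x p.1 else 0) - if q.1 = p.1 + 1 then A p.1 p.2 q.2 else 0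

lemma det_cyclicMatrix_one (B : Fin (k + 1) → Matrix (Fin d) (Fin d) ℝ) :
    (cyclicMatrix (fun _ => 1) B).det = (1 - (List.ofFn B).prod).det := by
  classical
  obtain ⟨suf, hsufdef⟩ : ∃ suf : ℕ → Matrix (Fin d) (Fin d) ℝ,
    ∀ i, suf i = ((List.ofFn B).drop i).prod := ⟨_, fun _ => rfl⟩
  have hsuf : ∀ i : Fin (k + 1), suf i = B i * suf (i + 1) := by
    intro i
    have hi : (i : ℕ) < (List.ofFn B).length := by rw [List.length_ofFn]; exact i.2
    rw [hsufdef, hsufdef, List.drop_eq_getElem_cons hi, List.prod_cons, List.getElem_ofFn]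
  have hlast : suf (k + 1) = 1 := by
    rw [hsufdef, List.drop_of_length_le (by rw [List.length_ofFn]), List.prod_nil]
  obtain ⟨S, hS⟩ : ∃ S : Matrix (Fin (k + 1) × Fin d) (Fin (k + 1) × Fin d) ℝ,
    ∀ p q, S p q = if (q.1 : ℕ) = p.1 + 1 then B p.1 p.2 q.2 else 0 :=
    ⟨Matrix.of fun p q => _, fun _ _ => rfl⟩
  obtain ⟨U, hU⟩ : ∃ U : Matrix (Fin (k + 1) × Fin d) (Fin d) ℝ,
    ∀ p s, U p s = suf p.1 p.2 s := ⟨Matrix.of fun p q => _, fun _ _ => rfl⟩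
  obtain ⟨W, hW⟩ : ∃ W : Matrix (Fin d) (Fin (k + 1) × Fin d) ℝ,
    ∀ r q, W r q = if q = (0, r) then 1 else 0 := ⟨Matrix.of fun p q => _, fun _ _ => rfl⟩
  have hWU : W * U = (List.ofFn B).prod := by
    ext r s
    simp only [Matrix.mul_apply, hW, hU, ite_mul, one_mul, zero_mul, Finset.sum_ite_eq',
      Finset.mem_univ, if_true, hsufdef]
    simp only [Fin.val_zero, List.drop_zero]
  have hSU : ∀ (p : Fin (k + 1) × Fin d) (s : Fin d), ((1 - S) * U : Matrix _ _ ℝ) p s = if p.1 = Fin.last k then B p.1 p.2 s else 0 := by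
    rintro ⟨i, r⟩ s
    rw [Matrix.sub_mul, Matrix.one_mul, Matrix.sub_apply, Matrix.mul_apply,
      Fintype.sum_prod_type]
    simp only [hS, hU]
    rw [hsuf i, Matrix.mul_apply]
    by_cases h : i = Fin.last k
    · subst h
      have : ∀ x : Fin (k + 1), (x : ℕ) ≠ k + 1 := fun x => by omega
      simp [hlast, this, Matrix.one_apply]
    · have hi : (i : ℕ) + 1 < k + 1 := by
        have := Fin.val_lt_last h
        omega
      rw [Fintype.sum_eq_single (⟨i + 1, hi⟩ : Fin (k + 1))]
      · simp [h]
      · intro x hx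
        have : (x : ℕ) ≠ i + 1 := fun h' => hx (Fin.ext h')
        simp [this]
  have hfac : (1 - S) * (1 - U * W) = cyclicMatrix (fun _ => 1) B := by
    rw [Matrix.mul_sub, Matrix.mul_one, ← Matrix.mul_assoc]
    ext ⟨i, r⟩ ⟨j, s⟩
    rw [Matrix.sub_apply, Matrix.sub_apply, Matrix.mul_apply]
    simp only [hSU, hS, hW, cyclicMatrix, Matrix.one_apply, Prod.mk.injEq]
    rw [sub_sub]
    congr 1
    by_cases h : i = Fin.last k
    · subst h
      have : (j : ℕ) ≠ k + 1 := by omega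
      by_cases hj : j = 0
      · subst hj
        simp
      · simp [hj, this]
    · have hi : (i : ℕ) + 1 < k + 1 := by
        have := Fin.val_lt_last h
        omega
      have : (j = i + 1) ↔ (j : ℕ) = i + 1 := by
        rw [Fin.ext_iff, Fin.val_add_one_of_lt (Fin.lt_last_iff_ne_last.2 h)]
      simp [h, this]
  have hdetS : (1 - S).det = 1 := by
    have hbt : (1 - S).BlockTriangular Prod.fst := by
      rintro ⟨i, r⟩ ⟨j, s⟩ hij
      have h1 : (j : ℕ) < i := hij
      have h2 : (i, r) ≠ (j, s) := by rintro h; simp at h; simp [h.1] at h1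
      have h3 : (j : ℕ) ≠ i + 1 := by omega
      simp [hS, Matrix.one_apply_ne h2, h3]
    rw [hbt.det_fintype]
    refine Finset.prod_eq_one fun i _ => ?_
    have : (1 - S).toSquareBlock Prod.fst i = 1 := by
      ext ⟨⟨a, r⟩, ha⟩ ⟨⟨b, s⟩, hb⟩
      simp only at ha hb
      subst ha
      subst hb
      simp [Matrix.toSquareBlock, Matrix.toSquareBlockProp, hS, Matrix.one_apply]
    rw [this, Matrix.det_one]
  rw [← hfac, Matrix.det_mul, hdetS, one_mul, sub_eq_add_neg, sub_eq_add_neg, ← Matrix.neg_mul,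
    Matrix.det_one_add_mul_comm, Matrix.mul_neg, hWU]

lemma det_cyclicMatrix (x : Fin (k + 1) → ℝ) (A : Fin (k + 1) → Matrix (Fin d) (Fin d) ℝ) :
    (cyclicMatrix x A).det =
      ((∏ i, x i) • (1 : Matrix (Fin d) (Fin d) ℝ) - (List.ofFn A).prod).det := by
  classical
  suffices h : (fun x : Fin (k + 1) → ℝ => (cyclicMatrix x A).det) =
      fun x => ((∏ i, x i) • (1 : Matrix (Fin d) (Fin d) ℝ) - (List.ofFn A).prod).det from
    congrFun h x
  have hdense : Dense (Set.univ.pi fun _ : Fin (k + 1) => ({0}ᶜ : Set ℝ)) :=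
    dense_pi _ fun i _ => dense_compl_singleton 0
  refine Continuous.ext_on hdense ?_ ?_ ?_
  · refine Continuous.matrix_det ?_
    refine continuous_matrix fun p q => ?_
    unfold cyclicMatrix
    split_ifs <;> fun_prop
  · fun_prop
  · intro x hx
    have hx0 : ∀ i, x i ≠ 0 := fun i => by simpa using hx i (Set.mem_univ i)
    have hfac : cyclicMatrix x A = Matrix.diagonal (fun p : Fin (k + 1) × Fin d => x p.1) *
        cyclicMatrix (fun _ => 1) (fun i => (x i)⁻¹ • A i) := by
      ext p q
      rw [Matrix.diagonal_mul]
      unfold cyclicMatrix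
      have := hx0 p.1
      split_ifs <;> simp [this, mul_sub]
    have hprod : ∀ (n : ℕ) (x : Fin n → ℝ) (A : Fin n → Matrix (Fin d) (Fin d) ℝ),
        (List.ofFn fun i => (x i)⁻¹ • A i).prod = (∏ i, x i)⁻¹ • (List.ofFn A).prod := by
      intro n
      induction n with
      | zero => simp
      | succ n ih =>
        intro x A
        rw [List.ofFn_succ, List.prod_cons, ih, List.ofFn_succ, List.prod_cons, Fin.prod_univ_succ,
          smul_mul_smul_comm, mul_inv]
    have hP : (∏ i, x i) ≠ 0 := Finset.prod_ne_zero_iff.2 fun i _ => hx0 i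
    show (cyclicMatrix x A).det =
      ((∏ i, x i) • (1 : Matrix (Fin d) (Fin d) ℝ) - (List.ofFn A).prod).det
    rw [hfac, Matrix.det_mul, det_cyclicMatrix_one, Matrix.det_diagonal, hprod,
      Fintype.prod_prod_type]
    have : (∏ i, x i) • (1 : Matrix (Fin d) (Fin d) ℝ) - (List.ofFn A).prod =
        (∏ i, x i) • (1 - (∏ i, x i)⁻¹ • (List.ofFn A).prod) := by
      rw [smul_sub, smul_smul, mul_inv_cancel₀ hP, one_smul]
    rw [this, Matrix.det_smul]
    simp [Finset.prod_pow]

end CyclicDeterminant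

/-- The determinant of an endomorphism `(u, w) ↦ (u, K u + B w)` is that of `B`. -/
lemma LinearMap.det_eq_of_fst_eq_fst {M N : Type*} [AddCommGroup M] [Module ℝ M]
    [AddCommGroup N] [Module ℝ N] [FiniteDimensional ℝ M] [FiniteDimensional ℝ N]
    (L : M × N →ₗ[ℝ] M × N) (B : N →ₗ[ℝ] N) (h1 : ∀ p, (L p).1 = p.1)
    (h2 : ∀ w, (L (0, w)).2 = B w) : LinearMap.det L = LinearMap.det B := by
  classical
  let b1 := Module.finBasis ℝ M
  let b2 := Module.finBasis ℝ N
  rw [← LinearMap.det_toMatrix (b1.prod b2), ← LinearMap.det_toMatrix b2]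
  have : LinearMap.toMatrix (b1.prod b2) (b1.prod b2) L = Matrix.fromBlocks 1 0
      (Matrix.of fun i j => b2.repr (L (b1 j, 0)).2 i) (LinearMap.toMatrix b2 b2 B) := by
    ext i j
    rcases i with i | i <;> rcases j with j | j <;>
      simp [LinearMap.toMatrix_apply, h1, h2, Matrix.one_apply, Finsupp.single_apply, eq_comm]
  rw [this, Matrix.det_fromBlocks_zero₁₂, Matrix.det_one, one_mul]

section DeflationMap

variable {k d : ℕ}

/-- Block coordinates `(a, w, D)` of a matrix `[[a, w], [*, D]]`. -/
abbrev Block (d : ℕ) : Type := ℝ × (Fin d → ℝ) × (Fin d → Fin d → ℝ)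

/-- The scalars `x_i = a_i + w_i · y_{i+1}`. -/
def chainScalar (ζ : (Fin (k + 1) → Block d) × (Fin (k + 1) → Fin d → ℝ)) (i : Fin (k + 1)) : ℝ :=
  (ζ.1 i).1 + ∑ s, (ζ.1 i).2.1 s * ζ.2 (i + 1) s

/-- The column making `(1, y_{i+1})` be mapped to a multiple of `(1, y_i)` by the `i`-th matrix. -/
def chainColumn (ζ : (Fin (k + 1) → Block d) × (Fin (k + 1) → Fin d → ℝ)) (i : Fin (k + 1))
    (r : Fin d) : ℝ :=
  ζ.2 i r * chainScalar ζ i - ∑ s, (ζ.1 i).2.2 r s * ζ.2 (i + 1) s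

/-- The deflated `d × d` factors `D_i - y_i w_i`. -/
def chainQuotient (ζ : (Fin (k + 1) → Block d) × (Fin (k + 1) → Fin d → ℝ)) (i : Fin (k + 1)) :
    Matrix (Fin d) (Fin d) ℝ :=
  Matrix.of fun r s => (ζ.1 i).2.2 r s - ζ.2 i r * (ζ.1 i).2.1 s

/-- The map replacing the chain of affine eigenvectors by the columns it determines. -/
def deflationMap (ζ : (Fin (k + 1) → Block d) × (Fin (k + 1) → Fin d → ℝ)) :
    (Fin (k + 1) → Block d) × (Fin (k + 1) → Fin d → ℝ) :=
  (ζ.1, chainColumn ζ)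

lemma contDiff_chainScalar (i : Fin (k + 1)) :
    ContDiff ℝ 1 (fun ζ : (Fin (k + 1) → Block d) × (Fin (k + 1) → Fin d → ℝ) =>
      chainScalar ζ i) := by
  unfold chainScalar
  fun_prop

lemma contDiff_chainColumn :
    ContDiff ℝ 1 (chainColumn : (Fin (k + 1) → Block d) × (Fin (k + 1) → Fin d → ℝ) → _) := by
  refine contDiff_pi.2 fun i => contDiff_pi.2 fun r => ?_
  unfold chainColumn
  have := contDiff_chainScalar (d := d) i
  fun_prop

lemma contDiff_deflationMap :
    ContDiff ℝ 1 (deflationMap (k := k) (d := d)) :=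
  contDiff_fst.prodMk contDiff_chainColumn

lemma det_fderiv_deflationMap (ζ : (Fin (k + 1) → Block d) × (Fin (k + 1) → Fin d → ℝ)) :
    (fderiv ℝ deflationMap ζ).det =
      ((∏ i, chainScalar ζ i) • (1 : Matrix (Fin d) (Fin d) ℝ)
        - (List.ofFn (chainQuotient ζ)).prod).det := by
  classical
  rw [← det_cyclicMatrix]
  have hdiff : HasFDerivAt (deflationMap (k := k) (d := d)) (fderiv ℝ deflationMap ζ) ζ :=
    (contDiff_deflationMap.differentiable one_ne_zero ζ).hasFDerivAt
  let e : (Fin (k + 1) × Fin d → ℝ) ≃ₗ[ℝ] (Fin (k + 1) → Fin d → ℝ) :=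
    LinearEquiv.curry ℝ ℝ (Fin (k + 1)) (Fin d)
  let B : (Fin (k + 1) → Fin d → ℝ) →ₗ[ℝ] (Fin (k + 1) → Fin d → ℝ) :=
    (e : _ →ₗ[ℝ] _) ∘ₗ Matrix.toLin' (cyclicMatrix (chainScalar ζ) (chainQuotient ζ)) ∘ₗ
      (e.symm : _ →ₗ[ℝ] _)
  have hB : LinearMap.det B = (cyclicMatrix (chainScalar ζ) (chainQuotient ζ)).det := by
    rw [LinearMap.det_conj, LinearMap.det_toLin']
  rw [← hB]
  refine LinearMap.det_eq_of_fst_eq_fst _ _ ?_ ?_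
  · intro p
    have h2 : HasFDerivAt (fun ζ' => (deflationMap (k := k) (d := d) ζ').1)
        ((ContinuousLinearMap.fst ℝ _ _).comp (fderiv ℝ deflationMap ζ)) ζ :=
      hdiff.fst
    have h3 : HasFDerivAt (fun ζ' => (deflationMap (k := k) (d := d) ζ').1)
        (ContinuousLinearMap.fst ℝ _ _) ζ := hasFDerivAt_fst
    exact DFunLike.congr_fun (h2.unique h3) p
  · intro w
    have hline : HasDerivAt (fun t : ℝ => ζ + t • ((0 : Fin (k + 1) → Block d), w))
        ((0 : Fin (k + 1) → Block d), w) 0 := by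
      simpa using ((hasDerivAt_id (0 : ℝ)).smul_const
        ((0 : Fin (k + 1) → Block d), w)).const_add ζ
    have hcomp : HasDerivAt (fun t : ℝ => deflationMap (ζ + t • ((0 : Fin (k + 1) → Block d), w)))
        (fderiv ℝ deflationMap ζ (0, w)) 0 := by
      have h' : HasFDerivAt (deflationMap (k := k) (d := d)) (fderiv ℝ deflationMap ζ)
          (ζ + (0 : ℝ) • ((0 : Fin (k + 1) → Block d), w)) := by
        rw [zero_smul, add_zero]; exact hdiff
      exact h'.comp_hasDerivAt (0 : ℝ) hline
    have hsnd := hcomp.snd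
    ext i r
    have hir := hasDerivAt_pi.1 (hasDerivAt_pi.1 hsnd i) r
    have hx : HasDerivAt (fun t : ℝ => chainScalar (ζ + t • ((0 : Fin (k + 1) → Block d), w)) i)
        (∑ s, (ζ.1 i).2.1 s * w (i + 1) s) 0 := by
      simp only [chainScalar, Prod.fst_add, Prod.snd_add, Prod.smul_fst, Prod.smul_snd,
        Pi.add_apply, Pi.smul_apply, smul_zero, smul_eq_mul]
      refine HasDerivAt.const_add _ (HasDerivAt.fun_sum fun s _ => ?_)
      simpa using (((hasDerivAt_id (0 : ℝ)).mul_const (w (i + 1) s)).const_add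
        (ζ.2 (i + 1) s)).const_mul ((ζ.1 i).2.1 s)
    have hD : HasDerivAt (fun t : ℝ => ∑ s, (ζ.1 i).2.2 r s * (ζ.2 (i + 1) s + t * w (i + 1) s))
        (∑ s, (ζ.1 i).2.2 r s * w (i + 1) s) 0 := by
      refine HasDerivAt.fun_sum fun s _ => ?_
      simpa using (((hasDerivAt_id (0 : ℝ)).mul_const (w (i + 1) s)).const_add
        (ζ.2 (i + 1) s)).const_mul ((ζ.1 i).2.2 r s)
    have hy : HasDerivAt (fun t : ℝ => ζ.2 i r + t * w i r) (w i r) 0 := by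
      simpa using ((hasDerivAt_id (0 : ℝ)).mul_const (w i r)).const_add (ζ.2 i r)
    have htot := (hy.mul hx).sub hD
    have huniq := hir.unique (htot.congr_of_eventuallyEq (Eventually.of_forall fun t => by
      simp [deflationMap, chainColumn]))
    refine huniq.trans ?_
    have hBw : B w i r = ∑ q : Fin (k + 1) × Fin d,
        cyclicMatrix (chainScalar ζ) (chainQuotient ζ) (i, r) q * w q.1 q.2 := by
      simp only [B, LinearMap.comp_apply, Matrix.toLin'_apply]
      rfl
    have h1 : ∑ q : Fin (k + 1) × Fin d, (if (i, r) = q then chainScalar ζ i else 0) * w q.1 q.2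
        = chainScalar ζ i * w i r := by
      simp [ite_mul]
    have h2 : ∑ q : Fin (k + 1) × Fin d,
        (if q.1 = i + 1 then chainQuotient ζ i r q.2 else 0) * w q.1 q.2
        = ∑ s, chainQuotient ζ i r s * w (i + 1) s := by
      rw [Fintype.sum_prod_type, Finset.sum_eq_single (i + 1)]
      · simp
      · intro j _ hj
        simp [hj]
      · simp
    rw [hBw]
    simp only [cyclicMatrix, sub_mul, Finset.sum_sub_distrib]
    rw [h1, h2]
    simp only [chainQuotient, Matrix.of_apply, sub_mul, Finset.sum_sub_distrib, zero_smul,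
      add_zero, zero_mul, mul_assoc, ← Finset.mul_sum]
    ring

end DeflationMap

section Chain

variable {n : ℕ}

/-- Telescoping of an intertwining relation along a product. -/
lemma list_ofFn_prod_mul_of_chain {R : Type*} [Monoid R] :
    ∀ {m : ℕ} (M T : Fin m → R) (U : ℕ → R), (∀ i : Fin m, M i * U (i + 1) = U i * T i) →
      (List.ofFn M).prod * U m = U 0 * (List.ofFn T).prod
  | 0, M, T, U, _ => by simp
  | m + 1, M, T, U, h => by
    have ih := list_ofFn_prod_mul_of_chain (fun i => M i.succ) (fun i => T i.succ)
      (fun j => U (j + 1)) (fun i => by simpa using h i.succ)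
    have h0 := h 0
    simp only [Fin.val_zero, zero_add] at h0 ih
    rw [List.ofFn_succ, List.ofFn_succ, List.prod_cons, List.prod_cons, mul_assoc, ih,
      ← mul_assoc, h0, mul_assoc]

/-- Telescoping of a chain of vectors along a product of matrices. -/
lemma list_ofFn_prod_mulVec_of_chain {ι : Type*} [Fintype ι] [DecidableEq ι] :
    ∀ {m : ℕ} (M : Fin m → Matrix ι ι ℝ) (x : Fin m → ℝ) (u : ℕ → ι → ℝ),
      (∀ i : Fin m, (M i).mulVec (u (i + 1)) = x i • u i) →
      (List.ofFn M).prod.mulVec (u m) = (∏ i, x i) • u 0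
  | 0, M, x, u, _ => by simp
  | m + 1, M, x, u, h => by
    have ih := list_ofFn_prod_mulVec_of_chain (fun i => M i.succ) (fun i => x i.succ)
      (fun j => u (j + 1)) (fun i => by simpa using h i.succ)
    have h0 := h 0
    simp only [Fin.val_zero, zero_add] at h0 ih
    rw [List.ofFn_succ, List.prod_cons, ← Matrix.mulVec_mulVec, ih, Matrix.mulVec_smul, h0,
      Fin.prod_univ_succ, smul_smul, mul_comm]

lemma charpoly_ofFn_prod_eq_of_chain {ι : Type*} [Fintype ι] [DecidableEq ι] {m : ℕ}
    (M T : Fin m → Matrix ι ι ℝ) (U : ℕ → (Matrix ι ι ℝ)ˣ) (hU : U m = U 0)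
    (h : ∀ i : Fin m, M i * (U (i + 1) : Matrix ι ι ℝ) = U i * T i) :
    (List.ofFn M).prod.charpoly = (List.ofFn T).prod.charpoly := by
  have h1 := list_ofFn_prod_mul_of_chain M T (fun j => (U j : Matrix ι ι ℝ)) h
  simp only [hU] at h1
  rw [← Units.eq_mul_inv_iff_mul_eq] at h1
  generalize (List.ofFn M).prod = P at h1 ⊢
  generalize (List.ofFn T).prod = S at h1 ⊢
  rw [h1, Matrix.coe_units_inv, Matrix.charpoly_units_conj]

/-- The matrix `[[a, w], [c, D]]`. -/
def blockMatrix {d : ℕ} (a : ℝ) (w c : Fin d → ℝ) (D : Matrix (Fin d) (Fin d) ℝ) :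
    Matrix (Fin (d + 1)) (Fin (d + 1)) ℝ :=
  Matrix.of (Fin.cons (Fin.cons a w) fun r => Fin.cons (c r) (D r) :
    Fin (d + 1) → Fin (d + 1) → ℝ)

@[simp] lemma blockMatrix_zero_zero {d : ℕ} (a : ℝ) (w c : Fin d → ℝ) (D : Matrix (Fin d) (Fin d) ℝ) :
    blockMatrix a w c D 0 0 = a := rfl
@[simp] lemma blockMatrix_zero_succ {d : ℕ} (a : ℝ) (w c : Fin d → ℝ) (D : Matrix (Fin d) (Fin d) ℝ)
    (s : Fin d) : blockMatrix a w c D 0 s.succ = w s := rfl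
@[simp] lemma blockMatrix_succ_zero {d : ℕ} (a : ℝ) (w c : Fin d → ℝ) (D : Matrix (Fin d) (Fin d) ℝ)
    (r : Fin d) : blockMatrix a w c D r.succ 0 = c r := rfl
@[simp] lemma blockMatrix_succ_succ {d : ℕ} (a : ℝ) (w c : Fin d → ℝ) (D : Matrix (Fin d) (Fin d) ℝ)
    (r s : Fin d) : blockMatrix a w c D r.succ s.succ = D r s := rfl

lemma ext_blocks {d : ℕ} {A B : Matrix (Fin (d + 1)) (Fin (d + 1)) ℝ} (h00 : A 0 0 = B 0 0)
    (h01 : ∀ s : Fin d, A 0 s.succ = B 0 s.succ) (h10 : ∀ r : Fin d, A r.succ 0 = B r.succ 0)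
    (h11 : ∀ r s : Fin d, A r.succ s.succ = B r.succ s.succ) : A = B := by
  ext i j
  refine Fin.cases ?_ (fun r => ?_) i <;> refine Fin.cases ?_ (fun s => ?_) j
  exacts [h00, h01 s, h10 r, h11 r s]

lemma blockMatrix_mul {d : ℕ} (a a' : ℝ) (w c w' c' : Fin d → ℝ) (D D' : Matrix (Fin d) (Fin d) ℝ) :
    blockMatrix a w c D * blockMatrix a' w' c' D' =
      blockMatrix (a * a' + ∑ s, w s * c' s) (fun s => a * w' s + ∑ t, w t * D' t s)
        (fun r => c r * a' + ∑ t, D r t * c' t)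
        (Matrix.of fun r s => c r * w' s + ∑ t, D r t * D' t s) := by
  apply ext_blocks <;> intros <;> simp [Matrix.mul_apply, Fin.sum_univ_succ]

lemma blockMatrix_one {d : ℕ} :
    (1 : Matrix (Fin (d + 1)) (Fin (d + 1)) ℝ) = blockMatrix 1 0 0 1 := by
  apply ext_blocks <;> intros <;> simp [Matrix.one_apply, Fin.succ_ne_zero, (Fin.succ_ne_zero _).symm]

lemma charpoly_blockMatrix_zero {d : ℕ} (a : ℝ) (w : Fin d → ℝ) (D : Matrix (Fin d) (Fin d) ℝ) :
    (blockMatrix a w 0 D).charpoly = (Polynomial.X - Polynomial.C a) * D.charpoly := by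
  rw [Matrix.charpoly, Matrix.det_succ_column_zero, Fin.sum_univ_succ]
  rw [Finset.sum_eq_zero]
  · simp only [Fin.val_zero, pow_zero, one_mul, add_zero, Matrix.charmatrix_apply_eq,
      blockMatrix_zero_zero]
    congr 1
    rw [Matrix.charpoly]
    congr 1
    ext r s : 2
    simp [Matrix.charmatrix_apply, Matrix.diagonal_apply]
  · intro r _
    rw [Matrix.charmatrix_apply_ne _ _ _ (Fin.succ_ne_zero r)]
    simp

/-- A product of upper block triangular matrices. -/
lemma exists_ofFn_blockMatrix_prod {d : ℕ} : ∀ {m : ℕ} (x : Fin m → ℝ) (w : Fin m → Fin d → ℝ)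
    (A : Fin m → Matrix (Fin d) (Fin d) ℝ), ∃ u : Fin d → ℝ,
      (List.ofFn fun i => blockMatrix (x i) (w i) 0 (A i)).prod =
        blockMatrix (∏ i, x i) u 0 (List.ofFn A).prod
  | 0, x, w, A => ⟨0, by simpa using blockMatrix_one⟩
  | m + 1, x, w, A => by
    obtain ⟨u, hu⟩ := exists_ofFn_blockMatrix_prod (fun i => x i.succ) (fun i => w i.succ)
      (fun i => A i.succ)
    rw [List.ofFn_succ, List.prod_cons, hu, blockMatrix_mul]
    refine ⟨fun s => x 0 * u s + ∑ t, w 0 t * (List.ofFn fun i => A i.succ).prod t s, ?_⟩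
    apply ext_blocks
    · simp [Fin.prod_univ_succ]
    · intro s
      exact rfl
    · intro r; simp
    · intro r s
      simp [List.ofFn_succ, Matrix.mul_apply]

lemma charpoly_ofFn_blockMatrix_prod {d m : ℕ} (x : Fin m → ℝ) (w : Fin m → Fin d → ℝ)
    (A : Fin m → Matrix (Fin d) (Fin d) ℝ) :
      (List.ofFn fun i => blockMatrix (x i) (w i) 0 (A i)).prod.charpoly =
        (Polynomial.X - Polynomial.C (∏ i, x i)) * (List.ofFn A).prod.charpoly := by
  obtain ⟨u, hu⟩ := exists_ofFn_blockMatrix_prod x w A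
  rw [hu, charpoly_blockMatrix_zero]

end Chain

section Assemble

variable {k d : ℕ}

lemma Fin.ofNat_val_self (i : Fin (k + 1)) : Fin.ofNat (k + 1) i = i :=
  Fin.ext (Nat.mod_eq_of_lt i.isLt)

lemma Fin.ofNat_val_succ (i : Fin (k + 1)) : Fin.ofNat (k + 1) (i + 1) = i + 1 :=
  Fin.ext (by simp [Fin.val_add])

/-- The matrices `[[a_i, w_i], [c_i, D_i]]` with given blocks and columns. -/
def assemble (c : (Fin (k + 1) → Block d) × (Fin (k + 1) → Fin d → ℝ)) (i : Fin (k + 1)) :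
    Matrix (Fin (d + 1)) (Fin (d + 1)) ℝ :=
  blockMatrix (c.1 i).1 (c.1 i).2.1 (c.2 i) (Matrix.of (c.1 i).2.2)

/-- The unipotent matrix `[[1, 0], [y, 1]]`. -/
def unipotentColumn (y : Fin d → ℝ) : (Matrix (Fin (d + 1)) (Fin (d + 1)) ℝ)ˣ where
  val := blockMatrix 1 0 y 1
  inv := blockMatrix 1 0 (-y) 1
  val_inv := by
    rw [blockMatrix_mul, blockMatrix_one]
    apply ext_blocks <;> intros <;> simp [Matrix.one_apply]
  inv_val := by
    rw [blockMatrix_mul, blockMatrix_one]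
    apply ext_blocks <;> intros <;> simp [Matrix.one_apply]

lemma assemble_deflationMap_mul_unipotentColumn
    (ζ : (Fin (k + 1) → Block d) × (Fin (k + 1) → Fin d → ℝ)) (i : Fin (k + 1)) :
    assemble (deflationMap ζ) i * (unipotentColumn (ζ.2 (i + 1))).val =
      (unipotentColumn (ζ.2 i)).val *
        blockMatrix (chainScalar ζ i) (ζ.1 i).2.1 0 (chainQuotient ζ i) := by
  simp only [assemble, unipotentColumn, blockMatrix_mul]
  apply ext_blocks <;> intros <;>
    simp [deflationMap, chainScalar, chainQuotient, chainColumn, Matrix.one_apply]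

lemma charpoly_assemble_deflationMap (ζ : (Fin (k + 1) → Block d) × (Fin (k + 1) → Fin d → ℝ)) :
    (List.ofFn (assemble (deflationMap ζ))).prod.charpoly =
      (Polynomial.X - Polynomial.C (∏ i, chainScalar ζ i)) *
        (List.ofFn (chainQuotient ζ)).prod.charpoly := by
  rw [← charpoly_ofFn_blockMatrix_prod _ fun i => (ζ.1 i).2.1]
  refine charpoly_ofFn_prod_eq_of_chain _ _
    (fun j => unipotentColumn (ζ.2 (Fin.ofNat (k + 1) j))) ?_ fun i => ?_
  · rw [Fin.ofNat_self]
    rfl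
  · rw [Fin.ofNat_val_succ, Fin.ofNat_val_self]
    exact assemble_deflationMap_mul_unipotentColumn ζ i

end Assemble

section Fibre

variable {k d : ℕ}

/-- The cyclic product `M_i M_{i+1} ⋯ M_{i-1}`. -/
def cyclicProd (M : Fin (k + 1) → Matrix (Fin (d + 1)) (Fin (d + 1)) ℝ) (i : Fin (k + 1)) :
    Matrix (Fin (d + 1)) (Fin (d + 1)) ℝ :=
  (List.ofFn fun j => M (i + j)).prod

/-- The observability matrix with rows `e₀ᵀ P^j`. -/
def observability (P : Matrix (Fin (d + 1)) (Fin (d + 1)) ℝ) :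
    Matrix (Fin (d + 1)) (Fin (d + 1)) ℝ :=
  Matrix.of fun j s => (P ^ (j : ℕ)) 0 s

/-- Invertibility of all factors and observability of all cyclic products. -/
def GenericFactors (M : Fin (k + 1) → Matrix (Fin (d + 1)) (Fin (d + 1)) ℝ) : Prop :=
  ∀ i, (M i).det ≠ 0 ∧ (observability (cyclicProd M i)).det ≠ 0

lemma eq_zero_of_observability {P : Matrix (Fin (d + 1)) (Fin (d + 1)) ℝ}
    (hP : (observability P).det ≠ 0) {l : ℝ} {u : Fin (d + 1) → ℝ} (hu : P.mulVec u = l • u)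
    (h0 : u 0 = 0) : u = 0 := by
  refine Matrix.eq_zero_of_mulVec_eq_zero hP ?_
  ext j
  have hpow : ∀ j : ℕ, (P ^ j).mulVec u = l ^ j • u := by
    intro j
    induction j with
    | zero => simp
    | succ j ih => rw [pow_succ, ← Matrix.mulVec_mulVec, hu, Matrix.mulVec_smul, ih, smul_smul,
        pow_succ, mul_comm]
  have := congrFun (hpow j) 0
  simp only [Pi.smul_apply, h0, smul_zero] at this
  exact this

lemma cyclicProd_mulVec_of_chain (M : Fin (k + 1) → Matrix (Fin (d + 1)) (Fin (d + 1)) ℝ)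
    (x : Fin (k + 1) → ℝ) (u : Fin (k + 1) → Fin (d + 1) → ℝ)
    (h : ∀ i, (M i).mulVec (u (i + 1)) = x i • u i) (i : Fin (k + 1)) :
    (cyclicProd M i).mulVec (u i) = (∏ i, x i) • u i := by
  have := list_ofFn_prod_mulVec_of_chain (fun j => M (i + j)) (fun j => x (i + j))
    (fun j => u (i + Fin.ofNat (k + 1) j)) (fun j => by
      rw [Fin.ofNat_val_succ, Fin.ofNat_val_self, ← add_assoc]
      exact h _)
  rw [Fin.ofNat_self, show Fin.ofNat (k + 1) 0 = 0 from rfl, add_zero] at this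
  have hprod : ∏ j, x (i + j) = ∏ j, x j := Equiv.prod_comp (Equiv.addLeft i) x
  rw [cyclicProd, this, hprod]

lemma assemble_deflationMap_mulVec (ζ : (Fin (k + 1) → Block d) × (Fin (k + 1) → Fin d → ℝ))
    (i : Fin (k + 1)) :
    (assemble (deflationMap ζ) i).mulVec (Fin.cons 1 (ζ.2 (i + 1)) : Fin (d + 1) → ℝ) =
      chainScalar ζ i • (Fin.cons 1 (ζ.2 i) : Fin (d + 1) → ℝ) := by
  ext r
  refine Fin.cases ?_ (fun r => ?_) r <;>
    simp [Matrix.mulVec, dotProduct, Fin.sum_univ_succ, assemble, deflationMap, chainScalar,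
      chainColumn]
  ring

lemma deflationMap_eq_of_chain (c : (Fin (k + 1) → Block d) × (Fin (k + 1) → Fin d → ℝ))
    (y : Fin (k + 1) → Fin d → ℝ) (t : Fin (k + 1) → ℝ)
    (h : ∀ i, (assemble c i).mulVec (Fin.cons 1 (y (i + 1)) : Fin (d + 1) → ℝ) =
      t i • (Fin.cons 1 (y i) : Fin (d + 1) → ℝ)) :
    deflationMap (c.1, y) = c ∧ ∀ i, chainScalar (c.1, y) i = t i := by
  have h1 : ∀ i, chainScalar (c.1, y) i = t i := by
    intro i
    have := congrFun (h i) 0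
    simpa [Matrix.mulVec, dotProduct, Fin.sum_univ_succ, assemble, chainScalar] using this
  refine ⟨?_, h1⟩
  refine Prod.ext rfl ?_
  ext i r
  have := congrFun (h i) r.succ
  simp only [Matrix.mulVec, dotProduct, Fin.sum_univ_succ, assemble, blockMatrix_succ_zero,
    Fin.cons_zero, mul_one, blockMatrix_succ_succ, Matrix.of_apply, Fin.cons_succ, Pi.smul_apply,
    smul_eq_mul] at this
  simp only [deflationMap, chainColumn, h1]
  linarith

lemma exists_chain_of_root (M : Fin (k + 1) → Matrix (Fin (d + 1)) (Fin (d + 1)) ℝ)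
    (hM : ∀ i, (M i).det ≠ 0) {l : ℝ} (hl : (List.ofFn M).prod.charpoly.IsRoot l) :
    ∃ (x : Fin (k + 1) → ℝ) (u : Fin (k + 1) → Fin (d + 1) → ℝ),
      (∀ i, (M i).mulVec (u (i + 1)) = x i • u i) ∧ ∏ i, x i = l ∧ ∀ i, u i ≠ 0 := by
  classical
  rw [Polynomial.IsRoot, Matrix.eval_charpoly, ← Matrix.exists_mulVec_eq_zero_iff] at hl
  obtain ⟨u0, hu0, hP⟩ := hl
  have hP' : (List.ofFn M).prod.mulVec u0 = l • u0 := by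
    rw [Matrix.sub_mulVec, sub_eq_zero] at hP
    rw [← hP]
    ext r
    simp [Matrix.mulVec_diagonal]
  have hdet : (List.ofFn M).prod.det ≠ 0 := by
    have : (List.ofFn M).prod.det = ((List.ofFn M).map Matrix.det).prod :=
      map_list_prod (Matrix.detMonoidHom) _
    rw [this, List.map_ofFn, List.prod_ofFn]
    exact Finset.prod_ne_zero_iff.2 fun i _ => hM i
  have hl0 : l • u0 ≠ 0 := by
    rw [← hP']
    exact fun h => hu0 (Matrix.eq_zero_of_mulVec_eq_zero hdet h)
  let w : ℕ → Fin (d + 1) → ℝ := fun j => ((List.ofFn M).drop j).prod.mulVec u0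
  have hw0 : w 0 = l • u0 := by simpa [w] using hP'
  have hwl : w (k + 1) = u0 := by
    have : (List.ofFn M).drop (k + 1) = [] := List.drop_of_length_le (by simp)
    simp only [w]
    rw [this, List.prod_nil, Matrix.one_mulVec]
  have hws : ∀ i : Fin (k + 1), (M i).mulVec (w (i + 1)) = w i := by
    intro i
    simp only [w]
    rw [List.drop_eq_getElem_cons (i := i) (by rw [List.length_ofFn]; exact i.isLt),
      List.prod_cons, ← Matrix.mulVec_mulVec, List.getElem_ofFn]
  refine ⟨fun i => if i = Fin.last k then l else 1, fun i => w i, fun i => ?_, ?_, fun i hi => ?_⟩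
  · by_cases h : i = Fin.last k
    · subst h
      have := hws (Fin.last k)
      simp only [Fin.val_last, hwl] at this
      simp only [if_true, Fin.last_add_one, Fin.val_zero, Fin.val_last, hw0, Matrix.mulVec_smul]
      rw [this]
    · have hv : ((i + 1 : Fin (k + 1)) : ℕ) = i + 1 :=
        Fin.val_add_one_of_lt (Fin.lt_last_iff_ne_last.2 h)
      simp only [h, if_false, hv, hws, one_smul]
  · simp
  · apply hl0
    rw [← hw0]
    have := List.prod_take_mul_prod_drop (List.ofFn M) i
    simp only [w, List.drop_zero]
    rw [← this, ← Matrix.mulVec_mulVec]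
    simp only [w] at hi
    rw [hi, Matrix.mulVec_zero]

/-- For generic factors, the eigenvector chains over a given matrix family correspond to the
real roots of the characteristic polynomial of the product. -/
lemma bijOn_fibre_roots (c : (Fin (k + 1) → Block d) × (Fin (k + 1) → Fin d → ℝ))
    (hc : GenericFactors (assemble c)) :
    Set.BijOn (fun ζ => ∏ i, chainScalar ζ i) (deflationMap ⁻¹' {c})
      {l | (List.ofFn (assemble c)).prod.charpoly.IsRoot l} := by
  refine ⟨?_, ?_, ?_⟩
  · rintro ζ rfl
    change (List.ofFn (assemble (deflationMap ζ))).prod.charpoly.IsRoot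
      (∏ i, chainScalar ζ i)
    rw [charpoly_assemble_deflationMap]
    generalize ∏ i, chainScalar ζ i = l
    generalize (List.ofFn (chainQuotient ζ)).prod.charpoly = q
    simp
  · intro ζ hζ ζ' hζ' h
    simp only [Set.mem_preimage, Set.mem_singleton_iff] at hζ hζ'
    have h1 : ζ.1 = ζ'.1 := (congrArg Prod.fst hζ).trans (congrArg Prod.fst hζ').symm
    refine Prod.ext h1 ?_
    funext i
    have e1 := cyclicProd_mulVec_of_chain _ _ (fun j => (Fin.cons 1 (ζ.2 j) : Fin (d + 1) → ℝ))
      (assemble_deflationMap_mulVec ζ) i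
    have e2 := cyclicProd_mulVec_of_chain _ _ (fun j => (Fin.cons 1 (ζ'.2 j) : Fin (d + 1) → ℝ))
      (assemble_deflationMap_mulVec ζ') i
    rw [hζ] at e1
    beta_reduce at h
    rw [hζ', ← h] at e2
    have := eq_zero_of_observability (hc i).2
      (u := (Fin.cons 1 (ζ.2 i) : Fin (d + 1) → ℝ) - Fin.cons 1 (ζ'.2 i))
      (by rw [Matrix.mulVec_sub, e1, e2, smul_sub]) (by simp)
    rw [sub_eq_zero] at this
    exact (Fin.cons_right_injective _ this)
  · intro l hl
    obtain ⟨x, u, hu, hx, hne⟩ := exists_chain_of_root (assemble c) (fun i => (hc i).1) hl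
    have hh : ∀ i, u i 0 ≠ 0 := fun i h => hne i
      (eq_zero_of_observability (hc i).2 (cyclicProd_mulVec_of_chain _ _ _ hu i) h)
    let y : Fin (k + 1) → Fin d → ℝ := fun i r => u i r.succ / u i 0
    have hy : ∀ i, (Fin.cons 1 (y i) : Fin (d + 1) → ℝ) = (u i 0)⁻¹ • u i := by
      intro i
      ext r
      refine Fin.cases ?_ (fun r => ?_) r
      · simp [hh i]
      · simp [y, div_eq_inv_mul]
    have := deflationMap_eq_of_chain c y (fun i => x i * u i 0 / u (i + 1) 0) (fun i => by
      rw [hy, hy, Matrix.mulVec_smul, hu, smul_smul, smul_smul]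
      congr 1
      field_simp [hh i, hh (i + 1)])
    refine ⟨(c.1, y), this.1, ?_⟩
    simp only [this.2]
    have hprod : ∏ i, u (i + 1) 0 = ∏ i, u i 0 :=
      Equiv.prod_comp (Equiv.addRight 1) (fun i => u i 0)
    rw [Finset.prod_div_distrib, Finset.prod_mul_distrib, hx, hprod]
    exact mul_div_cancel_right₀ _ (Finset.prod_ne_zero_iff.2 fun i _ => hh i)

lemma nodup_roots_of_derivative_ne_zero {p : Polynomial ℝ} (hp : p ≠ 0)
    (h : ∀ x ∈ p.roots, p.derivative.eval x ≠ 0) : p.roots.Nodup := by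
  classical
  rw [Multiset.nodup_iff_count_le_one]
  intro x
  rw [Polynomial.count_roots]
  by_contra! hx
  rw [Polynomial.one_lt_rootMultiplicity_iff_isRoot hp] at hx
  exact h x ((Polynomial.mem_roots hp).2 hx.1) hx.2

lemma eval_charpoly_eq_det {ι : Type*} [Fintype ι] [DecidableEq ι] (A : Matrix ι ι ℝ) (x : ℝ) :
    A.charpoly.eval x = (x • (1 : Matrix ι ι ℝ) - A).det := by
  rw [Matrix.eval_charpoly, Matrix.smul_one_eq_diagonal]
  rfl

lemma sum_roots_eq_tsum_fibre (c : (Fin (k + 1) → Block d) × (Fin (k + 1) → Fin d → ℝ))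
    (hc : GenericFactors (assemble c))
    (hreg : ∀ ζ, deflationMap ζ = c → (fderiv ℝ deflationMap ζ).det ≠ 0) :
    (∀ x ∈ (List.ofFn (assemble c)).prod.charpoly.roots,
      (List.ofFn (assemble c)).prod.charpoly.derivative.eval x ≠ 0) ∧
    ∀ h : ℝ → ENNReal, ((List.ofFn (assemble c)).prod.charpoly.roots.map h).sum =
      ∑' ζ : (deflationMap (k := k) (d := d)) ⁻¹' {c}, h (∏ i, chainScalar ζ.1 i) := by
  classical
  have hbij := bijOn_fibre_roots c hc
  have hp : (List.ofFn (assemble c)).prod.charpoly ≠ 0 := (Matrix.charpoly_monic _).ne_zero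
  have hder : ∀ x ∈ (List.ofFn (assemble c)).prod.charpoly.roots,
      (List.ofFn (assemble c)).prod.charpoly.derivative.eval x ≠ 0 := by
    intro x hx
    obtain ⟨ζ, hζ, rfl⟩ := hbij.surjOn ((Polynomial.mem_roots hp).1 hx)
    have hζ' : deflationMap ζ = c := hζ
    have hr := hreg ζ hζ
    rw [det_fderiv_deflationMap, ← eval_charpoly_eq_det] at hr
    rw [← hζ', charpoly_assemble_deflationMap]
    beta_reduce
    generalize ∏ i, chainScalar ζ i = l at hr ⊢
    generalize (List.ofFn (chainQuotient ζ)).prod.charpoly = q at hr ⊢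
    simpa using hr
  refine ⟨hder, fun h => ?_⟩
  have hnd := nodup_roots_of_derivative_ne_zero hp hder
  set p := (List.ofFn (assemble c)).prod.charpoly with hpdef
  have hset : {l | p.IsRoot l} = (↑p.roots.toFinset : Set ℝ) := by
    ext l
    simp [hp]
  rw [hset] at hbij
  have e1 : (p.roots.map h).sum = ∑ x ∈ p.roots.toFinset, h x := by
    rw [Finset.sum, Multiset.toFinset_val, hnd.dedup]
  rw [e1, ← Finset.tsum_subtype]
  exact (Equiv.tsum_eq hbij.equiv (fun x : p.roots.toFinset => h x)).symm

end Fibre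

/-- An analytic homogeneous function that is not identically zero vanishes only on a null set. -/
lemma ae_ne_zero_of_homogeneous {E : Type*} [NormedAddCommGroup E] [NormedSpace ℝ E]
    [FiniteDimensional ℝ E] [MeasurableSpace E] [BorelSpace E] (μ : Measure E)
    [μ.IsAddHaarMeasure] {F : E → ℝ} (hF : ContDiff ℝ ⊤ F) (D : ℕ)
    (hhom : ∀ (s : ℝ) x, F (s • x) = s ^ D * F x) {v : E} (hv : F v ≠ 0) :
    ∀ᵐ x ∂μ, F x ≠ 0 := by
  let L : ℝ →ₗ[ℝ] E := LinearMap.toSpanSingleton ℝ E v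
  have hmeas : MeasurableSet {x | F x ≠ 0} :=
    (isOpen_ne_fun hF.continuous continuous_const).measurableSet
  refine ae_mem_of_ae_add_linearMap_mem L volume μ hmeas fun y => ?_
  have han : AnalyticOnNhd ℝ (fun t : ℝ => F (y + t • v)) Set.univ := by
    refine ContDiff.analyticOnNhd ?_
    exact hF.comp (contDiff_const.add (contDiff_id.smul contDiff_const))
  obtain ⟨t, ht⟩ : ∃ t : ℝ, F (y + t • v) ≠ 0 := by
    have hcont : ContinuousAt (fun s : ℝ => F (s • y + v)) 0 :=
      (hF.continuous.comp ((continuous_id.smul continuous_const).add continuous_const)).continuousAt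
    have h0 : (fun s : ℝ => F (s • y + v)) 0 ≠ 0 := by simpa using hv
    have hev := hcont.eventually_ne h0
    have hev' : ∀ᶠ s in nhdsWithin (0 : ℝ) {0}ᶜ, F (s • y + v) ≠ 0 :=
      hev.filter_mono nhdsWithin_le_nhds
    obtain ⟨s, hs, hs0⟩ := (hev'.and self_mem_nhdsWithin).exists
    refine ⟨s⁻¹, fun h => hs ?_⟩
    have hs0' : s ≠ 0 := hs0
    have : s • y + v = s • (y + s⁻¹ • v) := by
      rw [smul_add, smul_smul, mul_inv_cancel₀ hs0', one_smul]
    rw [this, hhom, h, mul_zero]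
  have hcod := han.preimage_zero_mem_codiscrete (x := t) ht
  have hle := ae_restrict_le_codiscreteWithin (μ := (volume : Measure ℝ)) MeasurableSet.univ
  rw [Measure.restrict_univ] at hle
  filter_upwards [hle hcod] with s hs
  change F (y + L s) ≠ 0
  simpa [L] using hs

section HaarInstances

lemma isAddHaarMeasure_volume_pi_const (ι α : Type*) [Fintype ι] [AddGroup α] [TopologicalSpace α]
    [MeasureSpace α] [SigmaFinite (volume : Measure α)] [MeasurableAdd α]
    [(volume : Measure α).IsAddHaarMeasure] : (volume : Measure (ι → α)).IsAddHaarMeasure :=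
  Measure.pi.isAddHaarMeasure fun _ => volume

lemma isAddHaarMeasure_volume_prod (α β : Type*) [AddGroup α] [TopologicalSpace α]
    [MeasureSpace α] [SFinite (volume : Measure α)] [MeasurableAdd α]
    [(volume : Measure α).IsAddHaarMeasure] [AddGroup β] [TopologicalSpace β] [MeasureSpace β]
    [SFinite (volume : Measure β)] [MeasurableAdd β] [(volume : Measure β).IsAddHaarMeasure] :
    (volume : Measure (α × β)).IsAddHaarMeasure :=
  Measure.prod.instIsAddHaarMeasure volume volume

instance isAddHaarMeasure_volume_array₂ (d e : ℕ) :
    (volume : Measure (Fin d → Fin e → ℝ)).IsAddHaarMeasure :=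
  isAddHaarMeasure_volume_pi_const _ _

instance isAddHaarMeasure_volume_array₃ (k d e : ℕ) :
    (volume : Measure (Fin k → Fin d → Fin e → ℝ)).IsAddHaarMeasure :=
  isAddHaarMeasure_volume_pi_const _ _

instance isAddHaarMeasure_volume_rowBlock (d : ℕ) :
    (volume : Measure ((Fin d → ℝ) × (Fin d → Fin d → ℝ))).IsAddHaarMeasure :=
  isAddHaarMeasure_volume_prod _ _

instance isAddHaarMeasure_volume_block (d : ℕ) : (volume : Measure (Block d)).IsAddHaarMeasure :=
  isAddHaarMeasure_volume_prod _ _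

instance isAddHaarMeasure_volume_blocks (k d : ℕ) :
    (volume : Measure (Fin (k + 1) → Block d)).IsAddHaarMeasure :=
  isAddHaarMeasure_volume_pi_const _ _

instance isAddHaarMeasure_volume_blocks_prod (k d : ℕ) :
    (volume : Measure ((Fin (k + 1) → Block d) × (Fin (k + 1) → Fin d → ℝ))).IsAddHaarMeasure :=
  isAddHaarMeasure_volume_prod _ _

end HaarInstances

section EntrywiseSmooth

variable {E : Type*} [NormedAddCommGroup E] [NormedSpace ℝ E] {ι : Type*} [Fintype ι]
  [DecidableEq ι] {r : WithTop ℕ∞}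

lemma contDiff_entries_mul {E ι : Type*} [NormedAddCommGroup E] [NormedSpace ℝ E] [Fintype ι]
    {r : WithTop ℕ∞} {A B : E → Matrix ι ι ℝ} (hA : ∀ i j, ContDiff ℝ r fun x => A x i j)
    (hB : ∀ i j, ContDiff ℝ r fun x => B x i j) (i j : ι) :
    ContDiff ℝ r fun x => (A x * B x) i j := by
  simp only [Matrix.mul_apply]
  exact ContDiff.sum fun l _ => (hA i l).mul (hB l j)

lemma contDiff_entries_ofFn_prod : ∀ {m : ℕ} {A : E → Fin m → Matrix ι ι ℝ},
    (∀ l i j, ContDiff ℝ r fun x => A x l i j) → ∀ i j,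
      ContDiff ℝ r fun x => (List.ofFn (A x)).prod i j
  | 0, A, _, i, j => by simpa using contDiff_const
  | m + 1, A, h, i, j => by
    simp only [List.ofFn_succ, List.prod_cons]
    exact contDiff_entries_mul (h 0) (contDiff_entries_ofFn_prod fun l => h l.succ) i j

lemma contDiff_entries_pow {A : E → Matrix ι ι ℝ} (hA : ∀ i j, ContDiff ℝ r fun x => A x i j) :
    ∀ (m : ℕ) (i j : ι), ContDiff ℝ r fun x => (A x ^ m) i j
  | 0, i, j => by simpa using contDiff_const
  | m + 1, i, j => by
    simp only [pow_succ]
    exact contDiff_entries_mul (contDiff_entries_pow hA m) hA i j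

lemma contDiff_det_of_entries {A : E → Matrix ι ι ℝ} (hA : ∀ i j, ContDiff ℝ r fun x => A x i j) :
    ContDiff ℝ r fun x => (A x).det := by
  simp only [Matrix.det_apply]
  exact ContDiff.sum fun σ _ => (contDiff_prod fun i _ => hA _ _).const_smul _

end EntrywiseSmooth

section Generic

variable {k d : ℕ}

lemma list_ofFn_smul_prod {ι : Type*} [Fintype ι] [DecidableEq ι] (s : ℝ) :
    ∀ {m : ℕ} (M : Fin m → Matrix ι ι ℝ),
      (List.ofFn fun j => s • M j).prod = s ^ m • (List.ofFn M).prod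
  | 0, M => by simp
  | m + 1, M => by
    rw [List.ofFn_succ, List.prod_cons, list_ofFn_smul_prod s fun j => M j.succ, List.ofFn_succ,
      List.prod_cons, Matrix.smul_mul, Matrix.mul_smul, smul_smul, pow_succ']

lemma list_ofFn_ite_prod {R : Type*} [Monoid R] (S : R) :
    ∀ {m : ℕ} (a : Fin m), (List.ofFn fun j => if j = a then S else 1).prod = S
  | m + 1, a => by
    rw [List.ofFn_succ, List.prod_cons]
    refine Fin.cases ?_ (fun a => ?_) a
    · simp [Fin.succ_ne_zero, List.ofFn_const]
    · have := list_ofFn_ite_prod S a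
      simpa [(Fin.succ_ne_zero _).symm, Fin.succ_inj] using this

/-- The cyclic shift matrix. -/
def shiftMatrix (d : ℕ) : Matrix (Fin (d + 1)) (Fin (d + 1)) ℝ :=
  (Equiv.addRight (1 : Fin (d + 1))).toPEquiv.toMatrix

lemma shiftMatrix_apply (r s : Fin (d + 1)) :
    shiftMatrix d r s = if s = r + 1 then 1 else 0 := by
  simp [shiftMatrix, PEquiv.toMatrix_apply, eq_comm]

lemma det_shiftMatrix_ne_zero : (shiftMatrix d).det ≠ 0 := by
  rw [shiftMatrix, Matrix.det_permutation]
  simp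

lemma observability_shiftMatrix : observability (shiftMatrix d) = 1 := by
  have h : ∀ (j : ℕ) (s : Fin (d + 1)),
      (shiftMatrix d ^ j) 0 s = if s = Fin.ofNat (d + 1) j then 1 else 0 := by
    intro j
    induction j with
    | zero =>
      intro s
      rw [pow_zero, Matrix.one_apply, show Fin.ofNat (d + 1) 0 = 0 from rfl]
      simp [eq_comm]
    | succ j ih =>
      intro s
      rw [pow_succ, Matrix.mul_apply]
      simp only [ih, shiftMatrix_apply]
      have : Fin.ofNat (d + 1) (j + 1) = Fin.ofNat (d + 1) j + 1 :=
        Fin.ext (by simp [Fin.val_add])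
      rw [this]
      generalize Fin.ofNat (d + 1) j = a
      rw [Finset.sum_eq_single a (fun b _ hb => by simp [hb]) (by simp)]
      simp
  ext j s
  rw [observability, Matrix.of_apply, h, Fin.ofNat_val_self, Matrix.one_apply]
  simp [eq_comm]

/-- Almost every family of matrices is generic. -/
lemma ae_genericFactors : ∀ᵐ ω : Fin (k + 1) → Fin (d + 1) → Fin (d + 1) → ℝ,
    GenericFactors fun i => Matrix.of (ω i) := by
  let v : Fin (k + 1) → Fin (d + 1) → Fin (d + 1) → ℝ :=
    fun i => if i = 0 then shiftMatrix d else (1 : Matrix (Fin (d + 1)) (Fin (d + 1)) ℝ)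
  have hentry : ∀ (i : Fin (k + 1)) (r s : Fin (d + 1)), ContDiff ℝ ⊤
      (fun ω : Fin (k + 1) → Fin (d + 1) → Fin (d + 1) → ℝ => Matrix.of (ω i) r s) := by
    intro i r s
    simp only [Matrix.of_apply]
    fun_prop
  have hv : ∀ i, Matrix.of (v i) = if i = 0 then shiftMatrix d else 1 := by
    intro i
    rfl
  unfold GenericFactors
  rw [ae_all_iff]
  intro i
  have h1 : ∀ᵐ ω : Fin (k + 1) → Fin (d + 1) → Fin (d + 1) → ℝ, (Matrix.of (ω i)).det ≠ 0 := by
    refine ae_ne_zero_of_homogeneous volume (contDiff_det_of_entries (hentry i)) (d + 1) ?_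
      (v := v) ?_
    · intro s x
      have : Matrix.of ((s • x) i) = s • Matrix.of (x i) := rfl
      rw [this, Matrix.det_smul, Fintype.card_fin]
    · rw [hv]
      split_ifs
      · exact det_shiftMatrix_ne_zero
      · simp
  have h2 : ∀ᵐ ω : Fin (k + 1) → Fin (d + 1) → Fin (d + 1) → ℝ,
      (observability (cyclicProd (fun i => Matrix.of (ω i)) i)).det ≠ 0 := by
    obtain ⟨F, hF⟩ : ∃ F : (Fin (k + 1) → Fin (d + 1) → Fin (d + 1) → ℝ) → ℝ,
        ∀ ω, F ω = (observability (cyclicProd (fun i => Matrix.of (ω i)) i)).det := ⟨_, fun _ => rfl⟩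
    obtain ⟨D, hD⟩ : ∃ D : ℕ, D = ∑ j : Fin (d + 1), (k + 1) * (j : ℕ) := ⟨_, rfl⟩
    have hsmooth : ContDiff ℝ ⊤ F := by
      rw [funext hF]
      refine contDiff_det_of_entries fun r s => ?_
      simp only [observability, Matrix.of_apply]
      refine contDiff_entries_pow (fun r s => ?_) _ _ _
      exact contDiff_entries_ofFn_prod (fun l => hentry _) r s
    have hhom : ∀ (s : ℝ) x, F (s • x) = s ^ D * F x := by
      intro s x
      rw [hF, hF]
      have hP : cyclicProd (fun i => Matrix.of ((s • x) i)) i =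
          s ^ (k + 1) • cyclicProd (fun i => Matrix.of (x i)) i := by
        rw [cyclicProd, cyclicProd, ← list_ofFn_smul_prod]
        rfl
      generalize cyclicProd (fun i => Matrix.of (x i)) i = P at hP
      rw [hP]
      have ho : observability (s ^ (k + 1) • P) =
          Matrix.of fun (j : Fin (d + 1)) t => s ^ ((k + 1) * (j : ℕ)) * observability P j t := by
        ext j t
        simp [observability, smul_pow, pow_mul]
      rw [ho, Matrix.det_mul_column, Finset.prod_pow_eq_pow_sum, hD]
    have hFv : F v ≠ 0 := by
      have : cyclicProd (fun i => Matrix.of (v i)) i = shiftMatrix d := by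
        rw [cyclicProd, ← list_ofFn_ite_prod (shiftMatrix d) (-i)]
        congr 2
        funext j
        rw [hv]
        congr 1
        rw [eq_neg_iff_add_eq_zero, add_comm i j]
      rw [hF, this, observability_shiftMatrix, Matrix.det_one]
      exact one_ne_zero
    simpa only [hF] using ae_ne_zero_of_homogeneous volume hsmooth D hhom hFv
  filter_upwards [h1, h2] with ω a b using ⟨a, b⟩

end Generic

lemma lintegral_pi_prod {α : Type*} [MeasurableSpace α] (μ : Measure α) [SigmaFinite μ] :
    ∀ {n : ℕ} (f : Fin n → α → ENNReal), (∀ i, Measurable (f i)) →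
      ∫⁻ x, ∏ i, f i (x i) ∂(Measure.pi fun _ : Fin n => μ) = ∏ i, ∫⁻ a, f i a ∂μ
  | 0, f, _ => by
    simp
  | n + 1, f, hf => by
    have h := (measurePreserving_piFinSuccAbove (fun _ : Fin (n + 1) => μ) 0).symm
    rw [← h.lintegral_comp_emb (MeasurableEquiv.measurableEmbedding _), lintegral_prod]
    · have hstep : ∀ (a : α) (x : Fin n → α),
          ∏ i, f i ((MeasurableEquiv.piFinSuccAbove (fun _ => α) 0).symm (a, x) i) =
            f 0 a * ∏ i, f i.succ (x i) := by
        intro a x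
        rw [Fin.prod_univ_succ]
        simp [MeasurableEquiv.piFinSuccAbove]
      simp only [hstep]
      have := lintegral_pi_prod μ (fun i => f i.succ) fun i => hf _
      rw [Fin.prod_univ_succ, ← this, ← lintegral_mul_const _ (hf 0)]
      refine lintegral_congr fun a => ?_
      rw [lintegral_const_mul]
      exact Finset.measurable_prod _ fun i _ => (hf _).comp (measurable_pi_apply i)
    · have hm : Measurable fun x : Fin (n + 1) → α => ∏ i, f i (x i) :=
        Finset.measurable_prod _ fun i _ => (hf _).comp (measurable_pi_apply i)
      exact (hm.comp h.measurable).aemeasurable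

/-- `μ` has density proportional to `exp (-S)` with respect to `ν`. -/
def HasExpDensity {α : Type*} [MeasurableSpace α] (μ ν : Measure α) (S : α → ℝ) : Prop :=
  Measurable S ∧ ∃ a : ENNReal, a ≠ 0 ∧ a ≠ ⊤ ∧
    μ = a • ν.withDensity fun x => ENNReal.ofReal (Real.exp (-S x))

namespace HasExpDensity

variable {α β : Type*} [MeasurableSpace α] [MeasurableSpace β] {μ ν : Measure α} {μ' ν' : Measure β}
  {S : α → ℝ} {S' : β → ℝ}

lemma measurable_density (hS : Measurable S) :
    Measurable fun x => ENNReal.ofReal (Real.exp (-S x)) := by fun_prop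

lemma exists_lintegral_eq (h : HasExpDensity μ ν S) : ∃ a : ENNReal, a ≠ 0 ∧ a ≠ ⊤ ∧
    ∀ F : α → ENNReal, AEMeasurable F ν →
      ∫⁻ x, F x ∂μ = a * ∫⁻ x, ENNReal.ofReal (Real.exp (-S x)) * F x ∂ν := by
  obtain ⟨hS, a, ha0, ha, rfl⟩ := h
  refine ⟨a, ha0, ha, fun F hF => ?_⟩
  rw [lintegral_smul_measure, lintegral_withDensity_eq_lintegral_mul₀
    (measurable_density hS).aemeasurable hF]
  rfl

lemma gaussianReal {v : NNReal} (hv : v ≠ 0) :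
    HasExpDensity (gaussianReal 0 v) volume fun x => x ^ 2 / (2 * v) := by
  refine ⟨by fun_prop, ENNReal.ofReal (Real.sqrt (2 * Real.pi * v))⁻¹, ?_, ENNReal.ofReal_ne_top, ?_⟩
  · simp only [ne_eq, ENNReal.ofReal_eq_zero, not_le]
    have : (0 : ℝ) < v := by positivity
    positivity
  · rw [gaussianReal_of_var_ne_zero _ hv, ← withDensity_smul _ (by fun_prop)]
    congr 1
    ext x
    rw [gaussianPDF, gaussianPDFReal, ENNReal.ofReal_mul (by positivity)]
    simp [neg_div]

lemma prod [SFinite ν] [SFinite ν'] (h : HasExpDensity μ ν S) (h' : HasExpDensity μ' ν' S') :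
    HasExpDensity (μ.prod μ') (ν.prod ν') fun p => S p.1 + S' p.2 := by
  obtain ⟨hS, a, ha0, ha, rfl⟩ := h
  obtain ⟨hS', b, hb0, hb, rfl⟩ := h'
  refine ⟨by fun_prop, a * b, mul_ne_zero ha0 hb0, ENNReal.mul_ne_top ha hb, ?_⟩
  rw [Measure.prod_smul_left, Measure.prod_smul_right,
    prod_withDensity (measurable_density hS) (measurable_density hS'), smul_smul]
  congr 2
  ext p
  rw [← ENNReal.ofReal_mul (Real.exp_pos _).le, ← Real.exp_add]
  congr 2; ring

lemma pi [SigmaFinite μ] [SigmaFinite ν] (h : HasExpDensity μ ν S) (n : ℕ) :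
    HasExpDensity (Measure.pi fun _ : Fin n => μ) (Measure.pi fun _ : Fin n => ν)
      fun x => ∑ i, S (x i) := by
  obtain ⟨hS, a, ha0, ha, hμ⟩ := h
  refine ⟨by fun_prop, a ^ n, pow_ne_zero _ ha0, ENNReal.pow_ne_top ha, ?_⟩
  refine Measure.pi_eq (fun s hs => ?_)
  have hd := measurable_density hS
  rw [Measure.smul_apply, withDensity_apply _ (MeasurableSet.univ_pi hs),
    ← lintegral_indicator (MeasurableSet.univ_pi hs)]
  have : ∀ x : Fin n → α, (Set.pi Set.univ s).indicator
      (fun x => ENNReal.ofReal (Real.exp (-∑ i, S (x i)))) x =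
      ∏ i, (s i).indicator (fun x => ENNReal.ofReal (Real.exp (-S x))) (x i) := by
    intro x
    by_cases hx : x ∈ Set.pi Set.univ s
    · rw [Set.indicator_of_mem hx, ← Finset.sum_neg_distrib, Real.exp_sum,
        ENNReal.ofReal_prod_of_nonneg fun i _ => (Real.exp_pos _).le]
      refine Finset.prod_congr rfl fun i _ => ?_
      rw [Set.indicator_of_mem (hx i trivial)]
    · rw [Set.indicator_of_notMem hx]
      simp only [Set.mem_pi, not_forall] at hx
      obtain ⟨i, _, hi⟩ := hx
      exact (Finset.prod_eq_zero (Finset.mem_univ i) (Set.indicator_of_notMem hi _)).symm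
  simp only [this]
  rw [lintegral_pi_prod ν _ fun i => hd.indicator (hs i), hμ]
  simp only [Measure.smul_apply, withDensity_apply _ (hs _), lintegral_indicator (hs _),
    smul_eq_mul, Finset.prod_mul_distrib, Finset.prod_const, Finset.card_univ, Fintype.card_fin]

lemma absolutelyContinuous (h : HasExpDensity μ ν S) : μ.AbsolutelyContinuous ν := by
  obtain ⟨hS, a, ha0, ha, rfl⟩ := h
  exact (withDensity_absolutelyContinuous _ _).smul_left a

end HasExpDensity

lemma exists_orthogonal_first_column {d : ℕ} (y : Fin d → ℝ) :
    ∃ (Q : Matrix (Fin (d + 1)) (Fin (d + 1)) ℝ) (s : ℝ), s ≠ 0 ∧ Q.transpose * Q = 1 ∧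
      Q * Q.transpose = 1 ∧ ∀ r, Q r 0 = s * (Fin.cons 1 y : Fin (d + 1) → ℝ) r := by
  let u : EuclideanSpace ℝ (Fin (d + 1)) := WithLp.toLp 2 (Fin.cons 1 y)
  have hu : u ≠ 0 := fun h => by
    have := congrArg (fun v : EuclideanSpace ℝ (Fin (d + 1)) => v 0) h
    simp [u] at this
  have hn : ‖u‖⁻¹ ≠ 0 := inv_ne_zero (norm_ne_zero_iff.2 hu)
  have hv : Orthonormal ℝ (({0} : Set (Fin (d + 1))).domRestrict fun _ => ‖u‖⁻¹ • u) := by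
    constructor
    · intro i
      change ‖‖u‖⁻¹ • u‖ = 1
      rw [norm_smul, norm_inv, norm_norm, inv_mul_cancel₀ (norm_ne_zero_iff.2 hu)]
    · intro i j hij
      exact absurd (Subsingleton.elim i j) hij
  obtain ⟨b, hb⟩ := hv.exists_orthonormalBasis_extension_of_card_eq (by simp)
  have hb0 := hb 0 rfl
  let e := EuclideanSpace.basisFun (Fin (d + 1)) ℝ
  have hQ := e.toMatrix_orthonormalBasis_mem_unitary b
  refine ⟨e.toBasis.toMatrix b, ‖u‖⁻¹, hn, ?_, ?_, fun r => ?_⟩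
  · have := (Matrix.mem_unitaryGroup_iff').1 hQ
    rwa [Matrix.star_eq_conjTranspose, Matrix.conjTranspose_eq_transpose_of_trivial] at this
  · have := (Matrix.mem_unitaryGroup_iff).1 hQ
    rwa [Matrix.star_eq_conjTranspose, Matrix.conjTranspose_eq_transpose_of_trivial] at this
  · simp [Module.Basis.toMatrix_apply, e, hb0, u]

lemma sum_sq_entries {ι : Type*} [Fintype ι] (M : Matrix ι ι ℝ) :
    ∑ r, ∑ s, M r s ^ 2 = (M * M.transpose).trace := by
  simp [Matrix.trace, Matrix.mul_apply, sq]

lemma sum_sq_entries_orthogonal {ι : Type*} [Fintype ι] [DecidableEq ι] {Q R : Matrix ι ι ℝ}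
    (hQ : Q.transpose * Q = 1) (hR : R.transpose * R = 1) (T : Matrix ι ι ℝ) :
    ∑ r, ∑ s, (Q * T * R.transpose) r s ^ 2 = ∑ r, ∑ s, T r s ^ 2 := by
  rw [sum_sq_entries, sum_sq_entries, Matrix.transpose_mul, Matrix.transpose_mul,
    Matrix.transpose_transpose]
  have : Q * T * R.transpose * (R * (T.transpose * Q.transpose)) =
      Q * (T * T.transpose * Q.transpose) := by
    calc _ = Q * T * (R.transpose * R) * (T.transpose * Q.transpose) := by
          simp only [Matrix.mul_assoc]
      _ = _ := by rw [hR, Matrix.mul_one]; simp only [Matrix.mul_assoc]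
  rw [this, Matrix.trace_mul_comm, Matrix.mul_assoc, hQ, Matrix.mul_one]

section FixedChain

variable {k d : ℕ}

/-- The sum of squares of the entries of a family of blocks. -/
def blockEnergy (T : Fin (k + 1) → Block d) : ℝ :=
  ∑ i, ((T i).1 ^ 2 + (∑ s, (T i).2.1 s ^ 2 + ∑ r, ∑ s, (T i).2.2 r s ^ 2))

lemma sum_sq_blockMatrix (a : ℝ) (w c : Fin d → ℝ) (D : Matrix (Fin d) (Fin d) ℝ) :
    ∑ r, ∑ s, blockMatrix a w c D r s ^ 2 =
      a ^ 2 + ∑ s, w s ^ 2 + (∑ r, c r ^ 2 + ∑ r, ∑ s, D r s ^ 2) := by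
  simp [Fin.sum_univ_succ, Finset.sum_add_distrib]
  ring

/-- The block coordinates of a family of matrices. -/
def blocksOf (M : Fin (k + 1) → Matrix (Fin (d + 1)) (Fin (d + 1)) ℝ) :
    (Fin (k + 1) → Block d) × (Fin (k + 1) → Fin d → ℝ) :=
  (fun i => (M i 0 0, fun s => M i 0 s.succ, fun r s => M i r.succ s.succ), fun i r => M i r.succ 0)

lemma assemble_blocksOf (M : Fin (k + 1) → Matrix (Fin (d + 1)) (Fin (d + 1)) ℝ) :
    assemble (blocksOf M) = M := by
  ext1 i
  apply ext_blocks <;> intros <;> simp [assemble, blocksOf]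

lemma blocksOf_assemble (c : (Fin (k + 1) → Block d) × (Fin (k + 1) → Fin d → ℝ)) :
    blocksOf (assemble c) = c := by
  ext <;> simp [assemble, blocksOf]

lemma exists_blockTriangularization (y : Fin (k + 1) → Fin d → ℝ) :
    ∃ L : (Fin (k + 1) → Block d) →ₗ[ℝ] (Fin (k + 1) → Block d), Function.Injective L ∧
      ∀ T, ∏ i, chainScalar (L T, y) i = ∏ i, (T i).1 ∧
        (List.ofFn (chainQuotient (L T, y))).prod.charpoly =
          (List.ofFn fun i => Matrix.of (T i).2.2).prod.charpoly ∧
        ∑ i, ∑ r, ∑ s, assemble (deflationMap (L T, y)) i r s ^ 2 = blockEnergy T := by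
  choose Q s hs hQQ hQQ' hcol using fun i => exists_orthogonal_first_column (y i)
  obtain ⟨B, hB⟩ : ∃ B : (Fin (k + 1) → Block d) → Fin (k + 1) →
      Matrix (Fin (d + 1)) (Fin (d + 1)) ℝ, ∀ T i, B T i =
        blockMatrix (T i).1 (T i).2.1 0 (Matrix.of (T i).2.2) := ⟨_, fun _ _ => rfl⟩
  obtain ⟨M, hM⟩ : ∃ M : (Fin (k + 1) → Block d) → Fin (k + 1) →
      Matrix (Fin (d + 1)) (Fin (d + 1)) ℝ, ∀ T i, M T i = Q i * B T i * (Q (i + 1)).transpose :=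
    ⟨_, fun _ _ => rfl⟩
  have hBadd : ∀ T T' i, B (T + T') i = B T i + B T' i := by
    intro T T' i
    simp only [hB]
    apply ext_blocks <;> intros <;> simp
  have hBsmul : ∀ (a : ℝ) T i, B (a • T) i = a • B T i := by
    intro a T i
    simp only [hB]
    apply ext_blocks <;> intros <;> simp
  have hMadd : ∀ T T' i, M (T + T') i = M T i + M T' i := by
    intro T T' i; simp only [hM, hBadd, Matrix.mul_add, Matrix.add_mul]
  have hMsmul : ∀ (a : ℝ) T i, M (a • T) i = a • M T i := by
    intro a T i; simp only [hM, hBsmul, Matrix.mul_smul, Matrix.smul_mul]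
  let L : (Fin (k + 1) → Block d) →ₗ[ℝ] (Fin (k + 1) → Block d) :=
    { toFun := fun T => (blocksOf (M T)).1
      map_add' := fun T T' => by
        ext <;> simp [blocksOf, hMadd]
      map_smul' := fun a T => by
        ext <;> simp [blocksOf, hMsmul] }
  have hL : ∀ T, L T = (blocksOf (M T)).1 := fun _ => rfl
  have hQe : ∀ i, (Q i).mulVec (Pi.single 0 1) = s i • (Fin.cons 1 (y i) : Fin (d + 1) → ℝ) := by
    intro i; ext r; simp [hcol]
  have hBe : ∀ T i, (B T i).mulVec (Pi.single 0 1) = (T i).1 • Pi.single 0 1 := by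
    intro T i
    ext r
    rw [hB]
    refine Fin.cases ?_ (fun r => ?_) r <;> simp
  have hchain : ∀ T i, (assemble (blocksOf (M T)) i).mulVec
      (Fin.cons 1 (y (i + 1)) : Fin (d + 1) → ℝ) =
      ((s (i + 1))⁻¹ * (T i).1 * s i) • (Fin.cons 1 (y i) : Fin (d + 1) → ℝ) := by
    intro T i
    have h1 : (Fin.cons 1 (y (i + 1)) : Fin (d + 1) → ℝ) =
        (s (i + 1))⁻¹ • (Q (i + 1)).mulVec (Pi.single 0 1) := by
      rw [hQe, smul_smul, inv_mul_cancel₀ (hs _), one_smul]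
    rw [assemble_blocksOf, h1, Matrix.mulVec_smul, hM, Matrix.mulVec_mulVec, Matrix.mul_assoc, hQQ,
      Matrix.mul_one, ← Matrix.mulVec_mulVec, hBe, Matrix.mulVec_smul, hQe, smul_smul, smul_smul]
  have hdef : ∀ T, deflationMap (L T, y) = blocksOf (M T) ∧
      ∀ i, chainScalar (L T, y) i = (s (i + 1))⁻¹ * (T i).1 * s i := fun T =>
    deflationMap_eq_of_chain (blocksOf (M T)) y _ (hchain T)
  have hscal : ∀ T, ∏ i, chainScalar (L T, y) i = ∏ i, (T i).1 := by
    intro T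
    rw [Finset.prod_congr rfl fun i _ => (hdef T).2 i, Finset.prod_mul_distrib,
      Finset.prod_mul_distrib]
    have h1 : ∏ i, (s (i + 1))⁻¹ = ∏ i, (s i)⁻¹ :=
      Equiv.prod_comp (Equiv.addRight (1 : Fin (k + 1))) fun i => (s i)⁻¹
    have h2 : (∏ i, (s i)⁻¹) * ∏ i, s i = 1 := by
      rw [← Finset.prod_mul_distrib]
      exact Finset.prod_eq_one fun i _ => inv_mul_cancel₀ (hs i)
    rw [h1, mul_right_comm, h2, one_mul]
  refine ⟨L, ?_, fun T => ⟨hscal T, ?_, ?_⟩⟩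
  · rw [injective_iff_map_eq_zero]
    intro T hT
    have h1 := (hdef T).1
    have h2 : deflationMap ((0 : Fin (k + 1) → Block d), y) = 0 := by
      ext <;> simp [deflationMap, chainColumn, chainScalar]
    rw [hT, h2] at h1
    have h3 : M T = 0 := by
      rw [← assemble_blocksOf (M T), ← h1]
      ext1 i
      apply ext_blocks <;> intros <;> simp [assemble]
    have h4 : ∀ i, B T i = 0 := by
      intro i
      have : B T i = (Q i).transpose * M T i * Q (i + 1) := by
        rw [hM]
        calc B T i = ((Q i).transpose * Q i) * B T i * ((Q (i + 1)).transpose * Q (i + 1)) := by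
              rw [hQQ, hQQ, Matrix.one_mul, Matrix.mul_one]
          _ = _ := by simp only [Matrix.mul_assoc]
      rw [this, h3]; simp
    ext i j
    · have := congrFun (congrFun (h4 i) 0) 0
      rw [hB] at this; simpa using this
    · have := congrFun (congrFun (h4 i) 0) j.succ
      rw [hB] at this; simpa using this
    · rename_i l
      have := congrFun (congrFun (h4 i) j.succ) l.succ
      rw [hB] at this; simpa using this
  · have h1 := charpoly_assemble_deflationMap (L T, y)
    rw [(hdef T).1, assemble_blocksOf, hscal] at h1
    let U : ℕ → (Matrix (Fin (d + 1)) (Fin (d + 1)) ℝ)ˣ := fun j =>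
      ⟨Q (Fin.ofNat (k + 1) j), (Q (Fin.ofNat (k + 1) j)).transpose, hQQ' _, hQQ _⟩
    have hU : ∀ j, (U j : Matrix (Fin (d + 1)) (Fin (d + 1)) ℝ) = Q (Fin.ofNat (k + 1) j) :=
      fun _ => rfl
    have h2 := charpoly_ofFn_prod_eq_of_chain (M T) (B T) U
      (by apply Units.ext; simp only [hU]; congr 1; simp [Fin.ofNat])
      (fun i => by
        rw [hU, hU, Fin.ofNat_val_self, Fin.ofNat_val_succ, hM, Matrix.mul_assoc, hQQ,
          Matrix.mul_one])
    have h3 := charpoly_ofFn_blockMatrix_prod (fun i => (T i).1) (fun i => (T i).2.1)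
      (fun i => Matrix.of (T i).2.2)
    have h4 : B T = fun i => blockMatrix (T i).1 (T i).2.1 0 (Matrix.of (T i).2.2) := by
      ext1 i; exact hB T i
    rw [h2, h4, h3] at h1
    exact (mul_left_cancel₀ (Polynomial.X_sub_C_ne_zero _) h1).symm
  · rw [(hdef T).1, assemble_blocksOf]
    refine Finset.sum_congr rfl fun i _ => ?_
    rw [hM, sum_sq_entries_orthogonal (hQQ _) (hQQ _), hB, sum_sq_blockMatrix]
    simp
    ring

end FixedChain

section Ensemble

/-- The law of `m` independent `n × n` matrices with i.i.d. `N(0, v)` entries. -/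
noncomputable def gaussianEnsemble (v : NNReal) (n m : ℕ) : Measure (Fin m → Fin n → Fin n → ℝ) :=
  Measure.pi fun _ => Measure.pi fun _ => Measure.pi fun _ => gaussianReal 0 v

instance (v : NNReal) (n m : ℕ) : IsProbabilityMeasure (gaussianEnsemble v n m) := by
  unfold gaussianEnsemble; infer_instance

/-- The law of independent Gaussian blocks. -/
noncomputable def blockLaw (v : NNReal) (k d : ℕ) : Measure (Fin (k + 1) → Block d) :=
  Measure.pi fun _ => (gaussianReal 0 v).prod
    ((Measure.pi fun _ => gaussianReal 0 v).prod
      (Measure.pi fun _ => Measure.pi fun _ => gaussianReal 0 v))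

instance (v : NNReal) (k d : ℕ) : IsProbabilityMeasure (blockLaw v k d) := by
  unfold blockLaw; infer_instance

lemma hasExpDensity_gaussianEnsemble {v : NNReal} (hv : v ≠ 0) (n m : ℕ) :
    HasExpDensity (gaussianEnsemble v n m) volume
      fun ω => (∑ i, ∑ r, ∑ s, ω i r s ^ 2) / (2 * v) := by
  have h := (((HasExpDensity.gaussianReal hv).pi n).pi n).pi m
  simp only [← Finset.sum_div] at h
  exact h

lemma hasExpDensity_blockLaw {v : NNReal} (hv : v ≠ 0) (k d : ℕ) :
    HasExpDensity (blockLaw v k d) volume fun T => blockEnergy T / (2 * v) := by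
  have hg := HasExpDensity.gaussianReal hv
  have h := (hg.prod ((hg.pi d).prod ((hg.pi d).pi d))).pi (k + 1)
  simp only [← Finset.sum_div, ← add_div] at h
  exact h

lemma measurePreserving_blockLaw (v : NNReal) (k d : ℕ) :
    MeasurePreserving (fun T : Fin (k + 1) → Block d => (fun i => (T i).1, fun i => (T i).2.2))
      (blockLaw v k d)
      ((Measure.pi fun _ : Fin (k + 1) => gaussianReal 0 v).prod (gaussianEnsemble v d (k + 1))) := by
  let μ1 : Measure ℝ := gaussianReal 0 v
  let μ2 : Measure (Fin d → ℝ) := Measure.pi fun _ => gaussianReal 0 v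
  let μ3 : Measure (Fin d → Fin d → ℝ) := Measure.pi fun _ => Measure.pi fun _ => gaussianReal 0 v
  have h1 : MeasurePreserving (Prod.map id Prod.snd : Block d → ℝ × (Fin d → Fin d → ℝ))
      (μ1.prod (μ2.prod μ3)) (μ1.prod μ3) :=
    (MeasurePreserving.id μ1).prod measurePreserving_snd
  have h2 := measurePreserving_pi (fun _ : Fin (k + 1) => μ1.prod (μ2.prod μ3))
    (fun _ => μ1.prod μ3) (fun _ => h1)
  have h3 := measurePreserving_arrowProdEquivProdArrow ℝ (Fin d → Fin d → ℝ) (Fin (k + 1))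
    (fun _ => μ1) (fun _ => μ3)
  exact h3.comp h2

end Ensemble

section Deflation

variable {k d : ℕ}

/-- The linear identification of block coordinates with families of matrices. -/
noncomputable def assembleEquiv (k d : ℕ) : ((Fin (k + 1) → Block d) × (Fin (k + 1) → Fin d → ℝ)) ≃L[ℝ]
    (Fin (k + 1) → Fin (d + 1) → Fin (d + 1) → ℝ) :=
  LinearEquiv.toContinuousLinearEquiv
    { toFun := fun c i r s => assemble c i r s
      invFun := fun ω => blocksOf fun i => Matrix.of (ω i)
      map_add' := fun c c' => by
        ext i r s
        refine Fin.cases ?_ (fun r => ?_) r <;> refine Fin.cases ?_ (fun s => ?_) s <;>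
          simp [assemble]
      map_smul' := fun a c => by
        ext i r s
        refine Fin.cases ?_ (fun r => ?_) r <;> refine Fin.cases ?_ (fun s => ?_) s <;>
          simp [assemble]
      left_inv := fun c => blocksOf_assemble c
      right_inv := fun ω => by
        have := assemble_blocksOf fun i => Matrix.of (ω i)
        ext i r s
        exact congrFun (congrFun (congrFun this i) r) s }

lemma prodMatrix_assembleEquiv (c : (Fin (k + 1) → Block d) × (Fin (k + 1) → Fin d → ℝ)) :
    prodMatrix (d + 1) (k + 1) (assembleEquiv k d c) = (List.ofFn (assemble c)).prod := rfl

lemma exists_volume_eq_smul_map_assembleEquiv (k d : ℕ) : ∃ a : ENNReal, a ≠ 0 ∧ a ≠ ⊤ ∧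
    (volume : Measure (Fin (k + 1) → Fin (d + 1) → Fin (d + 1) → ℝ)) =
      a • Measure.map (assembleEquiv k d) volume := by
  have : (Measure.map (assembleEquiv k d) volume).IsAddHaarMeasure :=
    (assembleEquiv k d).isAddHaarMeasure_map volume
  refine ⟨_, ?_, ?_, Measure.isAddLeftInvariant_eq_smul volume (Measure.map (assembleEquiv k d) volume)⟩
  · have := Measure.addHaarScalarFactor_pos_of_isAddHaarMeasure
      (volume : Measure (Fin (k + 1) → Fin (d + 1) → Fin (d + 1) → ℝ))
      (Measure.map (assembleEquiv k d) volume)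
    exact_mod_cast this.ne'
  · exact ENNReal.coe_ne_top

end Deflation

lemma continuous_ofFn_prod {X R : Type*} [TopologicalSpace X] [Monoid R] [TopologicalSpace R]
    [ContinuousMul R] : ∀ {m : ℕ} {A : X → Fin m → R}, (∀ l, Continuous fun x => A x l) →
      Continuous fun x => (List.ofFn (A x)).prod
  | 0, A, _ => by simpa using continuous_const
  | m + 1, A, h => by
    simp only [List.ofFn_succ, List.prod_cons]
    exact (h 0).mul (continuous_ofFn_prod fun l => h l.succ)

lemma continuous_eval_charpoly {X ι : Type*} [TopologicalSpace X] [Fintype ι] [DecidableEq ι]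
    {A : X → Matrix ι ι ℝ} (hA : Continuous A) {x : X → ℝ} (hx : Continuous x) :
    Continuous fun p => (A p).charpoly.eval (x p) := by
  simp only [eval_charpoly_eq_det]
  exact Continuous.matrix_det ((hx.smul continuous_const).sub hA)

section Deflation

variable {k d : ℕ}

lemma continuous_prodMatrix (n m : ℕ) : Continuous (prodMatrix n m) := by
  refine continuous_ofFn_prod fun l => ?_
  exact continuous_apply l

lemma continuous_prod_chainScalar : Continuous
    fun ζ : (Fin (k + 1) → Block d) × (Fin (k + 1) → Fin d → ℝ) => ∏ i, chainScalar ζ i :=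
  continuous_finsetProd _ fun i _ => (contDiff_chainScalar i).continuous

lemma continuous_chainQuotient_prod : Continuous
    fun ζ : (Fin (k + 1) → Block d) × (Fin (k + 1) → Fin d → ℝ) =>
      (List.ofFn (chainQuotient ζ)).prod := by
  refine continuous_ofFn_prod fun l => continuous_matrix fun r s => ?_
  simp only [chainQuotient, Matrix.of_apply]
  fun_prop

lemma ae_generic_regular : ∀ᵐ c : (Fin (k + 1) → Block d) × (Fin (k + 1) → Fin d → ℝ),
    GenericFactors (assemble c) ∧ ∀ ζ, deflationMap ζ = c → (fderiv ℝ deflationMap ζ).det ≠ 0 := by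
  refine Filter.Eventually.and ?_ (ae_forall_fiber_det_fderiv_ne_zero volume contDiff_deflationMap)
  obtain ⟨a, ha0, ha, hvol⟩ := exists_volume_eq_smul_map_assembleEquiv k d
  have h := ae_genericFactors (k := k) (d := d)
  rw [hvol, Measure.ae_ennreal_smul_measure_iff ha0] at h
  exact ae_of_ae_map (assembleEquiv k d).continuous.measurable.aemeasurable h

/-- Integrating over matrix families in block coordinates. -/
lemma lintegral_comp_assembleEquiv {a : ENNReal}
    (hvol : (volume : Measure (Fin (k + 1) → Fin (d + 1) → Fin (d + 1) → ℝ)) =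
      a • Measure.map (assembleEquiv k d) volume)
    (F : (Fin (k + 1) → Fin (d + 1) → Fin (d + 1) → ℝ) → ENNReal) :
    ∫⁻ ω, F ω = a * ∫⁻ c, F (assembleEquiv k d c) := by
  rw [hvol, lintegral_smul_measure]
  congr 1
  exact lintegral_map_equiv F (assembleEquiv k d).toHomeomorph.toMeasurableEquiv

lemma aemeasurable_of_comp_assembleEquiv
    {F : (Fin (k + 1) → Fin (d + 1) → Fin (d + 1) → ℝ) → ENNReal}
    (hF : AEMeasurable fun c => F (assembleEquiv k d c)) : AEMeasurable F := by
  obtain ⟨a, ha0, ha, hvol⟩ := exists_volume_eq_smul_map_assembleEquiv k d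
  rw [hvol]
  refine AEMeasurable.smul_measure ?_ a
  exact ((assembleEquiv k d).toHomeomorph.toMeasurableEquiv.measurableEmbedding.aemeasurable_map_iff).2
    hF

/-- The function of the deflated data that a root statistic becomes. -/
noncomputable def deflatedStat (H : ℝ × ℝ × ℝ → ENNReal) (z l : ℝ) (q : Polynomial ℝ) : ENNReal :=
  H (l, q.eval l, (z - l) * q.eval z)

/-- The root statistic. -/
noncomputable def rootStat (H : ℝ × ℝ × ℝ → ENNReal) (z : ℝ) (p : Polynomial ℝ) : ENNReal :=
  (p.roots.map fun x => H (x, p.derivative.eval x, p.eval z)).sum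

lemma measurable_deflatedStat {X : Type*} [TopologicalSpace X] [MeasurableSpace X]
    [OpensMeasurableSpace X] {n : ℕ} {H : ℝ × ℝ × ℝ → ENNReal} (hH : Measurable H) (z : ℝ)
    {l : X → ℝ} (hl : Continuous l) {A : X → Matrix (Fin n) (Fin n) ℝ} (hA : Continuous A) :
    Measurable fun x => deflatedStat H z (l x) (A x).charpoly := by
  refine hH.comp (Continuous.measurable ?_)
  exact hl.prodMk ((continuous_eval_charpoly hA hl).prodMk
    ((continuous_const.sub hl).mul (continuous_eval_charpoly hA continuous_const)))

lemma ae_rootStat_eq_tsum (H : ℝ × ℝ × ℝ → ENNReal) (z : ℝ) :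
    ∀ᵐ c : (Fin (k + 1) → Block d) × (Fin (k + 1) → Fin d → ℝ),
      rootStat H z (prodMatrix (d + 1) (k + 1) (assembleEquiv k d c)).charpoly =
        ∑' ζ : (deflationMap (k := k) (d := d)) ⁻¹' {c},
          deflatedStat H z (∏ i, chainScalar ζ.1 i) (List.ofFn (chainQuotient ζ.1)).prod.charpoly := by
  filter_upwards [ae_generic_regular] with c hc
  rw [prodMatrix_assembleEquiv, rootStat, (sum_roots_eq_tsum_fibre c hc.1 hc.2).2]
  refine tsum_congr fun ζ => ?_
  have hζ : deflationMap ζ.1 = c := ζ.2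
  have := charpoly_assemble_deflationMap ζ.1
  rw [hζ] at this
  rw [this, deflatedStat]
  generalize (List.ofFn (chainQuotient ζ.1)).prod.charpoly = q
  generalize ∏ i, chainScalar ζ.1 i = l
  simp

lemma ae_roots_simple : ∀ᵐ ω : Fin (k + 1) → Fin (d + 1) → Fin (d + 1) → ℝ,
    ∀ x ∈ (prodMatrix (d + 1) (k + 1) ω).charpoly.roots,
      (prodMatrix (d + 1) (k + 1) ω).charpoly.derivative.eval x ≠ 0 := by
  obtain ⟨a, ha0, ha, hvol⟩ := exists_volume_eq_smul_map_assembleEquiv k d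
  rw [hvol, Measure.ae_ennreal_smul_measure_iff ha0]
  refine (assembleEquiv k d).toHomeomorph.toMeasurableEquiv.measurableEmbedding.ae_map_iff.2 ?_
  filter_upwards [ae_generic_regular] with c hc
  exact (sum_roots_eq_tsum_fibre c hc.1 hc.2).1

end Deflation

section Deflation

variable {k d : ℕ}

lemma continuous_assemble_energy : Continuous
    fun ζ : (Fin (k + 1) → Block d) × (Fin (k + 1) → Fin d → ℝ) =>
      ∑ i, ∑ r, ∑ s, assemble (deflationMap ζ) i r s ^ 2 := by
  have h : Continuous fun ζ : (Fin (k + 1) → Block d) × (Fin (k + 1) → Fin d → ℝ) =>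
      assembleEquiv k d (deflationMap ζ) :=
    (assembleEquiv k d).continuous.comp contDiff_deflationMap.continuous
  have h' : ∀ i r s, Continuous fun ζ : (Fin (k + 1) → Block d) × (Fin (k + 1) → Fin d → ℝ) =>
      assemble (deflationMap ζ) i r s := fun i r s =>
    (continuous_apply s).comp ((continuous_apply r).comp ((continuous_apply i).comp h))
  fun_prop

/-- Integration over the block coordinates for a fixed chain of directions. -/
lemma exists_lintegral_fixed_chain (w : ℝ) (y : Fin (k + 1) → Fin d → ℝ) : ∃ J : ENNReal, J ≠ 0 ∧
    ∀ Ψ : ℝ → Polynomial ℝ → ENNReal,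
      ∫⁻ Z, ENNReal.ofReal (Real.exp
          (-((∑ i, ∑ r, ∑ s, assemble (deflationMap (Z, y)) i r s ^ 2) / w))) *
          Ψ (∏ i, chainScalar (Z, y) i) (List.ofFn (chainQuotient (Z, y))).prod.charpoly =
        J * ∫⁻ T : Fin (k + 1) → Block d, ENNReal.ofReal (Real.exp (-(blockEnergy T / w))) *
          Ψ (∏ i, (T i).1) (prodMatrix d (k + 1) fun i => (T i).2.2).charpoly := by
  obtain ⟨L, hL, hspec⟩ := exists_blockTriangularization y
  have hdet : LinearMap.det L ≠ 0 := by
    have := LinearMap.ker_eq_bot.2 hL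
    intro h
    exact absurd (LinearMap.bot_lt_ker_of_det_eq_zero h) (by rw [this]; exact lt_irrefl _)
  have hdet' : LinearMap.det (L : (Fin (k + 1) → Block d) →ₗ[ℝ] (Fin (k + 1) → Block d)) ≠ 0 := hdet
  have hmap := Measure.map_linearMap_addHaar_eq_smul_addHaar
    (volume : Measure (Fin (k + 1) → Block d)) hdet'
  have hemb : MeasurableEmbedding L :=
    (LinearEquiv.ofInjectiveEndo L hL).toContinuousLinearEquiv.toHomeomorph.measurableEmbedding
  obtain ⟨b, hb⟩ : ∃ b : ENNReal, b = ENNReal.ofReal |(LinearMap.det L)⁻¹| := ⟨_, rfl⟩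
  have hb0 : b ≠ 0 := by
    rw [hb]
    simpa using hdet
  have hbt : b ≠ ⊤ := by rw [hb]; exact ENNReal.ofReal_ne_top
  rw [← hb] at hmap
  have hvol : (volume : Measure (Fin (k + 1) → Block d)) = b⁻¹ • Measure.map L volume := by
    rw [hmap, smul_smul, ENNReal.inv_mul_cancel hb0 hbt, one_smul]
  refine ⟨b⁻¹, ENNReal.inv_ne_zero.2 hbt, fun Ψ => ?_⟩
  conv_lhs => rw [hvol]
  rw [lintegral_smul_measure, hemb.lintegral_map, smul_eq_mul]
  congr 1
  refine lintegral_congr fun T => ?_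
  rw [(hspec T).1, (hspec T).2.1, (hspec T).2.2]
  rfl

lemma lintegral_blockLaw (v : NNReal) (k d : ℕ) {F : (Fin (k + 1) → ℝ) →
    (Fin (k + 1) → Fin d → Fin d → ℝ) → ENNReal} (hF : Measurable (Function.uncurry F)) :
    ∫⁻ T, F (fun i => (T i).1) (fun i => (T i).2.2) ∂(blockLaw v k d) =
      ∫⁻ ξ, ∫⁻ A, F ξ A ∂(gaussianEnsemble v d (k + 1))
        ∂(Measure.pi fun _ : Fin (k + 1) => gaussianReal 0 v) := by
  have h := (measurePreserving_blockLaw v k d).lintegral_comp hF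
  rw [lintegral_prod _ hF.aemeasurable] at h
  exact h

end Deflation

/-- The deflation identity: root statistics of a product of Gaussian matrices in terms of a product
of Gaussian scalars and a product of Gaussian matrices of size one less. -/
theorem exists_deflation {v : NNReal} (hv : v ≠ 0) (k d : ℕ) : ∃ C : ENNReal, C ≠ 0 ∧
    ∀ H : ℝ × ℝ × ℝ → ENNReal, Measurable H → ∀ z : ℝ,
      AEMeasurable (fun ω => rootStat H z (prodMatrix (d + 1) (k + 1) ω).charpoly)
        (gaussianEnsemble v (d + 1) (k + 1)) ∧
      ∫⁻ ω, rootStat H z (prodMatrix (d + 1) (k + 1) ω).charpoly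
          ∂(gaussianEnsemble v (d + 1) (k + 1)) =
        C * ∫⁻ ξ, ∫⁻ A, ENNReal.ofReal |(prodMatrix d (k + 1) A).charpoly.eval (∏ i, ξ i)| *
            deflatedStat H z (∏ i, ξ i) (prodMatrix d (k + 1) A).charpoly
          ∂(gaussianEnsemble v d (k + 1)) ∂(Measure.pi fun _ : Fin (k + 1) => gaussianReal 0 v) := by
  obtain ⟨a₁, ha₁0, -, hγ⟩ := (hasExpDensity_gaussianEnsemble hv (d + 1) (k + 1)).exists_lintegral_eq
  obtain ⟨a₂, ha₂0, ha₂t, hτ⟩ := (hasExpDensity_blockLaw hv k d).exists_lintegral_eq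
  obtain ⟨a₃, ha₃0, -, hvol⟩ := exists_volume_eq_smul_map_assembleEquiv k d
  choose J hJ0 hJ using fun y => exists_lintegral_fixed_chain (k := k) (d := d) (2 * v : ℝ) y
  obtain ⟨w, hw⟩ : ∃ w : (Fin (k + 1) → Block d) × (Fin (k + 1) → Fin d → ℝ) → ENNReal,
      ∀ ζ, w ζ = ENNReal.ofReal (Real.exp
        (-((∑ i, ∑ r, ∑ s, assemble (deflationMap ζ) i r s ^ 2) / (2 * v)))) := ⟨_, fun _ => rfl⟩
  have hwm : Measurable w := by
    rw [funext hw]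
    refine (ENNReal.continuous_ofReal.comp (Real.continuous_exp.comp ?_)).measurable
    exact (continuous_assemble_energy.div_const _).neg
  obtain ⟨K, hK⟩ : ∃ K : ENNReal, K = ∫⁻ T : Fin (k + 1) → Block d,
      ENNReal.ofReal (Real.exp (-(blockEnergy T / (2 * v)))) := ⟨_, rfl⟩
  have haK : a₂ * K = 1 := by
    have := hτ (fun _ => 1) measurable_const.aemeasurable
    simp only [mul_one, lintegral_const, measure_univ] at this
    rw [hK]; exact this.symm
  have hK0 : K ≠ 0 := by rintro rfl; simp at haK
  have hKt : K ≠ ⊤ := by rintro rfl; simp [ENNReal.mul_top ha₂0] at haK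
  have hJm : Measurable J := by
    have h1 : J = fun y => (∫⁻ Z, w (Z, y)) * K⁻¹ := by
      ext y
      have := hJ y (fun _ _ => 1)
      simp only [mul_one] at this
      simp only [hw]
      rw [this, ← hK, mul_assoc, ENNReal.mul_inv_cancel hK0 hKt, mul_one]
    rw [h1]
    exact (Measurable.lintegral_prod_left' hwm).mul_const _
  have hJint : ∫⁻ y, J y ≠ 0 := by
    rw [Ne, lintegral_eq_zero_iff hJm]
    intro h
    have h0 : (volume : Measure (Fin (k + 1) → Fin d → ℝ)) = 0 := by
      rw [← ae_eq_bot, ← Filter.eventually_false_iff_eq_bot]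
      filter_upwards [h] with y hy using hJ0 y hy
    exact NeZero.ne (volume : Measure (Fin (k + 1) → Fin d → ℝ)) h0
  refine ⟨a₁ * a₃ * (∫⁻ y, J y) * a₂⁻¹, ?_, fun H hH z => ?_⟩
  · exact mul_ne_zero (mul_ne_zero (mul_ne_zero ha₁0 ha₃0) hJint) (ENNReal.inv_ne_zero.2 ha₂t)
  obtain ⟨φ, hφ⟩ : ∃ φ : (Fin (k + 1) → Block d) × (Fin (k + 1) → Fin d → ℝ) → ENNReal,
      ∀ ζ, φ ζ = deflatedStat H z (∏ i, chainScalar ζ i)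
        (List.ofFn (chainQuotient ζ)).prod.charpoly := ⟨_, fun _ => rfl⟩
  have hφm : Measurable φ := by
    rw [funext hφ]
    exact measurable_deflatedStat hH z continuous_prod_chainScalar continuous_chainQuotient_prod
  have hae := ae_rootStat_eq_tsum (k := k) (d := d) H z
  have hmeas : AEMeasurable fun ω => rootStat H z (prodMatrix (d + 1) (k + 1) ω).charpoly := by
    refine aemeasurable_of_comp_assembleEquiv ?_
    refine ((area_formula volume contDiff_deflationMap hφm).1).congr ?_
    filter_upwards [hae] with c hc
    rw [hc]
    exact tsum_congr fun ζ => hφ _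
  refine ⟨hmeas.mono_ac (hasExpDensity_gaussianEnsemble hv _ _).absolutelyContinuous, ?_⟩
  rw [hγ _ hmeas, lintegral_comp_assembleEquiv hvol]
  have hstep : ∫⁻ c, ENNReal.ofReal (Real.exp
      (-((∑ i, ∑ r, ∑ s, assembleEquiv k d c i r s ^ 2) / (2 * v)))) *
        rootStat H z (prodMatrix (d + 1) (k + 1) (assembleEquiv k d c)).charpoly =
      ∫⁻ ζ, ENNReal.ofReal |(fderiv ℝ (deflationMap (k := k) (d := d)) ζ).det| * (w ζ * φ ζ) := by
    refine Eq.trans ?_ (area_formula volume contDiff_deflationMap (hwm.mul hφm)).2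
    refine lintegral_congr_ae ?_
    filter_upwards [hae] with c hc
    rw [hc, ← ENNReal.tsum_mul_left]
    refine tsum_congr fun ζ => ?_
    have hζ : deflationMap ζ.1 = c := ζ.2
    rw [Pi.mul_apply, hφ, hw, hζ]
    rfl
  rw [hstep]
  have hdm : Measurable fun ζ : (Fin (k + 1) → Block d) × (Fin (k + 1) → Fin d → ℝ) =>
      ENNReal.ofReal |(fderiv ℝ (deflationMap (k := k) (d := d)) ζ).det| * (w ζ * φ ζ) := by
    refine Measurable.mul ?_ (hwm.mul hφm)
    simp only [det_fderiv_deflationMap, ← eval_charpoly_eq_det]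
    exact (ENNReal.continuous_ofReal.comp (continuous_abs.comp
      (continuous_eval_charpoly continuous_chainQuotient_prod continuous_prod_chainScalar))).measurable
  rw [Measure.volume_eq_prod, lintegral_prod_symm _ hdm.aemeasurable]
  have hinner : ∀ y : Fin (k + 1) → Fin d → ℝ, ∫⁻ Z : Fin (k + 1) → Block d,
      ENNReal.ofReal |(fderiv ℝ (deflationMap (k := k) (d := d)) (Z, y)).det| * (w (Z, y) * φ (Z, y)) =
      J y * (a₂⁻¹ * ∫⁻ T, ENNReal.ofReal
        |(prodMatrix d (k + 1) fun i => (T i).2.2).charpoly.eval (∏ i, (T i).1)| *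
        deflatedStat H z (∏ i, (T i).1) (prodMatrix d (k + 1) fun i => (T i).2.2).charpoly
          ∂(blockLaw v k d)) := by
    intro y
    have h := hJ y fun l q => ENNReal.ofReal |q.eval l| * deflatedStat H z l q
    have hcA : Continuous fun T : Fin (k + 1) → Block d =>
        prodMatrix d (k + 1) fun i => (T i).2.2 := (continuous_prodMatrix d (k + 1)).comp (by fun_prop)
    have hcl : Continuous fun T : Fin (k + 1) → Block d => ∏ i, (T i).1 := by fun_prop
    rw [hτ _ (Measurable.aemeasurable ?_), ← mul_assoc a₂⁻¹, ENNReal.inv_mul_cancel ha₂0 ha₂t, one_mul,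
      ← h]
    · refine lintegral_congr fun Z => ?_
      rw [det_fderiv_deflationMap, ← eval_charpoly_eq_det, hw, hφ]
      ring
    · refine Measurable.mul ?_ (measurable_deflatedStat hH z hcl hcA)
      exact (ENNReal.continuous_ofReal.comp (continuous_abs.comp
        (continuous_eval_charpoly hcA hcl))).measurable
  rw [lintegral_congr hinner, lintegral_mul_const _ hJm]
  have hcA : Continuous fun p : (Fin (k + 1) → ℝ) × (Fin (k + 1) → Fin d → Fin d → ℝ) =>
      prodMatrix d (k + 1) p.2 := (continuous_prodMatrix d (k + 1)).comp continuous_snd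
  have hcl : Continuous fun p : (Fin (k + 1) → ℝ) × (Fin (k + 1) → Fin d → Fin d → ℝ) =>
      ∏ i, p.1 i := by fun_prop
  have hlast := lintegral_blockLaw v k d (F := fun ξ A =>
    ENNReal.ofReal |(prodMatrix d (k + 1) A).charpoly.eval (∏ i, ξ i)| *
      deflatedStat H z (∏ i, ξ i) (prodMatrix d (k + 1) A).charpoly) (by
        refine Measurable.mul ?_ (measurable_deflatedStat hH z hcl hcA)
        exact (ENNReal.continuous_ofReal.comp (continuous_abs.comp
          (continuous_eval_charpoly hcA hcl))).measurable)
  rw [← hlast]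
  ring

lemma sign_finset_prod {ι : Type*} (S : Finset ι) (f : ι → ℝ) :
    (SignType.sign (∏ i ∈ S, f i) : ℝ) = ∏ i ∈ S, (SignType.sign (f i) : ℝ) := by
  classical
  induction S using Finset.induction_on with
  | empty => simp
  | insert a S ha ih => rw [Finset.prod_insert ha, Finset.prod_insert ha, sign_mul, ← ih]; simp

lemma sum_sign_eq_prod_sign (S : Finset ℝ) : ∀ y ∉ S,
    ∑ v ∈ S, (∏ u ∈ S.erase v, (SignType.sign (v - u) : ℝ)) * (SignType.sign (y - v) : ℝ) =
      ∏ v ∈ S, (SignType.sign (y - v) : ℝ) - (1 + (-1) ^ S.card) / 2 := by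
  induction S using Finset.induction_on_max with
  | empty => intro y _; simp
  | insert u S hu ih =>
    intro y hy
    have hyu : y ≠ u := fun h => hy (by simp [h])
    have hyS : y ∉ S := fun h => hy (by simp [h])
    have huS : u ∉ S := fun h => lt_irrefl _ (hu u h)
    have h1 : ∀ v ∈ S, ∏ w ∈ (insert u S).erase v, (SignType.sign (v - w) : ℝ) =
        -∏ w ∈ S.erase v, (SignType.sign (v - w) : ℝ) := by
      intro v hv
      have hvu : v ≠ u := fun h => huS (h ▸ hv)
      rw [Finset.erase_insert_of_ne hvu.symm, Finset.prod_insert (by simp [huS]),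
        sign_neg (sub_neg.2 (hu v hv))]
      simp
    have h2 : ∏ w ∈ S, (SignType.sign (u - w) : ℝ) = 1 :=
      Finset.prod_eq_one fun w hw => by rw [sign_pos (sub_pos.2 (hu w hw))]; simp
    rw [Finset.sum_insert huS, Finset.erase_insert huS, h2, Finset.sum_congr rfl fun v hv => by
      rw [h1 v hv, neg_mul], Finset.sum_neg_distrib, ih y hyS, Finset.prod_insert huS,
      Finset.card_insert_of_notMem huS, pow_succ]
    rcases lt_or_gt_of_ne hyu with h | h
    · rw [sign_neg (sub_neg.2 h)]; simp; ring
    · have h3 : ∏ w ∈ S, (SignType.sign (y - w) : ℝ) = 1 :=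
        Finset.prod_eq_one fun w hw => by rw [sign_pos (sub_pos.2 ((hu w hw).trans h))]; simp
      rw [sign_pos (sub_pos.2 h), h3]; simp; ring

lemma eval_pos_of_monic_of_roots_eq_zero {q : Polynomial ℝ} (hq : q.Monic) (h : q.roots = 0) (y : ℝ) :
    0 < q.eval y := by
  have hne : ∀ x, q.eval x ≠ 0 := fun x hx => by
    have : x ∈ q.roots := (Polynomial.mem_roots hq.ne_zero).2 hx
    simp [h] at this
  rcases Nat.eq_zero_or_pos q.natDegree with h0 | h0
  · rw [hq.natDegree_eq_zero.1 h0]; simp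
  · have ht := q.tendsto_atTop_of_leadingCoeff_nonneg (Polynomial.natDegree_pos_iff_degree_pos.1 h0)
      (by rw [hq.leadingCoeff]; norm_num)
    obtain ⟨x, hx⟩ := (ht.eventually_gt_atTop 0).exists
    by_contra hy
    have hmem := mem_range_of_exists_le_of_exists_ge q.continuous ⟨y, not_lt.1 hy⟩ ⟨x, hx.le⟩
    obtain ⟨c, hc⟩ := hmem
    exact hne c hc

lemma even_natDegree_of_roots_eq_zero {q : Polynomial ℝ} (hq : q.Monic) (h : q.roots = 0) :
    Even q.natDegree := by
  by_contra hodd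
  rw [Nat.not_even_iff_odd] at hodd
  have hd : (q.comp (-Polynomial.X)).natDegree = q.natDegree := by simp [Polynomial.natDegree_comp]
  have hlc : (q.comp (-Polynomial.X)).leadingCoeff = -1 := by
    rw [Polynomial.leadingCoeff_comp (by simp), hq.leadingCoeff]
    simp [hodd.neg_one_pow]
  have ht := (q.comp (-Polynomial.X)).tendsto_atBot_of_leadingCoeff_nonpos
    (Polynomial.natDegree_pos_iff_degree_pos.1 (by rw [hd]; exact hodd.pos)) (by rw [hlc]; norm_num)
  obtain ⟨x, hx⟩ := (ht.eventually_lt_atBot 0).exists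
  have := eval_pos_of_monic_of_roots_eq_zero hq h (-x)
  simp at hx
  linarith

/-- A monic real polynomial of odd degree with simple real roots has its sign determined by the
signs of its derivative at the roots. -/
lemma abs_eval_eq_mul_sum_sign {p : Polynomial ℝ} (hp : p.Monic) (hodd : Odd p.natDegree)
    (hs : ∀ x ∈ p.roots, p.derivative.eval x ≠ 0) (y : ℝ) :
    |p.eval y| = p.eval y * (p.roots.map fun v =>
      (SignType.sign (p.derivative.eval v) : ℝ) * (SignType.sign (y - v) : ℝ)).sum := by
  classical
  by_cases hy0 : p.eval y = 0
  · simp [hy0]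
  have hnd := nodup_roots_of_derivative_ne_zero hp.ne_zero hs
  obtain ⟨q, hpq, hdeg, hq⟩ := p.exists_prod_multiset_X_sub_C_mul
  obtain ⟨S, hS⟩ : ∃ S : Finset ℝ, S = p.roots.toFinset := ⟨_, rfl⟩
  have hSval : S.val = p.roots := by rw [hS, Multiset.toFinset_val, Multiset.dedup_eq_self.2 hnd]
  have hprod : (p.roots.map fun a => Polynomial.X - Polynomial.C a).prod =
      ∏ v ∈ S, (Polynomial.X - Polynomial.C v) := by rw [Finset.prod, hSval]
  have hqm : q.Monic := by
    have h1 : (∏ v ∈ S, (Polynomial.X - Polynomial.C v)).Monic :=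
      Polynomial.monic_prod_of_monic _ _ fun v _ => Polynomial.monic_X_sub_C v
    rw [hprod] at hpq
    exact h1.of_mul_monic_left (hpq ▸ hp)
  have hcard : Odd S.card := by
    have he := even_natDegree_of_roots_eq_zero hqm hq
    have hc : S.card = p.roots.card := by rw [← hSval]; rfl
    rw [hc]
    rw [← hdeg] at hodd
    exact (Nat.odd_add.1 hodd).2 he
  have hqpos := eval_pos_of_monic_of_roots_eq_zero hqm hq
  rw [hprod] at hpq
  have hyS : y ∉ S := fun h => hy0 <| by
    rw [hS, Multiset.mem_toFinset, Polynomial.mem_roots hp.ne_zero] at h; exact h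
  have hder : ∀ v ∈ S, p.derivative.eval v = (∏ u ∈ S.erase v, (v - u)) * q.eval v := by
    intro v hv
    rw [← hpq, ← Finset.mul_prod_erase S _ hv]
    simp [Polynomial.eval_prod]
  have hsgn : (SignType.sign (p.eval y) : ℝ) = ∏ v ∈ S, (SignType.sign (y - v) : ℝ) := by
    rw [← hpq, Polynomial.eval_mul, sign_mul, sign_pos (hqpos y), Polynomial.eval_prod]
    simp [sign_finset_prod]
  have hsum : (p.roots.map fun v =>
      (SignType.sign (p.derivative.eval v) : ℝ) * (SignType.sign (y - v) : ℝ)).sum =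
      ∑ v ∈ S, (∏ u ∈ S.erase v, (SignType.sign (v - u) : ℝ)) * (SignType.sign (y - v) : ℝ) := by
    rw [← hSval]
    refine Finset.sum_congr rfl fun v hv => ?_
    rw [hder v hv, sign_mul, sign_pos (hqpos v)]
    simp [sign_finset_prod]
  rw [hsum, sum_sign_eq_prod_sign S y hyS, hcard.neg_one_pow, ← hsgn]
  rw [add_neg_cancel, zero_div, sub_zero, mul_comm, sign_mul_self]

/-- Having finite moments of every order. -/
def AllMemLp {Ω : Type*} [MeasurableSpace Ω] (F : Ω → ℝ) (μ : Measure Ω) : Prop :=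
  ∀ p : NNReal, MemLp F p μ

namespace AllMemLp

variable {Ω Ω' ι : Type*} [MeasurableSpace Ω] [MeasurableSpace Ω'] {μ : Measure Ω} {μ' : Measure Ω'}
  {F G : Ω → ℝ}

lemma mul (hF : AllMemLp F μ) (hG : AllMemLp G μ) : AllMemLp (fun x => F x * G x) μ := by
  intro p
  have : ENNReal.HolderTriple ((2 * p : NNReal) : ENNReal) ((2 * p : NNReal) : ENNReal) p := by
    constructor
    rw [ENNReal.coe_mul, ENNReal.mul_inv (by simp) (by simp), ← add_mul]
    simp [ENNReal.inv_two_add_inv_two]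
  exact MemLp.mul (p := ((2 * p : NNReal) : ENNReal)) (q := ((2 * p : NNReal) : ENNReal))
    (hG (2 * p)) (hF (2 * p))

lemma sub (hF : AllMemLp F μ) (hG : AllMemLp G μ) : AllMemLp (fun x => F x - G x) μ :=
  fun p => (hF p).sub (hG p)

lemma abs (hF : AllMemLp F μ) : AllMemLp (fun x => |F x|) μ := fun p => (hF p).abs

lemma const [IsFiniteMeasure μ] (c : ℝ) : AllMemLp (fun _ : Ω => c) μ := fun _ => memLp_const c

lemma sum (S : Finset ι) {F : ι → Ω → ℝ} (h : ∀ i ∈ S, AllMemLp (F i) μ) :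
    AllMemLp (fun x => ∑ i ∈ S, F i x) μ :=
  fun p => memLp_finsetSum S fun i hi => h i hi p

lemma prod [IsFiniteMeasure μ] (S : Finset ι) {F : ι → Ω → ℝ} (h : ∀ i ∈ S, AllMemLp (F i) μ) :
    AllMemLp (fun x => ∏ i ∈ S, F i x) μ := by
  classical
  induction S using Finset.induction_on with
  | empty => simpa using const 1
  | insert a S ha ih =>
    simp only [Finset.prod_insert ha]
    exact (h a (by simp)).mul (ih fun i hi => h i (by simp [hi]))

lemma pow [IsFiniteMeasure μ] (hF : AllMemLp F μ) (n : ℕ) : AllMemLp (fun x => F x ^ n) μ := by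
  have := prod (Finset.range n) (F := fun _ => F) (fun _ _ => hF)
  simpa using this

lemma comp {φ : Ω' → Ω} (hF : AllMemLp F μ) (hφ : MeasurePreserving φ μ' μ) :
    AllMemLp (fun x => F (φ x)) μ' := fun p => (hF p).comp_measurePreserving hφ

lemma integrable (hF : AllMemLp F μ) : Integrable F μ := by
  have := hF 1
  rw [ENNReal.coe_one] at this
  exact memLp_one_iff_integrable.1 this

lemma gaussianReal (v : NNReal) : AllMemLp (fun x => x) (gaussianReal 0 v) :=
  fun p => memLp_id_gaussianReal p

lemma det [IsFiniteMeasure μ] [Fintype ι] [DecidableEq ι] {A : Ω → Matrix ι ι ℝ}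
    (hA : ∀ i j, AllMemLp (fun x => A x i j) μ) : AllMemLp (fun x => (A x).det) μ := by
  simp only [Matrix.det_apply']
  exact sum _ fun σ _ => (const _).mul (prod _ fun i _ => hA _ _)

lemma eval_charpoly [IsFiniteMeasure μ] [Fintype ι] [DecidableEq ι] {A : Ω → Matrix ι ι ℝ}
    (hA : ∀ i j, AllMemLp (fun x => A x i j) μ) {y : Ω → ℝ} (hy : AllMemLp y μ) :
    AllMemLp (fun x => (A x).charpoly.eval (y x)) μ := by
  simp only [eval_charpoly_eq_det]
  refine det fun i j => ?_
  simp only [Matrix.sub_apply, Matrix.smul_apply, smul_eq_mul]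
  exact (hy.mul (const _)).sub (hA i j)

lemma matrix_mul [Fintype ι] {A B : Ω → Matrix ι ι ℝ}
    (hA : ∀ i j, AllMemLp (fun x => A x i j) μ) (hB : ∀ i j, AllMemLp (fun x => B x i j) μ)
    (i j : ι) : AllMemLp (fun x => (A x * B x) i j) μ := by
  simp only [Matrix.mul_apply]
  exact sum _ fun l _ => (hA i l).mul (hB l j)

lemma ofFn_prod [IsFiniteMeasure μ] [Fintype ι] [DecidableEq ι] :
    ∀ {m : ℕ} {A : Ω → Fin m → Matrix ι ι ℝ}, (∀ l i j, AllMemLp (fun x => A x l i j) μ) →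
      ∀ i j, AllMemLp (fun x => (List.ofFn (A x)).prod i j) μ
  | 0, A, _, i, j => by simpa using const _
  | m + 1, A, h, i, j => by
    simp only [List.ofFn_succ, List.prod_cons]
    exact matrix_mul (h 0) (ofFn_prod fun l => h l.succ) i j

lemma prodMatrix (v : NNReal) (n m : ℕ) (i j : Fin n) :
    AllMemLp (fun ω => prodMatrix n m ω i j) (gaussianEnsemble v n m) := by
  refine ofFn_prod (fun l r s => ?_) i j
  have h1 := measurePreserving_eval (fun _ : Fin n => ProbabilityTheory.gaussianReal 0 v) s
  have h2 := measurePreserving_eval (fun _ : Fin n => Measure.pi fun _ : Fin n =>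
    ProbabilityTheory.gaussianReal 0 v) r
  have h3 := measurePreserving_eval (fun _ : Fin m => Measure.pi fun _ : Fin n =>
    Measure.pi fun _ : Fin n => ProbabilityTheory.gaussianReal 0 v) l
  exact (((gaussianReal v).comp h1).comp h2).comp h3

lemma prod_scalars (v : NNReal) (m : ℕ) : AllMemLp (fun ξ : Fin m → ℝ => ∏ i, ξ i)
    (Measure.pi fun _ => ProbabilityTheory.gaussianReal 0 v) :=
  prod _ fun i _ => (gaussianReal v).comp
    (measurePreserving_eval (fun _ : Fin m => ProbabilityTheory.gaussianReal 0 v) i)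

end AllMemLp

section SelectionDeterminants

variable {n : ℕ}

/-- The `i`-th basis vector, or a prescribed row of `B`. -/
def optRow (B : Matrix (Fin n) (Fin n) ℝ) (i : Fin n) : Option (Fin n) → Fin n → ℝ
  | none => Pi.single i 1
  | some l => B l

/-- The determinant of the matrix whose rows are chosen by `o`. -/
noncomputable def selDet (B : Matrix (Fin n) (Fin n) ℝ) (o : Fin n → Option (Fin n)) : ℝ :=
  (Matrix.of fun i => optRow B i (o i)).det

lemma det_sum_optRow (ξ : Fin n → Option (Fin n) → ℝ) (B : Matrix (Fin n) (Fin n) ℝ) :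
    (Matrix.of fun i => ∑ q, ξ i q • optRow B i q).det = ∑ o, (∏ i, ξ i (o i)) * selDet B o := by
  have h := (Matrix.detRowAlternating (n := Fin n) (R := ℝ)).toMultilinearMap.map_sum
    (fun i q => ξ i q • optRow B i q)
  refine Eq.trans h (Finset.sum_congr rfl fun o _ => ?_)
  exact (Matrix.detRowAlternating (n := Fin n) (R := ℝ)).toMultilinearMap.map_smul_univ
    (fun i => ξ i (o i)) (fun i => optRow B i (o i))

lemma integral_det_mul_det {Ω : Type*} [MeasurableSpace Ω] {μ : Measure Ω}
    {ξ ξ' : Ω → Fin n → Option (Fin n) → ℝ} {W : (Fin n → Option (Fin n)) → ℝ}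
    (hint : ∀ o o' : Fin n → Option (Fin n), Integrable (fun ω => (∏ i, ξ ω i (o i)) * ∏ i, ξ' ω i (o' i)) μ)
    (h : ∀ o o', ∫ ω, (∏ i, ξ ω i (o i)) * ∏ i, ξ' ω i (o' i) ∂μ = if o = o' then W o else 0)
    (B : Matrix (Fin n) (Fin n) ℝ) :
    ∫ ω, (Matrix.of fun i => ∑ q, ξ ω i q • optRow B i q).det *
      (Matrix.of fun i => ∑ q, ξ' ω i q • optRow B i q).det ∂μ = ∑ o, W o * selDet B o ^ 2 := by
  have e : ∀ ω, (Matrix.of fun i => ∑ q, ξ ω i q • optRow B i q).det *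
      (Matrix.of fun i => ∑ q, ξ' ω i q • optRow B i q).det
      = ∑ o, ∑ o', ((∏ i, ξ ω i (o i)) * ∏ i, ξ' ω i (o' i)) * (selDet B o * selDet B o') := by
    intro ω
    rw [det_sum_optRow, det_sum_optRow, Finset.sum_mul_sum]
    exact Finset.sum_congr rfl fun o _ => Finset.sum_congr rfl fun o' _ => by ring
  simp only [e]
  rw [integral_finsetSum _ fun o _ => integrable_finsetSum _ fun o' _ => (hint o o').mul_const _]
  refine Finset.sum_congr rfl fun o _ => ?_
  rw [integral_finsetSum _ fun o' _ => (hint o o').mul_const _]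
  simp only [integral_mul_const, h]
  simp [sq]

lemma selDet_eq_zero {B : Matrix (Fin n) (Fin n) ℝ} {o : Fin n → Option (Fin n)} {i j : Fin n}
    (hij : i ≠ j) (hi : o i = o j) (hn : o i ≠ none) : selDet B o = 0 := by
  refine Matrix.det_zero_of_row_eq hij ?_
  ext k
  obtain ⟨l, hl⟩ := Option.ne_none_iff_exists'.1 hn
  simp [optRow, hl, ← hi]

end SelectionDeterminants

section GaussianRows

variable {n : ℕ}

lemma integral_sq_gaussianReal (v : NNReal) : ∫ x, x * x ∂(gaussianReal 0 v) = v := by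
  have h := variance_of_integral_eq_zero (μ := gaussianReal 0 v) (X := id) aemeasurable_id
    (by simp)
  rw [variance_id_gaussianReal] at h
  simp [h, sq]

lemma integral_eval_gaussianReal_pi (v : NNReal) (a : Fin n) :
    ∫ x, x a ∂(Measure.pi fun _ : Fin n => gaussianReal 0 v) = 0 := by
  have := integral_comp_eval (μ := fun _ : Fin n => gaussianReal 0 v) (i := a) (f := id)
    aestronglyMeasurable_id
  simpa using this

lemma integral_eval_mul_eval_gaussianReal_pi (v : NNReal) (a b : Fin n) :
    ∫ x, x a * x b ∂(Measure.pi fun _ : Fin n => gaussianReal 0 v) = if a = b then (v : ℝ) else 0 := by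
  split_ifs with h
  · subst h
    have := integral_comp_eval (μ := fun _ : Fin n => gaussianReal 0 v) (i := a)
      (f := fun x => x * x) (by fun_prop)
    rw [integral_sq_gaussianReal] at this
    exact this
  · have e : ∀ x : Fin n → ℝ, x a * x b
        = ∏ i, (if i = a ∨ i = b then x i else 1) := by
      intro x
      rw [Finset.prod_ite]
      have : ({i | i = a ∨ i = b} : Finset (Fin n)) = {a, b} := by ext; simp
      rw [this, Finset.prod_pair h]
      simp
    simp only [e]
    rw [integral_fintype_prod_eq_prod (fun i x => if i = a ∨ i = b then x else (1:ℝ))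
      (μ := fun _ : Fin n => gaussianReal 0 v)]
    exact Finset.prod_eq_zero (Finset.mem_univ a) (by simp)

lemma AllMemLp.eval_gaussianReal_pi (v : NNReal) (a : Fin n) :
    AllMemLp (fun x => x a) (Measure.pi fun _ : Fin n => ProbabilityTheory.gaussianReal 0 v) :=
  (AllMemLp.gaussianReal v).comp
    (measurePreserving_eval (fun _ : Fin n => ProbabilityTheory.gaussianReal 0 v) a)

lemma AllMemLp.entry_gaussianReal_pi (v : NNReal) (a b : Fin n) :
    AllMemLp (fun x => x a b) (Measure.pi fun _ : Fin n => Measure.pi fun _ : Fin n =>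
      ProbabilityTheory.gaussianReal 0 v) :=
  (AllMemLp.eval_gaussianReal_pi v b).comp (measurePreserving_eval (fun _ : Fin n =>
    Measure.pi fun _ : Fin n => ProbabilityTheory.gaussianReal 0 v) a)

/-- The coefficients of the rows of `x - X B`. -/
def charCoeff (x : ℝ) (y : Fin n → ℝ) : Option (Fin n) → ℝ
  | none => x
  | some l => - y l

lemma smul_one_sub_mul_eq (x : ℝ) (X : Fin n → Fin n → ℝ) (B : Matrix (Fin n) (Fin n) ℝ) :
    x • 1 - Matrix.of X * B = Matrix.of fun i => ∑ q, charCoeff x (X i) q • optRow B i q := by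
  ext i j
  simp [Fintype.sum_option, charCoeff, optRow, Matrix.mul_apply, Matrix.one_apply, Pi.single_apply,
    sub_eq_add_neg, eq_comm]

lemma integral_charCoeff_mul (v : NNReal) (x z : ℝ) (q q' : Option (Fin n)) :
    ∫ y, charCoeff x y q * charCoeff z y q' ∂(Measure.pi fun _ : Fin n => gaussianReal 0 v)
      = if q = q' then (if q = none then x * z else v) else 0 := by
  cases q <;> cases q' <;>
    simp [charCoeff, integral_const_mul, integral_mul_const, integral_neg,
      integral_eval_gaussianReal_pi, integral_eval_mul_eval_gaussianReal_pi]

lemma prod_ite_eq_ite_prod (o o' : Fin n → Option (Fin n)) (w : Fin n → ℝ) :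
    ∏ i, (if o i = o' i then w i else 0) = if o = o' then ∏ i, w i else 0 := by
  split_ifs with h
  · simp [h]
  · obtain ⟨i, hi⟩ := Function.ne_iff.1 h
    exact Finset.prod_eq_zero (Finset.mem_univ i) (by simp [hi])

/-- The number of rows selected from the matrix. -/
def selCard (o : Fin n → Option (Fin n)) : ℕ := (Finset.univ.filter fun i => o i ≠ none).card

lemma prod_option_weight (a b : ℝ) (o : Fin n → Option (Fin n)) :
    ∏ i, (if o i = none then a else b) = a ^ (n - selCard o) * b ^ selCard o := by
  rw [Finset.prod_ite, Finset.prod_const, Finset.prod_const]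
  congr 2
  have := Finset.card_filter_add_card_filter_not (s := (Finset.univ : Finset (Fin n)))
    (fun i => o i = none)
  simp only [Finset.card_univ, Fintype.card_fin] at this
  change _ = n - (Finset.univ.filter fun i => ¬ o i = none).card
  omega

lemma integral_charpoly_mul (v : NNReal) (x z : ℝ) (B : Matrix (Fin n) (Fin n) ℝ) :
    ∫ X, (Matrix.of X * B).charpoly.eval x * (Matrix.of X * B).charpoly.eval z
      ∂(Measure.pi fun _ : Fin n => Measure.pi fun _ : Fin n => gaussianReal 0 v)
    = ∑ o, ((x * z) ^ (n - selCard o) * (v : ℝ) ^ selCard o) * selDet B o ^ 2 := by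
  simp only [eval_charpoly_eq_det, smul_one_sub_mul_eq]
  have hL : ∀ (x : ℝ) (i : Fin n) (q : Option (Fin n)), AllMemLp (fun X => charCoeff x (X i) q)
      (Measure.pi fun _ : Fin n => Measure.pi fun _ : Fin n => gaussianReal 0 v) := by
    intro x i q
    cases q with
    | none => exact AllMemLp.const x
    | some l =>
      have := (AllMemLp.const (-1) (μ := Measure.pi fun _ : Fin n => Measure.pi fun _ : Fin n =>
        gaussianReal 0 v)).mul (AllMemLp.entry_gaussianReal_pi v i l)
      simpa [charCoeff] using this
  refine integral_det_mul_det (fun o o' => ?_) (fun o o' => ?_) B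
  · exact ((AllMemLp.prod _ fun i _ => hL x i (o i)).mul
      (AllMemLp.prod _ fun i _ => hL z i (o' i))).integrable
  · simp only [← Finset.prod_mul_distrib]
    rw [integral_fintype_prod_eq_prod (fun i y => charCoeff x y (o i) * charCoeff z y (o' i))
      (μ := fun _ : Fin n => Measure.pi fun _ : Fin n => gaussianReal 0 v)]
    simp only [integral_charCoeff_mul]
    rw [prod_ite_eq_ite_prod, prod_option_weight]

/-- The selection uses no row twice. -/
def SelInjective (o : Fin n → Option (Fin n)) : Prop :=
  ∀ i j, o i ≠ none → o i = o j → i = j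

lemma selDet_eq_zero_of_not_selInjective {B : Matrix (Fin n) (Fin n) ℝ}
    {o : Fin n → Option (Fin n)} (h : ¬ SelInjective o) : selDet B o = 0 := by
  simp only [SelInjective, not_forall] at h
  obtain ⟨i, j, h1, h2, h3⟩ := h
  exact selDet_eq_zero h3 h2 h1

lemma integral_prod_selection {E : Type*} [MeasurableSpace E] {ρ : Measure E}
    [IsProbabilityMeasure ρ] {o : Fin n → Option (Fin n)} (ho : SelInjective o)
    (c : Fin n → ℝ) (h : Fin n → E → ℝ) :
    ∫ X, ∏ i, (o i).elim (c i) (fun l => h i (X l)) ∂(Measure.pi fun _ : Fin n => ρ)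
      = ∏ i, (o i).elim (c i) (fun _ => ∫ y, h i y ∂ρ) := by
  classical
  have e : ∀ g : Fin n → Option (Fin n) → ℝ, ∏ i, g i (o i)
      = (∏ i with o i = none, g i none) * ∏ l, ∏ i with o i = some l, g i (some l) := by
    intro g
    rw [← Finset.prod_fiberwise (s := Finset.univ) (g := o), Fintype.prod_option]
    congr 1
    · exact Finset.prod_congr rfl fun i hi => by rw [(Finset.mem_filter.1 hi).2]
    · exact Finset.prod_congr rfl fun l _ => Finset.prod_congr rfl fun i hi => by
        rw [(Finset.mem_filter.1 hi).2]
  have e1 : ∀ X : Fin n → E, ∏ i, (o i).elim (c i) (fun l => h i (X l))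
      = (∏ i with o i = none, c i) * ∏ l, ∏ i with o i = some l, h i (X l) := fun X =>
    e fun i q => q.elim (c i) fun l => h i (X l)
  have e2 := e fun i q => q.elim (c i) fun l => ∫ y, h i y ∂ρ
  simp only [e1, integral_const_mul]
  rw [e2, integral_fintype_prod_eq_prod (fun l y => ∏ i with o i = some l, h i y)
    (μ := fun _ : Fin n => ρ)]
  simp only [Option.elim]
  congr 1
  refine Finset.prod_congr rfl fun l _ => ?_
  rcases Finset.eq_empty_or_nonempty (Finset.univ.filter fun i => o i = some l) with h0 | ⟨a, ha⟩
  · rw [h0]; simp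
  · have : (Finset.univ.filter fun i => o i = some l) = {a} := by
      simp only [Finset.mem_filter, Finset.mem_univ, true_and] at ha
      ext i
      simp only [Finset.mem_filter, Finset.mem_univ, true_and, Finset.mem_singleton]
      constructor
      · intro hi
        exact ho i a (by simp [hi]) (by rw [hi, ha])
      · rintro rfl
        exact ha
    rw [this]; simp

/-- The coefficients of a row of `X B` in the rows of `B`. -/
def rowCoeff (y : Fin n → ℝ) : Option (Fin n) → ℝ
  | none => 0
  | some l => y l

/-- The coefficients of a selected row of `X B`. -/
def stepCoeff (X : Fin n → Fin n → ℝ) (q q' : Option (Fin n)) : ℝ :=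
  q.elim (if q' = none then 1 else 0) fun l => rowCoeff (X l) q'

lemma selDet_mul (X : Fin n → Fin n → ℝ) (B : Matrix (Fin n) (Fin n) ℝ)
    (o : Fin n → Option (Fin n)) : selDet (Matrix.of X * B) o
      = (Matrix.of fun i => ∑ q, stepCoeff X (o i) q • optRow B i q).det := by
  unfold selDet
  congr 1
  ext i j
  rcases h : o i with _ | l <;>
  simp [Fintype.sum_option, stepCoeff, rowCoeff, optRow, Matrix.mul_apply, h]

lemma integral_rowCoeff_mul (v : NNReal) (q q' : Option (Fin n)) :
    ∫ y, rowCoeff y q * rowCoeff y q' ∂(Measure.pi fun _ : Fin n => gaussianReal 0 v)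
      = if q = q' then (if q = none then 0 else (v : ℝ)) else 0 := by
  cases q <;> cases q' <;>
    simp [rowCoeff, integral_eval_mul_eval_gaussianReal_pi]

/-- Two selections select from the same positions. -/
def SameSupport (o o' : Fin n → Option (Fin n)) : Prop := ∀ i, o i = none ↔ o' i = none

open Classical in
lemma integral_selDet_sq (v : NNReal) (B : Matrix (Fin n) (Fin n) ℝ)
    {o : Fin n → Option (Fin n)} (ho : SelInjective o) :
    ∫ X, selDet (Matrix.of X * B) o ^ 2
      ∂(Measure.pi fun _ : Fin n => Measure.pi fun _ : Fin n => gaussianReal 0 v)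
    = ∑ o', (if SameSupport o o' then (v : ℝ) ^ selCard o' else 0) * selDet B o' ^ 2 := by
  simp only [selDet_mul, sq (Matrix.det _)]
  have hL : ∀ (q q' : Option (Fin n)), AllMemLp (fun X => stepCoeff X q q')
      (Measure.pi fun _ : Fin n => Measure.pi fun _ : Fin n => gaussianReal 0 v) := by
    intro q q'
    rcases q with _ | l
    · exact AllMemLp.const _
    · rcases q' with _ | l'
      · exact AllMemLp.const _
      · exact AllMemLp.entry_gaussianReal_pi v l l'
  refine integral_det_mul_det (fun o' o'' => ?_) (fun o' o'' => ?_) B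
  · exact ((AllMemLp.prod _ fun i _ => hL (o i) (o' i)).mul
      (AllMemLp.prod _ fun i _ => hL (o i) (o'' i))).integrable
  · simp only [← Finset.prod_mul_distrib]
    have e : ∀ X : Fin n → Fin n → ℝ, ∀ i, stepCoeff X (o i) (o' i) * stepCoeff X (o i) (o'' i)
        = (o i).elim ((if o' i = none then 1 else 0) * (if o'' i = none then 1 else 0))
          (fun l => rowCoeff (X l) (o' i) * rowCoeff (X l) (o'' i)) := by
      intro X i
      rcases o i with _ | l <;> rfl
    simp only [e]
    rw [integral_prod_selection ho (fun i => (if o' i = none then 1 else 0) *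
      (if o'' i = none then 1 else 0)) (fun i y => rowCoeff y (o' i) * rowCoeff y (o'' i))]
    simp only [integral_rowCoeff_mul]
    have e' : ∀ i, (o i).elim ((if o' i = none then (1:ℝ) else 0) * (if o'' i = none then 1 else 0))
          (fun _ => if o' i = o'' i then (if o' i = none then 0 else (v:ℝ)) else 0)
        = if o' i = o'' i then (if (o i = none ↔ o' i = none) then (if o' i = none then 1 else (v : ℝ))
          else 0) else 0 := by
      intro i
      rcases o i with _ | l <;> rcases o' i with _ | l' <;> rcases o'' i with _ | l'' <;> simp
    simp only [e']
    rw [prod_ite_eq_ite_prod]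
    congr 1
    split_ifs with hs
    · have := prod_option_weight 1 (v:ℝ) o'
      simp only [one_pow, one_mul] at this
      rw [← this]
      exact Finset.prod_congr rfl fun i _ => by simp [hs i]
    · simp only [SameSupport, not_forall] at hs
      obtain ⟨i, hi⟩ := hs
      exact Finset.prod_eq_zero (Finset.mem_univ i) (by simp [hi])

end GaussianRows

section Counting

variable {n : ℕ}

open Classical in
lemma card_selInjective_sameSupport (o' : Fin n → Option (Fin n)) :
    (Finset.univ.filter fun o : Fin n → Option (Fin n) => SelInjective o ∧ SameSupport o o').card
      = n.descFactorial (selCard o') := by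
  have h := Fintype.card_embedding_eq (α := {i : Fin n // o' i ≠ none}) (β := Fin n)
  rw [Fintype.card_fin] at h
  have h2 : Fintype.card {i : Fin n // o' i ≠ none} = selCard o' := Fintype.card_subtype _
  rw [h2] at h
  rw [← h, ← Fintype.card_subtype]
  refine Fintype.card_congr
    { toFun := fun o => ⟨fun i => (o.1 i).get (Option.isSome_iff_ne_none.2
        fun h => i.2 ((o.2.2 i).1 h)), fun i j hij => ?_⟩
      invFun := fun l => ⟨fun i => if h : o' i ≠ none then some (l ⟨i, h⟩) else none, ?_, ?_⟩
      left_inv := ?_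
      right_inv := ?_ }
  · exact Subtype.ext (o.2.1 i j (fun h => i.2 ((o.2.2 i).1 h)) (Option.get_inj.1 hij))
  · intro i j hi hij
    beta_reduce at hi hij
    by_cases h : o' i ≠ none <;> by_cases h' : o' j ≠ none
    · rw [dif_pos h, dif_pos h'] at hij
      have := l.injective (Option.some_injective _ hij)
      simpa using this
    · rw [dif_pos h, dif_neg h'] at hij; simp at hij
    · rw [dif_neg h] at hi; simp at hi
    · rw [dif_neg h] at hi; simp at hi
  · intro i
    by_cases h : o' i = none <;> simp [h]
  · intro o
    ext1
    funext i
    by_cases h : o' i = none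
    · simp [h, (o.2.2 i).2 h]
    · simp only [ne_eq, h, not_false_eq_true, dite_true]
      exact Option.some_get _
  · intro l
    ext1 i
    simp

lemma selDet_one_sq (o : Fin n → Option (Fin n)) [Decidable (Function.Bijective fun i => (o i).getD i)] :
    selDet 1 o ^ 2 = if Function.Bijective (fun i => (o i).getD i) then 1 else 0 := by
  have e : selDet 1 o = ((1 : Matrix (Fin n) (Fin n) ℝ).submatrix (fun i => (o i).getD i) id).det := by
    unfold selDet
    congr 1
    ext i j
    rcases h : o i with _ | l <;> simp [optRow, Matrix.one_apply, Pi.single_apply, h, eq_comm]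
  rw [e]
  split_ifs with h
  · have := Matrix.det_permute (Equiv.ofBijective _ h) (1 : Matrix (Fin n) (Fin n) ℝ)
    rw [Equiv.coe_ofBijective] at this
    rw [this]
    rcases Int.units_eq_one_or (Equiv.Perm.sign (Equiv.ofBijective _ h)) with h' | h' <;> simp [h']
  · have : ¬ Function.Injective (fun i => (o i).getD i) := fun h' =>
      h (Finite.injective_iff_bijective.1 h')
    simp only [Function.Injective, not_forall] at this
    obtain ⟨i, j, hij, hne⟩ := this
    rw [Matrix.det_zero_of_row_eq hne]
    · simp
    · ext k
      exact congrArg (fun a => (1 : Matrix (Fin n) (Fin n) ℝ) a k) hij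

open Classical in
lemma sum_selDet_one_sq (c : ℕ → ℝ) :
    ∑ o : Fin n → Option (Fin n), c (selCard o) * selDet 1 o ^ 2
      = ∑ k ∈ Finset.range (n + 1), c k * n.descFactorial k := by
  simp only [selDet_one_sq, mul_ite, mul_one, mul_zero]
  rw [← Finset.sum_filter]
  have h1 : ∑ o : Fin n → Option (Fin n) with Function.Bijective (fun i => (o i).getD i),
      c (selCard o) = ∑ p : Finset (Fin n) × Equiv.Perm (Fin n) with
        (∀ i, i ∉ p.1 → p.2 i = i), c p.1.card := by
    refine Finset.sum_bij' (fun o ho => ⟨Finset.univ.filter fun i => o i ≠ none,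
        Equiv.ofBijective _ (Finset.mem_filter.1 ho).2⟩)
      (fun p _ => fun i => if i ∈ p.1 then some (p.2 i) else none) ?_ ?_ ?_ ?_ ?_
    · intro o ho
      simp +contextual
    · rintro ⟨S, σ⟩ hp
      simp only [Finset.mem_filter, Finset.mem_univ, true_and] at hp ⊢
      convert σ.bijective using 2 with i
      by_cases hi : i ∈ S <;> simp [hi, hp]
    · intro o ho
      funext i
      rcases h : o i with _ | l <;> simp [h]
    · rintro ⟨S, σ⟩ hp
      simp only [Finset.mem_filter, Finset.mem_univ, true_and] at hp
      refine Prod.ext (by ext; simp) (Equiv.ext fun i => ?_)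
      by_cases hi : i ∈ S <;> simp [hi, hp]
    · intro o ho
      rfl
  rw [h1, Finset.sum_filter, Fintype.sum_prod_type]
  have h2 : ∀ S : Finset (Fin n), ∑ σ : Equiv.Perm (Fin n),
      (if ∀ i, i ∉ S → σ i = i then c S.card else 0) = c S.card * S.card.factorial := by
    intro S
    rw [← Finset.sum_filter, Finset.sum_const, nsmul_eq_mul, mul_comm]
    congr 2
    rw [← Fintype.card_subtype]
    rw [← Fintype.card_congr (Equiv.Perm.subtypeEquivSubtypePerm (fun i => i ∈ S)),
      Fintype.card_perm]
    simp
  simp only [h2]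
  have := Finset.sum_powerset_apply_card (fun k => c k * (k.factorial : ℝ))
    (x := (Finset.univ : Finset (Fin n)))
  rw [Finset.powerset_univ, Finset.card_univ, Fintype.card_fin] at this
  rw [this]
  refine Finset.sum_congr rfl fun k _ => ?_
  rw [nsmul_eq_mul, Nat.descFactorial_eq_factorial_mul_choose]
  push_cast; ring

end Counting

section Covariance

variable {n : ℕ}

open Classical in
lemma integral_sum_selDet_sq (v : NNReal) (c : ℕ → ℝ) (B : Matrix (Fin n) (Fin n) ℝ) :
    ∫ X, ∑ o, c (selCard o) * selDet (Matrix.of X * B) o ^ 2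
      ∂(Measure.pi fun _ : Fin n => Measure.pi fun _ : Fin n => gaussianReal 0 v)
    = ∑ o, (c (selCard o) * ((n.descFactorial (selCard o) : ℝ) * (v : ℝ) ^ selCard o))
        * selDet B o ^ 2 := by
  have hint : ∀ o, Integrable (fun X => c (selCard o) * selDet (Matrix.of X * B) o ^ 2)
      (Measure.pi fun _ : Fin n => Measure.pi fun _ : Fin n => gaussianReal 0 v) := by
    intro o
    refine ((AllMemLp.const _).mul ((AllMemLp.det fun i j => ?_).pow 2)).integrable
    rcases h : o i with _ | l
    · simpa [optRow, h] using AllMemLp.const _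
    · simpa [optRow, h] using AllMemLp.matrix_mul
        (A := fun X => Matrix.of X) (B := fun _ => B)
        (fun i j => AllMemLp.entry_gaussianReal_pi v i j) (fun i j => AllMemLp.const _) l j
  rw [integral_finsetSum _ fun o _ => hint o]
  simp only [integral_const_mul]
  have e : ∀ o : Fin n → Option (Fin n), c (selCard o) * ∫ X, selDet (Matrix.of X * B) o ^ 2
      ∂(Measure.pi fun _ : Fin n => Measure.pi fun _ : Fin n => gaussianReal 0 v)
      = ∑ o', (if SelInjective o ∧ SameSupport o o' then c (selCard o') * (v:ℝ) ^ selCard o' else 0)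
        * selDet B o' ^ 2 := by
    intro o
    by_cases ho : SelInjective o
    · rw [integral_selDet_sq v B ho, Finset.mul_sum]
      refine Finset.sum_congr rfl fun o' _ => ?_
      by_cases hs : SameSupport o o'
      · have : selCard o = selCard o' := by
          unfold selCard
          congr 1
          ext i
          simp [hs i]
        simp [ho, hs, this, mul_assoc]
      · simp [hs]
    · simp [ho, selDet_eq_zero_of_not_selInjective ho]
  rw [Finset.sum_congr rfl fun o _ => e o, Finset.sum_comm]
  refine Finset.sum_congr rfl fun o' _ => ?_
  rw [← Finset.sum_mul, ← Finset.sum_filter, Finset.sum_const, card_selInjective_sameSupport,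
    nsmul_eq_mul]
  ring

lemma prodMatrix_succ (n m : ℕ) (ω : Fin (m + 1) → Fin n → Fin n → ℝ) :
    prodMatrix n (m + 1) ω = Matrix.of (ω 0) * prodMatrix n m (fun i => ω i.succ) := by
  unfold prodMatrix
  rw [List.ofFn_succ, List.prod_cons]

/-- Fubini for the first factor. -/
lemma integral_gaussianEnsemble_succ (v : NNReal) (n m : ℕ)
    (F : (Fin n → Fin n → ℝ) → (Fin m → Fin n → Fin n → ℝ) → ℝ)
    (hF : Integrable (fun ω => F (ω 0) (fun i => ω i.succ)) (gaussianEnsemble v n (m + 1))) :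
    ∫ ω, F (ω 0) (fun i => ω i.succ) ∂(gaussianEnsemble v n (m + 1))
      = ∫ ω, ∫ X, F X ω ∂(Measure.pi fun _ : Fin n => Measure.pi fun _ : Fin n => gaussianReal 0 v)
        ∂(gaussianEnsemble v n m) := by
  have hmp := measurePreserving_piFinSuccAbove (fun _ : Fin (m + 1) =>
    Measure.pi fun _ : Fin n => Measure.pi fun _ : Fin n => gaussianReal 0 v) 0
  have hF' : Integrable (fun p => F p.1 p.2) ((Measure.pi fun _ : Fin n => Measure.pi fun _ : Fin n =>
      gaussianReal 0 v).prod (gaussianEnsemble v n m)) :=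
    (hmp.integrable_comp_emb (MeasurableEquiv.measurableEmbedding _)).1 hF
  have h := hmp.integral_comp' (fun p => F p.1 p.2)
  refine Eq.trans h ?_
  exact integral_prod_symm _ hF'

lemma integral_sum_selDet_sq_prodMatrix (v : NNReal) (n m : ℕ) (c : ℕ → ℝ) :
    ∫ ω, ∑ o, c (selCard o) * selDet (prodMatrix n m ω) o ^ 2 ∂(gaussianEnsemble v n m)
    = ∑ k ∈ Finset.range (n + 1),
      c k * ((n.descFactorial k : ℝ) * (v : ℝ) ^ k) ^ m * n.descFactorial k := by
  induction m generalizing c with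
  | zero =>
    have : ∀ ω, prodMatrix n 0 ω = 1 := fun ω => by simp [prodMatrix]
    simp only [this, pow_zero, mul_one]
    rw [integral_const, sum_selDet_one_sq]
    simp
  | succ m ih =>
    have hint : ∀ m, Integrable (fun ω => ∑ o, c (selCard o) * selDet (prodMatrix n m ω) o ^ 2)
        (gaussianEnsemble v n m) := by
      intro m
      refine (AllMemLp.sum _ fun o _ => (AllMemLp.const _).mul
        ((AllMemLp.det fun i j => ?_).pow 2)).integrable
      rcases h : o i with _ | l
      · simpa [optRow, h] using AllMemLp.const _
      · simpa [optRow, h] using AllMemLp.prodMatrix v n m l j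
    have h0 := hint (m + 1)
    simp only [prodMatrix_succ] at h0 ⊢
    rw [integral_gaussianEnsemble_succ v n m (fun X ω => ∑ o, c (selCard o) *
      selDet (Matrix.of X * prodMatrix n m ω) o ^ 2) h0]
    simp only [integral_sum_selDet_sq]
    rw [ih fun k => c k * ((n.descFactorial k : ℝ) * (v : ℝ) ^ k)]
    refine Finset.sum_congr rfl fun k _ => ?_
    ring

/-- The covariance of the characteristic polynomial of a product of Gaussian matrices. -/
theorem integral_eval_charpoly_mul (v : NNReal) (n m : ℕ) (x z : ℝ) :
    ∫ ω, (prodMatrix n (m + 1) ω).charpoly.eval x * (prodMatrix n (m + 1) ω).charpoly.eval z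
      ∂(gaussianEnsemble v n (m + 1))
    = ∑ k ∈ Finset.range (n + 1), ((n.descFactorial k : ℝ) * (v : ℝ) ^ k) ^ (m + 1) *
      (x * z) ^ (n - k) := by
  have h0 : Integrable (fun ω => (prodMatrix n (m + 1) ω).charpoly.eval x *
      (prodMatrix n (m + 1) ω).charpoly.eval z) (gaussianEnsemble v n (m + 1)) :=
    ((AllMemLp.eval_charpoly (AllMemLp.prodMatrix v n (m + 1)) (AllMemLp.const x)).mul
    (AllMemLp.eval_charpoly (AllMemLp.prodMatrix v n (m + 1)) (AllMemLp.const z))).integrable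
  simp only [prodMatrix_succ] at h0 ⊢
  rw [integral_gaussianEnsemble_succ v n m (fun X ω => (Matrix.of X * prodMatrix n m ω).charpoly.eval x
    * (Matrix.of X * prodMatrix n m ω).charpoly.eval z) h0]
  simp only [integral_charpoly_mul]
  rw [integral_sum_selDet_sq_prodMatrix v n m fun k => (x * z) ^ (n - k) * (v : ℝ) ^ k]
  refine Finset.sum_congr rfl fun k _ => ?_
  ring

end Covariance

lemma Multiset.sum_ofReal_eq_ofReal_sum (s : Multiset ℝ) :
    (s.map ENNReal.ofReal).sum = ENNReal.ofReal (s.map fun h => max h 0).sum := by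
  have h0 : ∀ s : Multiset ℝ, 0 ≤ (s.map fun h => max h 0).sum := fun s =>
    Multiset.sum_nonneg fun x hx => by
      obtain ⟨y, -, rfl⟩ := Multiset.mem_map.1 hx
      exact le_max_right _ _
  induction s using Multiset.induction_on with
  | empty => simp
  | cons a s ih =>
    rw [Multiset.map_cons, Multiset.sum_cons, Multiset.map_cons, Multiset.sum_cons, ih,
      ENNReal.ofReal_add (le_max_right _ _) (h0 s)]
    congr 1
    rcases le_total a 0 with h | h <;> simp [h]

lemma Multiset.sum_ofReal_eq_sum_ofReal_neg_add (s : Multiset ℝ) (hs : 0 ≤ s.sum) :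
    (s.map ENNReal.ofReal).sum
      = ENNReal.ofReal s.sum + (s.map fun h => ENNReal.ofReal (-h)).sum := by
  have e : (s.map fun h => ENNReal.ofReal (-h)) = ((s.map fun h => -h).map ENNReal.ofReal) := by
    rw [Multiset.map_map]; rfl
  rw [e, Multiset.sum_ofReal_eq_ofReal_sum, Multiset.sum_ofReal_eq_ofReal_sum,
    ← ENNReal.ofReal_add hs]
  · congr 1
    rw [Multiset.map_map]
    clear e hs
    induction s using Multiset.induction_on with
    | empty => simp
    | cons a s ih =>
      simp only [Multiset.map_cons, Multiset.sum_cons, Function.comp_apply, ih]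
      rcases le_total a 0 with h | h <;> simp [h] <;> ring
  · refine Multiset.sum_nonneg fun x hx => ?_
    obtain ⟨y, -, rfl⟩ := Multiset.mem_map.1 hx
    exact le_max_right _ _

/-- The signed contribution of a root in the sign formula for `|p z|`. -/
noncomputable def signStat (z : ℝ) (t : ℝ × ℝ × ℝ) : ℝ :=
  t.2.2 * ((SignType.sign t.2.1 : ℝ) * (SignType.sign (z - t.1) : ℝ))

lemma measurable_coe_signType_sign : Measurable fun x : ℝ => (SignType.sign x : ℝ) := by
  have : (fun x : ℝ => (SignType.sign x : ℝ)) = fun x =>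
      if 0 < x then (1:ℝ) else if x < 0 then -1 else 0 := by
    funext x
    rw [sign_apply]
    split_ifs <;> simp
  rw [this]
  exact Measurable.ite measurableSet_Ioi measurable_const
    (Measurable.ite measurableSet_Iio measurable_const measurable_const)

lemma measurable_signStat (z : ℝ) : Measurable (signStat z) := by
  unfold signStat
  exact (measurable_snd.comp measurable_snd).mul
    ((measurable_coe_signType_sign.comp (measurable_fst.comp measurable_snd)).mul
      (measurable_coe_signType_sign.comp (measurable_const.sub measurable_fst)))

lemma abs_mul_signStat (z l a b : ℝ) :
    |a| * signStat z (l, a, (z - l) * b) = |z - l| * (b * a) := by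
  simp only [signStat]
  have h1 := abs_mul_sign a
  have h2 := self_mul_sign (z - l)
  calc |a| * ((z - l) * b * ((SignType.sign a : ℝ) * (SignType.sign (z - l) : ℝ)))
      = (|a| * (SignType.sign a : ℝ)) * ((z - l) * (SignType.sign (z - l) : ℝ)) * b := by ring
    _ = _ := by rw [h1, h2]; ring

lemma ofReal_abs_mul_signStat (z l a b : ℝ) :
    ENNReal.ofReal |a| * ENNReal.ofReal (signStat z (l, a, (z - l) * b))
      = ENNReal.ofReal (|z - l| * (b * a)) := by
  rw [← ENNReal.ofReal_mul (abs_nonneg a), abs_mul_signStat]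

lemma ofReal_abs_mul_neg_signStat (z l a b : ℝ) :
    ENNReal.ofReal |a| * ENNReal.ofReal (-signStat z (l, a, (z - l) * b))
      = ENNReal.ofReal (-(|z - l| * (b * a))) := by
  rw [← ENNReal.ofReal_mul (abs_nonneg a), mul_neg, abs_mul_signStat]

lemma ofReal_abs_eval_add_rootStat {p : Polynomial ℝ} (hp : p.Monic) (hodd : Odd p.natDegree)
    (hs : ∀ x ∈ p.roots, p.derivative.eval x ≠ 0) (z : ℝ) :
    ENNReal.ofReal |p.eval z| + rootStat (fun t => ENNReal.ofReal (-signStat z t)) z p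
      = rootStat (fun t => ENNReal.ofReal (signStat z t)) z p := by
  have h := abs_eval_eq_mul_sum_sign hp hodd hs z
  rw [← Multiset.sum_map_mul_left] at h
  have h' := Multiset.sum_ofReal_eq_sum_ofReal_neg_add _ (h ▸ abs_nonneg (p.eval z))
  rw [← h, Multiset.map_map, Multiset.map_map] at h'
  exact h'.symm

section OddDegree

variable (v : NNReal) (k d : ℕ)

/-- The law of the family of scalar factors. -/
noncomputable abbrev scalarLaw (v : NNReal) (m : ℕ) : Measure (Fin m → ℝ) :=
  Measure.pi fun _ : Fin m => gaussianReal 0 v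

/-- The covariance kernel of the characteristic polynomial. -/
noncomputable def covKernel (v : NNReal) (m d : ℕ) (x z : ℝ) : ℝ :=
  ∑ j ∈ Finset.range (d + 1), ((d.descFactorial j : ℝ) * (v : ℝ) ^ j) ^ m * (x * z) ^ (d - j)

/-- The (unnormalised) density of real eigenvalues with respect to the law of a product of
Gaussian variables. -/
noncomputable def rootDensity (v : NNReal) (m d : ℕ) (x : ℝ) : ℝ :=
  ∫ ξ, |x - ∏ i, ξ i| * covKernel v m d x (∏ i, ξ i) ∂(scalarLaw v m)

variable {v}

lemma natDegree_charpoly_prodMatrix (n m : ℕ) (ω : Fin m → Fin n → Fin n → ℝ) :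
    (prodMatrix n m ω).charpoly.natDegree = n := by
  rw [Matrix.charpoly_natDegree_eq_dim, Fintype.card_fin]

lemma card_roots_charpoly_prodMatrix_le (n m : ℕ) (ω : Fin m → Fin n → Fin n → ℝ) :
    (prodMatrix n m ω).charpoly.roots.card ≤ n := by
  have := (prodMatrix n m ω).charpoly.card_roots'
  rwa [natDegree_charpoly_prodMatrix] at this

lemma ae_roots_simple_gaussianEnsemble (hv : v ≠ 0) (d k : ℕ) :
    ∀ᵐ ω ∂(gaussianEnsemble v (d + 1) (k + 1)),
      ∀ x ∈ (prodMatrix (d + 1) (k + 1) ω).charpoly.roots,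
        (prodMatrix (d + 1) (k + 1) ω).charpoly.derivative.eval x ≠ 0 :=
  (hasExpDensity_gaussianEnsemble hv _ _).absolutelyContinuous.ae_le ae_roots_simple

theorem exists_integral_abs_eval (hv : v ≠ 0) (hd : Even d) :
    ∃ C : ENNReal, C ≠ 0 ∧ C ≠ ⊤ ∧ ∀ x : ℝ, 0 ≤ rootDensity v (k + 1) d x ∧
      ∫⁻ ω, ENNReal.ofReal |(prodMatrix (d + 1) (k + 1) ω).charpoly.eval x|
        ∂(gaussianEnsemble v (d + 1) (k + 1)) = C * ENNReal.ofReal (rootDensity v (k + 1) d x) := by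
  obtain ⟨C, hC0, hC⟩ := exists_deflation hv k d
  have hodd : ∀ ω, Odd (prodMatrix (d + 1) (k + 1) ω).charpoly.natDegree := fun ω => by
    rw [natDegree_charpoly_prodMatrix]; exact hd.add_one
  have hCtop : C ≠ ⊤ := by
    have h1 := (hC (fun _ => 1) measurable_const 0).2
    have hle : ∫⁻ ω, rootStat (fun _ => 1) 0 (prodMatrix (d + 1) (k + 1) ω).charpoly
        ∂(gaussianEnsemble v (d + 1) (k + 1)) ≤ (d + 1 : ℕ) := by
      refine (lintegral_mono (g := fun _ => ((d + 1 : ℕ) : ENNReal)) fun ω => ?_).trans (by simp)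
      simp only [rootStat, Multiset.map_const', Multiset.sum_replicate, nsmul_eq_mul, mul_one]
      exact_mod_cast card_roots_charpoly_prodMatrix_le _ _ _
    have hge : 1 ≤ ∫⁻ ω, rootStat (fun _ => 1) 0 (prodMatrix (d + 1) (k + 1) ω).charpoly
        ∂(gaussianEnsemble v (d + 1) (k + 1)) := by
      refine le_trans (by simp) (lintegral_mono (f := fun _ => (1 : ENNReal)) fun ω => ?_)
      simp only [rootStat, Multiset.map_const', Multiset.sum_replicate, nsmul_eq_mul, mul_one]
      have : 1 ≤ (prodMatrix (d + 1) (k + 1) ω).charpoly.roots.card := by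
        rw [Nat.one_le_iff_ne_zero]
        intro h0
        have := even_natDegree_of_roots_eq_zero (Matrix.charpoly_monic _)
          (Multiset.card_eq_zero.1 h0)
        exact (Nat.not_even_iff_odd.2 (hodd ω)) this
      exact_mod_cast this
    rintro rfl
    rw [h1] at hle hge
    rw [ENNReal.top_mul] at hle
    · simp at hle
    · intro h0
      rw [h0] at hge
      simp at hge
  refine ⟨C, hC0, hCtop, fun x => ?_⟩
  have hP := (hC _ (measurable_signStat x).ennreal_ofReal x)
  have hN := (hC _ (measurable_signStat x).neg.ennreal_ofReal x)
  simp only [deflatedStat, Pi.neg_apply] at hP hN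
  simp only [ofReal_abs_mul_signStat] at hP
  simp only [ofReal_abs_mul_neg_signStat] at hN
  obtain ⟨hPm, hPe⟩ := hP
  obtain ⟨hNm, hNe⟩ := hN
  have hae : ∫⁻ ω, ENNReal.ofReal |(prodMatrix (d + 1) (k + 1) ω).charpoly.eval x| +
      rootStat (fun t => ENNReal.ofReal (-signStat x t)) x (prodMatrix (d + 1) (k + 1) ω).charpoly
        ∂(gaussianEnsemble v (d + 1) (k + 1))
      = ∫⁻ ω, rootStat (fun t => ENNReal.ofReal (signStat x t)) x
        (prodMatrix (d + 1) (k + 1) ω).charpoly ∂(gaussianEnsemble v (d + 1) (k + 1)) := by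
    refine lintegral_congr_ae ?_
    filter_upwards [ae_roots_simple_gaussianEnsemble hv d k] with ω hω
    exact ofReal_abs_eval_add_rootStat (Matrix.charpoly_monic _) (hodd ω) hω x
  rw [lintegral_add_right' _ hNm, hPe, hNe] at hae
  -- the two parts of a single real integral
  set q : (Fin (k + 1) → ℝ) × (Fin (k + 1) → Fin d → Fin d → ℝ) → ℝ := fun p =>
    |x - ∏ i, p.1 i| * ((prodMatrix d (k + 1) p.2).charpoly.eval x *
      (prodMatrix d (k + 1) p.2).charpoly.eval (∏ i, p.1 i)) with hq
  have hl : AllMemLp (fun p : (Fin (k + 1) → ℝ) × (Fin (k + 1) → Fin d → Fin d → ℝ) => ∏ i, p.1 i)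
      ((scalarLaw v (k + 1)).prod (gaussianEnsemble v d (k + 1))) :=
    (AllMemLp.prod_scalars v (k + 1)).comp measurePreserving_fst
  have hA : ∀ i j, AllMemLp (fun p : (Fin (k + 1) → ℝ) × (Fin (k + 1) → Fin d → Fin d → ℝ) =>
      prodMatrix d (k + 1) p.2 i j)
      ((scalarLaw v (k + 1)).prod (gaussianEnsemble v d (k + 1))) := fun i j =>
    (AllMemLp.prodMatrix v d (k + 1) i j).comp measurePreserving_snd
  have hqi : Integrable q ((scalarLaw v (k + 1)).prod (gaussianEnsemble v d (k + 1))) :=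
    (((AllMemLp.const x).sub hl).abs.mul ((AllMemLp.eval_charpoly hA (AllMemLp.const x)).mul
      (AllMemLp.eval_charpoly hA hl))).integrable
  have e1 : ∫ p, q p ∂((scalarLaw v (k + 1)).prod (gaussianEnsemble v d (k + 1)))
      = rootDensity v (k + 1) d x := by
    rw [integral_prod _ hqi]
    simp only [hq, integral_const_mul, integral_eval_charpoly_mul]
    rfl
  have e2 := integral_eq_lintegral_pos_part_sub_lintegral_neg_part hqi
  have hJ1 : ∫⁻ p, ENNReal.ofReal (q p) ∂((scalarLaw v (k + 1)).prod (gaussianEnsemble v d (k + 1)))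
      = ∫⁻ ξ, ∫⁻ A, ENNReal.ofReal (q (ξ, A)) ∂(gaussianEnsemble v d (k + 1))
        ∂(scalarLaw v (k + 1)) :=
    lintegral_prod _ hqi.1.aemeasurable.ennreal_ofReal
  have hJ2 : ∫⁻ p, ENNReal.ofReal (-q p) ∂((scalarLaw v (k + 1)).prod (gaussianEnsemble v d (k + 1)))
      = ∫⁻ ξ, ∫⁻ A, ENNReal.ofReal (-q (ξ, A)) ∂(gaussianEnsemble v d (k + 1))
        ∂(scalarLaw v (k + 1)) :=
    lintegral_prod _ hqi.1.aemeasurable.neg.ennreal_ofReal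
  simp only [hq] at hJ1 hJ2
  rw [← hJ1, ← hJ2] at hae
  rw [e1] at e2
  have f1 : ∫⁻ p, ENNReal.ofReal (q p) ∂((scalarLaw v (k + 1)).prod (gaussianEnsemble v d (k + 1)))
    ≠ ⊤ := (hqi.lintegral_lt_top).ne
  have f2 : ∫⁻ p, ENNReal.ofReal (-q p) ∂((scalarLaw v (k + 1)).prod (gaussianEnsemble v d (k + 1)))
    ≠ ⊤ := (hqi.neg.lintegral_lt_top).ne
  simp only [hq] at e2 f1 f2
  generalize (∫⁻ p, ENNReal.ofReal (|x - ∏ i, p.1 i| * ((prodMatrix d (k + 1) p.2).charpoly.eval x *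
      (prodMatrix d (k + 1) p.2).charpoly.eval (∏ i, p.1 i)))
      ∂((scalarLaw v (k + 1)).prod (gaussianEnsemble v d (k + 1)))) = J1 at hae e2 f1
  generalize (∫⁻ p, ENNReal.ofReal (-(|x - ∏ i, p.1 i| * ((prodMatrix d (k + 1) p.2).charpoly.eval x *
      (prodMatrix d (k + 1) p.2).charpoly.eval (∏ i, p.1 i))))
      ∂((scalarLaw v (k + 1)).prod (gaussianEnsemble v d (k + 1)))) = J2 at hae e2 f2
  have hle : J2 ≤ J1 := by
    have : C * J2 ≤ C * J1 := hae ▸ le_add_self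
    rwa [ENNReal.mul_le_mul_iff_right hC0 hCtop] at this
  have hJ : ENNReal.ofReal (rootDensity v (k + 1) d x) = J1 - J2 := by
    rw [e2, ENNReal.ofReal_sub _ ENNReal.toReal_nonneg, ENNReal.ofReal_toReal f1,
      ENNReal.ofReal_toReal f2]
  constructor
  · rw [e2, sub_nonneg]
    exact ENNReal.toReal_mono f1 hle
  · rw [hJ, ENNReal.mul_sub fun _ _ => hCtop, ← hae, ENNReal.add_sub_cancel_right
      (ENNReal.mul_ne_top hCtop f2)]

end OddDegree

section LinearStatistics

variable {v : NNReal} {k d : ℕ}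

theorem exists_lintegral_sum_roots (hv : v ≠ 0) (hd : Even d) :
    ∃ C : ENNReal, C ≠ 0 ∧ ∀ g : ℝ → ENNReal, Measurable g →
      AEMeasurable (fun ω => ((prodMatrix (d + 2) (k + 1) ω).charpoly.roots.map g).sum)
        (gaussianEnsemble v (d + 2) (k + 1)) ∧
      ∫⁻ ω, ((prodMatrix (d + 2) (k + 1) ω).charpoly.roots.map g).sum
        ∂(gaussianEnsemble v (d + 2) (k + 1))
      = C * ∫⁻ ξ, ENNReal.ofReal (rootDensity v (k + 1) d (∏ i, ξ i)) * g (∏ i, ξ i)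
        ∂(scalarLaw v (k + 1)) := by
  obtain ⟨C, hC0, hC⟩ := exists_deflation hv k (d + 1)
  obtain ⟨C', hC0', hCt', hC'⟩ := exists_integral_abs_eval k d hv hd
  refine ⟨C * C', mul_ne_zero hC0 hC0', fun g hg => ?_⟩
  obtain ⟨h1, h2⟩ := hC (fun t => g t.1) (hg.comp measurable_fst) 0
  refine ⟨h1, h2.trans ?_⟩
  rw [mul_assoc, ← lintegral_const_mul' _ _ hCt']
  congr 1
  refine lintegral_congr fun ξ => ?_
  simp only [deflatedStat]
  rw [lintegral_mul_const, (hC' _).2, mul_assoc]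
  exact (continuous_eval_charpoly (continuous_prodMatrix _ _)
    continuous_const).abs.measurable.ennreal_ofReal

lemma integrable_rootDensity_kernel (v : NNReal) (m d : ℕ) :
    Integrable (fun p : (Fin m → ℝ) × (Fin m → ℝ) => |(∏ i, p.1 i) - ∏ i, p.2 i| *
      covKernel v m d (∏ i, p.1 i) (∏ i, p.2 i)) ((scalarLaw v m).prod (scalarLaw v m)) := by
  have h1 : AllMemLp (fun p : (Fin m → ℝ) × (Fin m → ℝ) => ∏ i, p.1 i)
      ((scalarLaw v m).prod (scalarLaw v m)) :=
    (AllMemLp.prod_scalars v m).comp measurePreserving_fst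
  have h2 : AllMemLp (fun p : (Fin m → ℝ) × (Fin m → ℝ) => ∏ i, p.2 i)
      ((scalarLaw v m).prod (scalarLaw v m)) :=
    (AllMemLp.prod_scalars v m).comp measurePreserving_snd
  exact ((h1.sub h2).abs.mul (AllMemLp.sum _ fun j _ =>
    (AllMemLp.const _).mul ((h1.mul h2).pow _))).integrable

lemma integrable_rootDensity (v : NNReal) (m d : ℕ) :
    Integrable (fun ξ : Fin m → ℝ => rootDensity v m d (∏ i, ξ i)) (scalarLaw v m) :=
  (integrable_rootDensity_kernel v m d).integral_prod_left

lemma linearStat_eq_toReal {n : ℕ} (P : Matrix (Fin n) (Fin n) ℝ) {g : ℝ → ℝ} (hg : ∀ x, 0 ≤ g x) :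
    linearStat n g P = ((P.charpoly.roots.map fun x => ENNReal.ofReal (g x)).sum).toReal := by
  unfold linearStat
  induction P.charpoly.roots using Multiset.induction_on with
  | empty => simp
  | cons a s ih =>
    have : (Multiset.map (fun x => ENNReal.ofReal (g x)) s).sum ≠ ⊤ := by
      clear ih
      induction s using Multiset.induction_on with
      | empty => simp
      | cons a s ih => simpa using ih
    rw [Multiset.map_cons, Multiset.sum_cons, Multiset.map_cons, Multiset.sum_cons,
      ENNReal.toReal_add ENNReal.ofReal_ne_top this, ih, ENNReal.toReal_ofReal (hg a)]

lemma abs_linearStat_le {n : ℕ} (P : Matrix (Fin n) (Fin n) ℝ) {g : ℝ → ℝ} {M : ℝ}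
    (hg : ∀ x, |g x| ≤ M) : |linearStat n g P| ≤ n * M := by
  have h1 : P.charpoly.roots.card ≤ n := by
    have := P.charpoly.card_roots'
    rwa [Matrix.charpoly_natDegree_eq_dim, Fintype.card_fin] at this
  have hM : 0 ≤ M := (abs_nonneg _).trans (hg 0)
  have h2 : |linearStat n g P| ≤ P.charpoly.roots.card * M := by
    unfold linearStat
    generalize P.charpoly.roots = s
    induction s using Multiset.induction_on with
    | empty => simp
    | cons a s ih =>
      rw [Multiset.map_cons, Multiset.sum_cons, Multiset.card_cons]
      push_cast
      have := abs_add_le (g a) (s.map g).sum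
      have := hg a
      linarith
  exact h2.trans (by gcongr)

/-- Linear statistics of real eigenvalues, normalised, in terms of the root density. -/
theorem integral_linearStat_div (hv : v ≠ 0) (hd : Even d)
    (hpos : 0 < ∫ ξ, rootDensity v (k + 1) d (∏ i, ξ i) ∂(scalarLaw v (k + 1)))
    {f : ℝ → ℝ} (hf : Measurable f) {M : ℝ} (hM : ∀ x, |f x| ≤ M) :
    (∫ ω, linearStat (d + 2) f (prodMatrix (d + 2) (k + 1) ω) ∂(gaussianEnsemble v (d + 2) (k + 1))) /
      ∫ ω, (numRealEigs (d + 2) (prodMatrix (d + 2) (k + 1) ω) : ℝ)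
        ∂(gaussianEnsemble v (d + 2) (k + 1))
    = (∫ ξ, f (∏ i, ξ i) * rootDensity v (k + 1) d (∏ i, ξ i) ∂(scalarLaw v (k + 1))) /
      ∫ ξ, rootDensity v (k + 1) d (∏ i, ξ i) ∂(scalarLaw v (k + 1)) := by
  obtain ⟨C, hC0, hC⟩ := exists_lintegral_sum_roots (k := k) hv hd
  obtain ⟨_, _, _, hD⟩ := exists_integral_abs_eval k d hv hd
  have hD0 : ∀ x, 0 ≤ rootDensity v (k + 1) d x := fun x => (hD x).1
  have hDi := integrable_rootDensity v (k + 1) d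
  have key : ∀ g : ℝ → ℝ, Measurable g → ∀ B : ℝ, (∀ x, 0 ≤ g x) → (∀ x, |g x| ≤ B) →
      Integrable (fun ω => linearStat (d + 2) g (prodMatrix (d + 2) (k + 1) ω))
        (gaussianEnsemble v (d + 2) (k + 1)) ∧
      ∫ ω, linearStat (d + 2) g (prodMatrix (d + 2) (k + 1) ω) ∂(gaussianEnsemble v (d + 2) (k + 1))
        = C.toReal * ∫ ξ, g (∏ i, ξ i) * rootDensity v (k + 1) d (∏ i, ξ i)
          ∂(scalarLaw v (k + 1)) := by
    intro g hg B h0 hB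
    obtain ⟨h1, h2⟩ := hC (fun x => ENNReal.ofReal (g x)) hg.ennreal_ofReal
    have hae : AEStronglyMeasurable (fun ω => linearStat (d + 2) g (prodMatrix (d + 2) (k + 1) ω))
        (gaussianEnsemble v (d + 2) (k + 1)) := by
      simp only [linearStat_eq_toReal _ h0]
      exact h1.ennreal_toReal.aestronglyMeasurable
    refine ⟨Integrable.of_bound hae _ (ae_of_all _ fun ω => abs_linearStat_le _ hB), ?_⟩
    have hgp : AEStronglyMeasurable (fun ξ : Fin (k + 1) → ℝ => g (∏ i, ξ i))
        (scalarLaw v (k + 1)) := (hg.comp (by fun_prop)).aestronglyMeasurable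
    rw [integral_eq_lintegral_of_nonneg_ae
      (ae_of_all _ fun ξ => mul_nonneg (h0 _) (hD0 _)) (hgp.mul hDi.1),
      ← ENNReal.toReal_mul]
    have e : ∀ ξ : Fin (k + 1) → ℝ, ENNReal.ofReal (g (∏ i, ξ i) * rootDensity v (k + 1) d (∏ i, ξ i))
        = ENNReal.ofReal (rootDensity v (k + 1) d (∏ i, ξ i)) * ENNReal.ofReal (g (∏ i, ξ i)) := by
      intro ξ
      rw [ENNReal.ofReal_mul (h0 _), mul_comm]
    simp only [e]
    rw [← h2]
    simp only [linearStat_eq_toReal _ h0]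
    refine integral_toReal h1 (ae_of_all _ fun ω => ?_)
    rw [lt_top_iff_ne_top]
    induction (prodMatrix (d + 2) (k + 1) ω).charpoly.roots using Multiset.induction_on with
    | empty => simp
    | cons a s ih => simpa using ih
  have hM0 : 0 ≤ M := (abs_nonneg _).trans (hM 0)
  have hCt : C.toReal ≠ 0 := by
    refine (ENNReal.toReal_pos hC0 ?_).ne'
    rintro rfl
    have h2 := (hC (fun _ => 1) measurable_const).2
    simp only [mul_one] at h2
    rw [← ofReal_integral_eq_lintegral_ofReal hDi (ae_of_all _ fun ξ => hD0 _), ENNReal.top_mul]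
      at h2
    · have h3 : ∫⁻ ω, ((prodMatrix (d + 2) (k + 1) ω).charpoly.roots.map fun _ => 1).sum
          ∂(gaussianEnsemble v (d + 2) (k + 1)) ≤ (d + 2 : ℕ) := by
        refine (lintegral_mono (g := fun _ => ((d + 2 : ℕ) : ENNReal)) fun ω => ?_).trans (by simp)
        simp only [Multiset.map_const', Multiset.sum_replicate, nsmul_eq_mul, mul_one]
        exact_mod_cast card_roots_charpoly_prodMatrix_le _ _ _
      rw [h2] at h3
      simp at h3
    · exact (ENNReal.ofReal_pos.2 hpos).ne'
  obtain ⟨i1, k1⟩ := key (fun x => f x + M) (hf.add_const M) (2 * M)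
    (fun x => by linarith [neg_le_of_abs_le (hM x)])
    (fun x => by
      rw [abs_le]
      constructor <;> linarith [neg_le_of_abs_le (hM x), le_of_abs_le (hM x)])
  obtain ⟨i2, k2⟩ := key (fun x => 1) measurable_const 1 (fun _ => zero_le_one) (fun _ => by simp)
  have e2 : ∀ P : Matrix (Fin (d + 2)) (Fin (d + 2)) ℝ,
      (numRealEigs (d + 2) P : ℝ) = linearStat (d + 2) (fun _ => 1) P := fun P => by
    simp [numRealEigs, linearStat]
  have e1 : ∀ P : Matrix (Fin (d + 2)) (Fin (d + 2)) ℝ,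
      linearStat (d + 2) f P = linearStat (d + 2) (fun x => f x + M) P
        - M * linearStat (d + 2) (fun _ => 1) P := fun P => by
    simp [linearStat, Multiset.sum_map_add]
    ring
  have hfD : Integrable (fun ξ : Fin (k + 1) → ℝ => f (∏ i, ξ i) * rootDensity v (k + 1) d (∏ i, ξ i))
      (scalarLaw v (k + 1)) :=
    hDi.bdd_mul (c := M) (hf.comp (by fun_prop)).aestronglyMeasurable (ae_of_all _ fun ξ => hM _)
  simp only [e1, e2]
  rw [integral_sub i1 (i2.const_mul M), integral_const_mul, k1, k2]
  simp only [add_mul, one_mul]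
  rw [integral_add hfD (hDi.const_mul M), integral_const_mul]
  rw [mul_add, mul_left_comm M, add_sub_cancel_right, mul_div_mul_left _ _ hCt]

end LinearStatistics

/-- Absolute moments of a centred Gaussian variable. -/
noncomputable def absMoment (v : NNReal) (j : ℕ) : ℝ := ∫ x, |x| ^ j ∂(gaussianReal 0 v)

section AbsMoment

variable {v : NNReal}

lemma absMoment_eq (hv : v ≠ 0) (j : ℕ) :
    absMoment v j = (Real.sqrt (2 * Real.pi * v))⁻¹ *
      ((1 / (2 * v : ℝ)) ^ (-((j : ℝ) + 1) / 2) * Real.Gamma (((j : ℝ) + 1) / 2)) := by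
  have hv' : (0 : ℝ) < v := by positivity
  unfold absMoment
  rw [integral_gaussianReal_eq_integral_smul hv]
  have e : ∀ x : ℝ, gaussianPDFReal 0 v x • |x| ^ j
      = (Real.sqrt (2 * Real.pi * v))⁻¹ * (|x| ^ j * Real.exp (-(1 / (2 * v : ℝ)) * |x| ^ 2)) := by
    intro x
    rw [gaussianPDFReal, smul_eq_mul, sq_abs]
    have : -(x - 0) ^ 2 / (2 * (v : ℝ)) = -(1 / (2 * v : ℝ)) * x ^ 2 := by
      field_simp
      ring
    rw [this]
    ring
  simp only [e]
  rw [integral_const_mul, integral_comp_abs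
    (f := fun x => x ^ j * Real.exp (-(1 / (2 * v : ℝ)) * x ^ 2))]
  have h := integral_rpow_mul_exp_neg_mul_rpow (p := 2) (q := j) (b := 1 / (2 * v : ℝ)) (by norm_num)
    (by linarith [Nat.cast_nonneg (α := ℝ) j]) (by positivity)
  have e2 : ∫ x in Set.Ioi (0 : ℝ), x ^ j * Real.exp (-(1 / (2 * v : ℝ)) * x ^ 2)
      = ∫ x in Set.Ioi (0 : ℝ), x ^ (j : ℝ) * Real.exp (-(1 / (2 * v : ℝ)) * x ^ (2 : ℝ)) := by
    refine setIntegral_congr_fun measurableSet_Ioi fun x _ => ?_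
    simp only [Real.rpow_natCast, Real.rpow_ofNat]
  rw [e2, h]
  ring

lemma absMoment_pos (hv : v ≠ 0) (j : ℕ) : 0 < absMoment v j := by
  have hv' : (0 : ℝ) < v := by positivity
  rw [absMoment_eq hv]
  have := Real.Gamma_pos_of_pos (s := ((j : ℝ) + 1) / 2) (by positivity)
  have := Real.pi_pos
  positivity

lemma absMoment_add_two (hv : v ≠ 0) (j : ℕ) :
    absMoment v (j + 2) = v * (j + 1) * absMoment v j := by
  have hv' : (0 : ℝ) < v := by positivity
  rw [absMoment_eq hv, absMoment_eq hv]
  have h1 : ((j + 2 : ℕ) : ℝ) + 1 = ((j : ℝ) + 1) + 2 := by push_cast; ring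
  have h2 : (((j + 2 : ℕ) : ℝ) + 1) / 2 = ((j : ℝ) + 1) / 2 + 1 := by rw [h1]; ring
  have h3 : -(((j + 2 : ℕ) : ℝ) + 1) / 2 = -((j : ℝ) + 1) / 2 + (-1) := by rw [h1]; ring
  rw [h2, h3, Real.Gamma_add_one (by positivity), Real.rpow_add (by positivity), Real.rpow_neg_one]
  field_simp

lemma absMoment_mul_succ (hv : v ≠ 0) (j : ℕ) :
    absMoment v j * absMoment v (j + 1)
      = (j.factorial * (v : ℝ) ^ j) * (absMoment v 0 * absMoment v 1) := by
  induction j with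
  | zero => simp
  | succ j ih =>
    rw [absMoment_add_two hv j, Nat.factorial_succ]
    push_cast
    linear_combination (v : ℝ) * (j + 1) * ih

end AbsMoment

/-- The Gaussian law reweighted by `|x| ^ j`. -/
noncomputable def absTilt (v : NNReal) (j : ℕ) : Measure ℝ :=
  (gaussianReal 0 v).withDensity fun x => ENNReal.ofReal (|x| ^ j / absMoment v j)

/-- The law of independent Gaussian factors reweighted by `|∏ ξ| ^ j`. -/
noncomputable def tiltLaw (v : NNReal) (m j : ℕ) : Measure (Fin m → ℝ) :=
  Measure.pi fun _ => absTilt v j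

section Tilt

variable {v : NNReal}

lemma integrable_abs_pow_gaussianReal (v : NNReal) (j : ℕ) :
    Integrable (fun x : ℝ => |x| ^ j) (gaussianReal 0 v) :=
  ((AllMemLp.gaussianReal v).abs.pow j).integrable

lemma measurable_absTilt_density (v : NNReal) (j : ℕ) :
    Measurable fun x : ℝ => ENNReal.ofReal (|x| ^ j / absMoment v j) := by fun_prop

lemma lintegral_absTilt_density (hv : v ≠ 0) (j : ℕ) :
    ∫⁻ x, ENNReal.ofReal (|x| ^ j / absMoment v j) ∂(gaussianReal 0 v) = 1 := by
  rw [← ofReal_integral_eq_lintegral_ofReal ((integrable_abs_pow_gaussianReal v j).div_const _)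
    (ae_of_all _ fun x => by have := absMoment_pos hv j; positivity), integral_div]
  change ENNReal.ofReal (absMoment v j / absMoment v j) = 1
  rw [div_self (absMoment_pos hv j).ne', ENNReal.ofReal_one]

instance [NeZero v] (j : ℕ) : IsProbabilityMeasure (absTilt v j) :=
  ⟨by rw [absTilt, withDensity_apply _ MeasurableSet.univ, setLIntegral_univ,
    lintegral_absTilt_density (NeZero.ne v)]⟩

instance [NeZero v] (m j : ℕ) : IsProbabilityMeasure (tiltLaw v m j) := by
  unfold tiltLaw; infer_instance

lemma integral_absTilt (v : NNReal) (j : ℕ) {E : Type*} [NormedAddCommGroup E] [NormedSpace ℝ E]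
    (F : ℝ → E) : ∫ x, F x ∂(absTilt v j)
      = ∫ x, (|x| ^ j / absMoment v j) • F x ∂(gaussianReal 0 v) := by
  rw [absTilt, integral_withDensity_eq_integral_toReal_smul (measurable_absTilt_density v j)
    (ae_of_all _ fun x => ENNReal.ofReal_lt_top)]
  congr 1
  funext x
  rw [ENNReal.toReal_ofReal]
  have : 0 ≤ absMoment v j := integral_nonneg fun x => by positivity
  positivity

lemma tiltLaw_eq_withDensity [NeZero v] (m j : ℕ) :
    tiltLaw v m j = (scalarLaw v m).withDensity fun ξ =>
      ENNReal.ofReal (|∏ i, ξ i| ^ j / absMoment v j ^ m) := by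
  have hpos := absMoment_pos (NeZero.ne v) j
  unfold tiltLaw
  refine Measure.pi_eq (μ := fun _ : Fin m => absTilt v j) fun s hs => ?_
  have e : ∀ ξ : Fin m → ℝ, ENNReal.ofReal (|∏ i, ξ i| ^ j / absMoment v j ^ m)
      = ∏ i, ENNReal.ofReal (|ξ i| ^ j / absMoment v j) := by
    intro ξ
    rw [← ENNReal.ofReal_prod_of_nonneg fun i _ => by positivity, Finset.abs_prod,
      ← Finset.prod_pow, Finset.prod_div_distrib]
    simp
  rw [withDensity_apply _ (MeasurableSet.univ_pi hs), ← lintegral_indicator (MeasurableSet.univ_pi hs)]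
  have e2 : ∀ ξ : Fin m → ℝ, (Set.univ.pi s).indicator
      (fun ξ => ENNReal.ofReal (|∏ i, ξ i| ^ j / absMoment v j ^ m)) ξ
      = ∏ i, (s i).indicator (fun x => ENNReal.ofReal (|x| ^ j / absMoment v j)) (ξ i) := by
    intro ξ
    by_cases h : ξ ∈ Set.univ.pi s
    · rw [Set.indicator_of_mem h, e]
      exact Finset.prod_congr rfl fun i _ => by rw [Set.indicator_of_mem (h i trivial)]
    · rw [Set.indicator_of_notMem h]
      simp only [Set.mem_pi, Set.mem_univ, true_imp_iff, not_forall] at h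
      obtain ⟨i, hi⟩ := h
      exact (Finset.prod_eq_zero (Finset.mem_univ i) (Set.indicator_of_notMem hi _)).symm
  rw [lintegral_congr e2, lintegral_pi_prod (gaussianReal 0 v)
    (fun i x => (s i).indicator (fun x => ENNReal.ofReal (|x| ^ j / absMoment v j)) x)
    fun i => (measurable_absTilt_density v j).indicator (hs i)]
  refine Finset.prod_congr rfl fun i _ => ?_
  rw [lintegral_indicator (hs i), absTilt, withDensity_apply _ (hs i)]

lemma integral_tiltLaw_prod [NeZero v] (m a b : ℕ) (F : (Fin m → ℝ) × (Fin m → ℝ) → ℝ) :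
    ∫ p, F p ∂((tiltLaw v m a).prod (tiltLaw v m b))
      = (∫ p, |∏ i, p.1 i| ^ a * |∏ i, p.2 i| ^ b * F p ∂((scalarLaw v m).prod (scalarLaw v m)))
        / (absMoment v a * absMoment v b) ^ m := by
  have ha := absMoment_pos (NeZero.ne v) a
  have hb := absMoment_pos (NeZero.ne v) b
  have hm : ∀ j, Measurable fun ξ : Fin m → ℝ =>
      ENNReal.ofReal (|∏ i, ξ i| ^ j / absMoment v j ^ m) := fun j => by fun_prop
  rw [tiltLaw_eq_withDensity, tiltLaw_eq_withDensity, prod_withDensity (hm a) (hm b),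
    integral_withDensity_eq_integral_toReal_smul
      (f := fun p : (Fin m → ℝ) × (Fin m → ℝ) => ENNReal.ofReal (|∏ i, p.1 i| ^ a / absMoment v a ^ m)
        * ENNReal.ofReal (|∏ i, p.2 i| ^ b / absMoment v b ^ m))
      (((hm a).comp measurable_fst).mul ((hm b).comp measurable_snd))
      (ae_of_all _ fun p => ENNReal.mul_lt_top ENNReal.ofReal_lt_top ENNReal.ofReal_lt_top),
    ← integral_div]
  congr 1
  funext p
  simp only [smul_eq_mul, ENNReal.toReal_mul]
  rw [ENNReal.toReal_ofReal (by positivity), ENNReal.toReal_ofReal (by positivity), mul_pow]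
  field_simp

end Tilt

/-- The part of the tilted expectation of `h |x|` on which `|y| < |x|`. -/
noncomputable def upperPart (v : NNReal) (m : ℕ) (h : ℝ → ℝ) (a b : ℕ) : ℝ :=
  ∫ p, (if |∏ i, p.2 i| < |∏ i, p.1 i| then h |∏ i, p.1 i| else 0)
    ∂((tiltLaw v m a).prod (tiltLaw v m b))

/-- The part of the tilted expectation of `h |x|` on which `|x| ≤ |y|`. -/
noncomputable def lowerPart (v : NNReal) (m : ℕ) (h : ℝ → ℝ) (a b : ℕ) : ℝ :=
  ∫ p, (if |∏ i, p.2 i| < |∏ i, p.1 i| then 0 else h |∏ i, p.1 i|)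
    ∂((tiltLaw v m a).prod (tiltLaw v m b))

/-- The contribution of the `j`-th monomial of the covariance kernel. -/
noncomputable def densityTerm (v : NNReal) (m : ℕ) (h : ℝ → ℝ) (j : ℕ) : ℝ :=
  if Even j then upperPart v m h (j + 1) j + lowerPart v m h j (j + 1)
  else -(lowerPart v m h (j + 1) j + upperPart v m h j (j + 1))

lemma abs_sub_add_abs_add (x y : ℝ) : |x - y| + |x + y| = 2 * if |y| < |x| then |x| else |y| := by
  split_ifs with h <;>
  rcases abs_cases (x - y) with ⟨h1, h1'⟩ | ⟨h1, h1'⟩ <;>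
  rcases abs_cases (x + y) with ⟨h2, h2'⟩ | ⟨h2, h2'⟩ <;>
  rcases abs_cases x with ⟨h3, h3'⟩ | ⟨h3, h3'⟩ <;>
  rcases abs_cases y with ⟨h4, h4'⟩ | ⟨h4, h4'⟩ <;> rw [h1, h2] <;> linarith

lemma mul_abs_sub_sub_abs_add (x y : ℝ) : (x * y) * (|x - y| - |x + y|)
    = -2 * (|x| * |y|) * if |y| < |x| then |y| else |x| := by
  have h : (|x - y| - |x + y|) * (|x - y| + |x + y|) = -4 * (x * y) := by
    have h1 := sq_abs (x - y)
    have h2 := sq_abs (x + y)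
    linear_combination h1 - h2
  rw [abs_sub_add_abs_add] at h
  have h' := abs_sub_add_abs_add x y
  by_cases h0 : x * y = 0
  · rw [h0, ← abs_mul, h0]; simp
  have hx : 0 < |x| := abs_pos.2 (left_ne_zero_of_mul h0)
  have hy : 0 < |y| := abs_pos.2 (right_ne_zero_of_mul h0)
  have hxy : (x * y) ^ 2 = |x| ^ 2 * |y| ^ 2 := by rw [sq_abs, sq_abs]; ring
  split_ifs at h ⊢
  · refine mul_right_cancel₀ hx.ne' ?_
    linear_combination (x * y) / 2 * h - 2 * hxy
  · refine mul_right_cancel₀ hy.ne' ?_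
    linear_combination (x * y) / 2 * h - 2 * hxy

lemma symmetrized_even {j : ℕ} (hj : Even j) (x y : ℝ) :
    |x - y| * (x * y) ^ j + |x + y| * (-(x * y)) ^ j
      = 2 * (if |y| < |x| then |x| ^ (j + 1) * |y| ^ j else |x| ^ j * |y| ^ (j + 1)) := by
  have e : (x * y) ^ j = |x| ^ j * |y| ^ j := by rw [← mul_pow, ← abs_mul, hj.pow_abs]
  rw [hj.neg_pow, e, ← add_mul, abs_sub_add_abs_add]
  split_ifs <;> ring

lemma symmetrized_odd {j : ℕ} (hj : Odd j) (x y : ℝ) :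
    |x - y| * (x * y) ^ j + |x + y| * (-(x * y)) ^ j
      = 2 * -(if |y| < |x| then |x| ^ j * |y| ^ (j + 1) else |x| ^ (j + 1) * |y| ^ j) := by
  obtain ⟨i, rfl⟩ := hj
  have e : (x * y) ^ (2 * i) = |x| ^ (2 * i) * |y| ^ (2 * i) := by
    rw [← mul_pow, ← abs_mul, (even_two_mul i).pow_abs]
  rw [Odd.neg_pow ⟨i, rfl⟩, pow_succ (x * y), e]
  have h := mul_abs_sub_sub_abs_add x y
  split_ifs at h ⊢ <;> linear_combination |x| ^ (2 * i) * |y| ^ (2 * i) * h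

section Symmetrization

variable {v : NNReal} {m : ℕ}

lemma exists_measurePreserving_neg_prod (v : NNReal) (hm : 0 < m) :
    ∃ S : (Fin m → ℝ) → Fin m → ℝ, MeasurePreserving S (scalarLaw v m) (scalarLaw v m) ∧
      ∀ ξ, ∏ i, S ξ i = -∏ i, ξ i := by
  refine ⟨fun ξ i => (if i = ⟨0, hm⟩ then (-1 : ℝ) else 1) * ξ i, ?_, fun ξ => ?_⟩
  · refine measurePreserving_pi (fun _ : Fin m => gaussianReal 0 v) (fun _ => gaussianReal 0 v)
      (f := fun (i : Fin m) (x : ℝ) => (if i = ⟨0, hm⟩ then (-1 : ℝ) else 1) * x) fun i => ?_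
    split_ifs
    · refine ⟨by fun_prop, ?_⟩
      have := gaussianReal_map_const_mul (μ := 0) (v := v) (-1)
      simpa using this
    · simp only [one_mul]
      exact MeasurePreserving.id _
  · rw [Finset.prod_mul_distrib, Finset.prod_ite_eq' Finset.univ (⟨0, hm⟩ : Fin m)]
    simp

lemma integral_symmetrize (hm : 0 < m) {G : ℝ → ℝ → ℝ}
    (hi : Integrable (fun p : (Fin m → ℝ) × (Fin m → ℝ) => G (∏ i, p.1 i) (∏ i, p.2 i))
      ((scalarLaw v m).prod (scalarLaw v m))) :
    ∫ p : (Fin m → ℝ) × (Fin m → ℝ), G (∏ i, p.1 i) (∏ i, p.2 i)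
      ∂((scalarLaw v m).prod (scalarLaw v m))
    = ∫ p : (Fin m → ℝ) × (Fin m → ℝ), (G (∏ i, p.1 i) (∏ i, p.2 i) + G (∏ i, p.1 i) (-∏ i, p.2 i)
        + G (-∏ i, p.1 i) (∏ i, p.2 i) + G (-∏ i, p.1 i) (-∏ i, p.2 i)) / 4
      ∂((scalarLaw v m).prod (scalarLaw v m)) := by
  obtain ⟨S, hS, hS'⟩ := exists_measurePreserving_neg_prod v hm
  have key : ∀ (T : (Fin m → ℝ) × (Fin m → ℝ) → (Fin m → ℝ) × (Fin m → ℝ)),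
      MeasurePreserving T ((scalarLaw v m).prod (scalarLaw v m))
        ((scalarLaw v m).prod (scalarLaw v m)) →
      Integrable (fun p => G (∏ i, (T p).1 i) (∏ i, (T p).2 i))
        ((scalarLaw v m).prod (scalarLaw v m)) ∧
      ∫ p, G (∏ i, (T p).1 i) (∏ i, (T p).2 i) ∂((scalarLaw v m).prod (scalarLaw v m))
        = ∫ p : (Fin m → ℝ) × (Fin m → ℝ), G (∏ i, p.1 i) (∏ i, p.2 i)
          ∂((scalarLaw v m).prod (scalarLaw v m)) := by
    intro T hT
    refine ⟨(hT.integrable_comp hi.1).2 hi, ?_⟩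
    have h2 : AEStronglyMeasurable (fun p : (Fin m → ℝ) × (Fin m → ℝ) =>
      G (∏ i, p.1 i) (∏ i, p.2 i)) (((scalarLaw v m).prod (scalarLaw v m)).map T) := by
      rw [hT.map_eq]; exact hi.1
    have h1 := integral_map hT.measurable.aemeasurable h2
    rw [hT.map_eq] at h1
    exact h1.symm
  obtain ⟨i1, k1⟩ := key (Prod.map id S) ((MeasurePreserving.id _).prod hS)
  obtain ⟨i2, k2⟩ := key (Prod.map S id) (hS.prod (MeasurePreserving.id _))
  obtain ⟨i3, k3⟩ := key (Prod.map S S) (hS.prod hS)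
  simp only [Prod.map_fst, Prod.map_snd, id_eq, hS'] at i1 k1 i2 k2 i3 k3
  have j1 : Integrable (fun p : (Fin m → ℝ) × (Fin m → ℝ) => G (∏ i, p.1 i) (∏ i, p.2 i)
      + G (∏ i, p.1 i) (-∏ i, p.2 i)) ((scalarLaw v m).prod (scalarLaw v m)) := hi.add i1
  have j2 : Integrable (fun p : (Fin m → ℝ) × (Fin m → ℝ) => G (∏ i, p.1 i) (∏ i, p.2 i)
      + G (∏ i, p.1 i) (-∏ i, p.2 i) + G (-∏ i, p.1 i) (∏ i, p.2 i))
      ((scalarLaw v m).prod (scalarLaw v m)) := j1.add i2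
  rw [integral_div, integral_add j2 i3, integral_add j1 i2,
    integral_add hi i1, k1, k2, k3]
  ring

/-- The contribution of one monomial of the kernel. -/
lemma integral_monomial [NeZero v] (hm : 0 < m) {g : ℝ → ℝ} (hg : Measurable g) {M : ℝ}
    (hM : ∀ x, |g x| ≤ M) (j : ℕ) :
    ∫ p : (Fin m → ℝ) × (Fin m → ℝ), g (∏ i, p.1 i) * (|(∏ i, p.1 i) - ∏ i, p.2 i| *
        ((∏ i, p.1 i) * ∏ i, p.2 i) ^ j) ∂((scalarLaw v m).prod (scalarLaw v m))
    = (absMoment v j * absMoment v (j + 1)) ^ m *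
      densityTerm v m (fun r => (g r + g (-r)) / 2) j := by
  set h : ℝ → ℝ := fun r => (g r + g (-r)) / 2 with hh
  have hhabs : ∀ x, (g x + g (-x)) = 2 * h |x| := by
    intro x
    rcases abs_cases x with ⟨e, -⟩ | ⟨e, -⟩ <;> rw [e, hh] <;> simp <;> ring
  have hx : AllMemLp (fun p : (Fin m → ℝ) × (Fin m → ℝ) => ∏ i, p.1 i)
      ((scalarLaw v m).prod (scalarLaw v m)) :=
    (AllMemLp.prod_scalars v m).comp measurePreserving_fst
  have hy : AllMemLp (fun p : (Fin m → ℝ) × (Fin m → ℝ) => ∏ i, p.2 i)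
      ((scalarLaw v m).prod (scalarLaw v m)) :=
    (AllMemLp.prod_scalars v m).comp measurePreserving_snd
  have hxm : Measurable fun p : (Fin m → ℝ) × (Fin m → ℝ) => ∏ i, p.1 i := by fun_prop
  have hym : Measurable fun p : (Fin m → ℝ) × (Fin m → ℝ) => ∏ i, p.2 i := by fun_prop
  have hhm : Measurable h := ((hg.add (hg.comp measurable_neg)).div_const 2)
  have hhM : ∀ r, |h r| ≤ M := by
    intro r
    have h1 := abs_le.1 (hM r)
    have h2 := abs_le.1 (hM (-r))
    rw [hh, abs_le]
    constructor <;> simp only <;> linarith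
  have hint : ∀ a b : ℕ, ∀ s : Set ((Fin m → ℝ) × (Fin m → ℝ)), MeasurableSet s →
      Integrable (s.indicator fun p => |∏ i, p.1 i| ^ a * |∏ i, p.2 i| ^ b * h |∏ i, p.1 i|)
        ((scalarLaw v m).prod (scalarLaw v m)) := by
    intro a b s hs
    refine Integrable.indicator ?_ hs
    have := ((hx.abs.pow a).mul (hy.abs.pow b)).integrable
    exact this.mul_bdd (c := M) (hhm.comp (hxm.norm)).aestronglyMeasurable
      (ae_of_all _ fun p => hhM _)
  have hs : MeasurableSet {p : (Fin m → ℝ) × (Fin m → ℝ) | |∏ i, p.2 i| < |∏ i, p.1 i|} :=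
    measurableSet_lt hym.norm hxm.norm
  have hU : ∀ a b, (absMoment v a * absMoment v b) ^ m * upperPart v m h a b
      = ∫ p, {p : (Fin m → ℝ) × (Fin m → ℝ) | |∏ i, p.2 i| < |∏ i, p.1 i|}.indicator
        (fun p => |∏ i, p.1 i| ^ a * |∏ i, p.2 i| ^ b * h |∏ i, p.1 i|) p
        ∂((scalarLaw v m).prod (scalarLaw v m)) := by
    intro a b
    have hpos : 0 < (absMoment v a * absMoment v b) ^ m :=
      pow_pos (mul_pos (absMoment_pos (NeZero.ne v) a) (absMoment_pos (NeZero.ne v) b)) m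
    rw [upperPart, integral_tiltLaw_prod, mul_div_cancel₀ _ hpos.ne']
    congr 1
    funext p
    simp only [Set.indicator_apply, Set.mem_ofPred_eq]
    split_ifs <;> simp
  have hL : ∀ a b, (absMoment v a * absMoment v b) ^ m * lowerPart v m h a b
      = ∫ p, {p : (Fin m → ℝ) × (Fin m → ℝ) | |∏ i, p.2 i| < |∏ i, p.1 i|}ᶜ.indicator
        (fun p => |∏ i, p.1 i| ^ a * |∏ i, p.2 i| ^ b * h |∏ i, p.1 i|) p
        ∂((scalarLaw v m).prod (scalarLaw v m)) := by
    intro a b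
    have hpos : 0 < (absMoment v a * absMoment v b) ^ m :=
      pow_pos (mul_pos (absMoment_pos (NeZero.ne v) a) (absMoment_pos (NeZero.ne v) b)) m
    rw [lowerPart, integral_tiltLaw_prod, mul_div_cancel₀ _ hpos.ne']
    congr 1
    funext p
    simp only [Set.indicator_apply, Set.mem_compl_iff, Set.mem_ofPred_eq]
    by_cases hp : |∏ i, p.2 i| < |∏ i, p.1 i|
    · simp only [if_pos hp, if_neg (not_not.2 hp), mul_zero]
    · simp only [if_neg hp, if_pos hp]
  have hGi : Integrable (fun p : (Fin m → ℝ) × (Fin m → ℝ) => g (∏ i, p.1 i) *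
      (|(∏ i, p.1 i) - ∏ i, p.2 i| * ((∏ i, p.1 i) * ∏ i, p.2 i) ^ j))
      ((scalarLaw v m).prod (scalarLaw v m)) :=
    ((hx.sub hy).abs.mul ((hx.mul hy).pow j)).integrable.bdd_mul (c := M)
      (hg.comp hxm).aestronglyMeasurable (ae_of_all _ fun p => hM _)
  rw [integral_symmetrize hm (G := fun x y => g x * (|x - y| * (x * y) ^ j)) hGi]
  have e : ∀ x y : ℝ, (g x * (|x - y| * (x * y) ^ j) + g x * (|x - -y| * (x * -y) ^ j)
      + g (-x) * (|-x - y| * (-x * y) ^ j) + g (-x) * (|-x - -y| * (-x * -y) ^ j)) / 4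
      = h |x| * ((|x - y| * (x * y) ^ j + |x + y| * (-(x * y)) ^ j) / 2) := by
    intro x y
    have a1 : |-x - y| = |x + y| := by rw [← abs_neg]; congr 1; ring
    have a2 : |-x - -y| = |x - y| := by rw [← abs_neg]; congr 1; ring
    rw [a1, a2, sub_neg_eq_add, mul_neg, neg_mul, neg_mul_neg]
    linear_combination (|x - y| * (x * y) ^ j + |x + y| * (-(x * y)) ^ j) / 4 * hhabs x
  simp only [e]
  have hcomm : absMoment v j * absMoment v (j + 1) = absMoment v (j + 1) * absMoment v j :=
    mul_comm _ _
  rcases Nat.even_or_odd j with hj | hj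
  · rw [densityTerm, if_pos hj, mul_add]
    nth_rewrite 1 [hcomm]
    rw [hU, hL, ← integral_add (hint _ _ _ hs) (hint _ _ _ hs.compl)]
    congr 1
    funext p
    rw [symmetrized_even hj]
    simp only [Set.indicator_apply, Set.mem_compl_iff, Set.mem_ofPred_eq]
    by_cases hp : |∏ i, p.2 i| < |∏ i, p.1 i|
    · simp only [if_pos hp, if_neg (not_not.2 hp)]
      ring
    · simp only [if_neg hp, if_pos hp]
      ring
  · rw [densityTerm, if_neg (Nat.not_even_iff_odd.2 hj), mul_neg, mul_add]
    nth_rewrite 1 [hcomm]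
    rw [hU, hL, ← integral_add (hint _ _ _ hs.compl) (hint _ _ _ hs), ← integral_neg]
    congr 1
    funext p
    rw [symmetrized_odd hj]
    simp only [Set.indicator_apply, Set.mem_compl_iff, Set.mem_ofPred_eq]
    by_cases hp : |∏ i, p.2 i| < |∏ i, p.1 i|
    · simp only [if_pos hp, if_neg (not_not.2 hp)]
      ring
    · simp only [if_neg hp, if_pos hp]
      ring

/-- Integrals against the root density as a sum over monomials. -/
theorem integral_mul_rootDensity [NeZero v] (hm : 0 < m) (d : ℕ) {g : ℝ → ℝ} (hg : Measurable g)
    {M : ℝ} (hM : ∀ x, |g x| ≤ M) :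
    ∫ ξ, g (∏ i, ξ i) * rootDensity v m d (∏ i, ξ i) ∂(scalarLaw v m)
    = (d.factorial * (v : ℝ) ^ d * (absMoment v 0 * absMoment v 1)) ^ m *
      ∑ j ∈ Finset.range (d + 1), densityTerm v m (fun r => (g r + g (-r)) / 2) j := by
  have hK := (integrable_rootDensity_kernel v m d).bdd_mul (c := M)
    (f := fun p : (Fin m → ℝ) × (Fin m → ℝ) => g (∏ i, p.1 i))
    (hg.comp (by fun_prop)).aestronglyMeasurable (ae_of_all _ fun p => hM _)
  have h1 : ∫ ξ, g (∏ i, ξ i) * rootDensity v m d (∏ i, ξ i) ∂(scalarLaw v m)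
      = ∫ p : (Fin m → ℝ) × (Fin m → ℝ), g (∏ i, p.1 i) * (|(∏ i, p.1 i) - ∏ i, p.2 i| *
        covKernel v m d (∏ i, p.1 i) (∏ i, p.2 i)) ∂((scalarLaw v m).prod (scalarLaw v m)) := by
    rw [integral_prod _ hK]
    simp only [rootDensity, integral_const_mul]
  rw [h1]
  have e : ∀ p : (Fin m → ℝ) × (Fin m → ℝ), g (∏ i, p.1 i) * (|(∏ i, p.1 i) - ∏ i, p.2 i| *
        covKernel v m d (∏ i, p.1 i) (∏ i, p.2 i))
      = ∑ j ∈ Finset.range (d + 1), ((d.descFactorial (d - j) : ℝ) * (v : ℝ) ^ (d - j)) ^ m *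
        (g (∏ i, p.1 i) * (|(∏ i, p.1 i) - ∏ i, p.2 i| * ((∏ i, p.1 i) * ∏ i, p.2 i) ^ j)) := by
    intro p
    rw [covKernel, Finset.mul_sum, Finset.mul_sum, ← Finset.sum_range_reflect]
    refine Finset.sum_congr rfl fun j hj => ?_
    have hj' : j ≤ d := Nat.lt_succ_iff.1 (Finset.mem_range.1 hj)
    have e1 : d + 1 - 1 - j = d - j := by omega
    have e2 : d - (d - j) = j := by omega
    rw [e1, e2]
    ring
  have hx : AllMemLp (fun p : (Fin m → ℝ) × (Fin m → ℝ) => ∏ i, p.1 i)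
      ((scalarLaw v m).prod (scalarLaw v m)) :=
    (AllMemLp.prod_scalars v m).comp measurePreserving_fst
  have hy : AllMemLp (fun p : (Fin m → ℝ) × (Fin m → ℝ) => ∏ i, p.2 i)
      ((scalarLaw v m).prod (scalarLaw v m)) :=
    (AllMemLp.prod_scalars v m).comp measurePreserving_snd
  have hGi : ∀ j, Integrable (fun p : (Fin m → ℝ) × (Fin m → ℝ) => g (∏ i, p.1 i) *
      (|(∏ i, p.1 i) - ∏ i, p.2 i| * ((∏ i, p.1 i) * ∏ i, p.2 i) ^ j))
      ((scalarLaw v m).prod (scalarLaw v m)) := fun j =>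
    ((hx.sub hy).abs.mul ((hx.mul hy).pow j)).integrable.bdd_mul (c := M)
      (hg.comp (by fun_prop)).aestronglyMeasurable (ae_of_all _ fun p => hM _)
  simp only [e]
  rw [integral_finsetSum _ fun j _ => (hGi j).const_mul _, Finset.mul_sum]
  refine Finset.sum_congr rfl fun j hj => ?_
  have hj' : j ≤ d := Nat.lt_succ_iff.1 (Finset.mem_range.1 hj)
  rw [integral_const_mul, integral_monomial hm hg hM, ← mul_assoc, ← mul_pow,
    absMoment_mul_succ (NeZero.ne v)]
  congr 2
  have e1 : (j.factorial : ℝ) * d.descFactorial (d - j) = d.factorial := by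
    have := Nat.factorial_mul_descFactorial (n := d) (k := d - j) (by omega)
    rw [Nat.sub_sub_self hj'] at this
    exact_mod_cast this
  have e2 : (v : ℝ) ^ (d - j) * (v : ℝ) ^ j = (v : ℝ) ^ d := by
    rw [← pow_add, Nat.sub_add_cancel hj']
  rw [← e1, ← e2]
  ring

end Symmetrization

section Taylor

lemma norm_exp_mul_I_sub_taylor_le (y : ℝ) :
    ‖Complex.exp (y * Complex.I) - (1 + y * Complex.I - (y : ℂ) ^ 2 / 2)‖ ≤ 4 * |y| ^ 3 := by
  rcases le_or_gt |y| 1 with h | h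
  · have h1 := Complex.norm_exp_sub_sum_le_norm_mul_exp (y * Complex.I) 3
    have e : ∑ k ∈ Finset.range 3, ((y : ℂ) * Complex.I) ^ k / (k.factorial : ℂ)
        = 1 + y * Complex.I - (y : ℂ) ^ 2 / 2 := by
      simp [Finset.sum_range_succ, mul_pow]
      ring
    have e2 : ‖(y : ℂ) * Complex.I‖ = |y| := by simp
    rw [e, e2] at h1
    refine h1.trans ?_
    have h3 : Real.exp |y| ≤ 4 := by
      refine (Real.exp_le_exp.2 h).trans ?_
      linarith [Real.exp_one_lt_d9]
    nlinarith [pow_nonneg (abs_nonneg y) 3]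
  · have h1 : ‖Complex.exp (y * Complex.I)‖ = 1 := Complex.norm_exp_ofReal_mul_I y
    have h2 : ‖(1 : ℂ) + y * Complex.I - (y : ℂ) ^ 2 / 2‖ ≤ 1 + |y| + |y| ^ 2 / 2 := by
      refine (norm_sub_le _ _).trans (add_le_add ((norm_add_le _ _).trans ?_) ?_)
      · simp
      · simp
    refine (norm_sub_le _ _).trans ?_
    have h3 : |y| ^ 2 ≤ |y| ^ 3 := pow_le_pow_right₀ h.le (by norm_num)
    have h4 : |y| ≤ |y| ^ 3 := le_self_pow₀ h.le (by norm_num)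
    have h5 : 1 ≤ |y| ^ 3 := one_le_pow₀ h.le
    linarith

lemma abs_log_one_add_sub_le {w : ℝ} (hw : -(1 / 2) ≤ w) :
    |Real.log (1 + w) - w| ≤ 2 * w ^ 2 := by
  have h0 : 0 < 1 + w := by linarith
  have h1 := Real.log_le_sub_one_of_pos h0
  have h2 := Real.one_sub_inv_le_log_of_pos h0
  have h3 : w - 2 * w ^ 2 ≤ 1 - (1 + w)⁻¹ := by
    rw [← sub_nonneg]
    have : 1 - (1 + w)⁻¹ - (w - 2 * w ^ 2) = w ^ 2 * (1 + 2 * w) / (1 + w) := by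
      field_simp; ring
    rw [this]
    have : 0 ≤ 1 + 2 * w := by linarith
    positivity
  rw [abs_le]
  constructor <;> nlinarith [sq_nonneg w]

lemma abs_log_one_add_sub_sub_le {w : ℝ} (hw : -(1 / 2) ≤ w) :
    |Real.log (1 + w) - (w - w ^ 2 / 2)| ≤ 9 * |w| ^ 3 := by
  rcases le_or_gt w (1 / 2) with h | h
  · have ha : |w| ≤ 1 / 2 := abs_le.2 ⟨hw, h⟩
    have h1 := Real.abs_log_sub_add_sum_range_le (x := -w) (by rw [abs_neg]; linarith) 2
    rw [abs_neg] at h1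
    have e : (∑ i ∈ Finset.range 2, (-w) ^ (i + 1) / ((i : ℝ) + 1)) + Real.log (1 - -w)
        = Real.log (1 + w) - (w - w ^ 2 / 2) := by
      simp [Finset.sum_range_succ]
      ring
    rw [e] at h1
    refine h1.trans ?_
    rw [div_le_iff₀ (by linarith)]
    have h3 := mul_nonneg (pow_nonneg (abs_nonneg w) 3) (by linarith : 0 ≤ 1 / 2 - |w|)
    norm_num
    nlinarith [pow_nonneg (abs_nonneg w) 3]
  · have h1 := abs_le.1 (abs_log_one_add_sub_le hw)
    rw [abs_of_pos (by linarith : 0 < w), abs_le]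
    have h3 : w ^ 2 ≤ 2 * w ^ 3 := by nlinarith [sq_nonneg w]
    constructor <;> nlinarith

/-- Second-order expansion of `u ^ (i c)` around `u = 1`, uniform on the half-line. -/
lemma norm_exp_log_sub_taylor_le (c : ℝ) : ∃ C : ℝ, 0 ≤ C ∧ ∀ w : ℝ, -1 ≤ w →
    ‖Complex.exp ((c * Real.log (1 + w) : ℝ) * Complex.I)
      - (1 + (c * Complex.I) * w + (-(c : ℂ) ^ 2 - c * Complex.I) / 2 * (w : ℂ) ^ 2)‖ ≤ C * |w| ^ 3 := by
  refine ⟨8 + 8 + 4 * |c| + (c ^ 2 + |c|) + 32 * |c| ^ 3 + 9 * |c| + 3 * c ^ 2, by positivity,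
    fun w hw => ?_⟩
  have hq : ‖(-(c : ℂ) ^ 2 - c * Complex.I)‖ ≤ c ^ 2 + |c| := by
    refine (norm_sub_le _ _).trans ?_
    simp
  have hw3 : 0 ≤ |w| ^ 3 := by positivity
  rcases le_or_gt (-(1 / 2)) w with h | h
  · set L := Real.log (1 + w) with hL
    have h1 := norm_exp_mul_I_sub_taylor_le (c * L)
    have hLw := abs_log_one_add_sub_le h
    have hLw2 := abs_log_one_add_sub_sub_le h
    have hL2 : |L| ≤ 2 * |w| := by
      have h0 : 0 < 1 + w := by linarith
      have g1 := Real.log_le_sub_one_of_pos h0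
      have g2 := Real.one_sub_inv_le_log_of_pos h0
      have g3 : 1 - (1 + w)⁻¹ = w / (1 + w) := by field_simp; ring
      rw [g3] at g2
      rcases le_or_gt 0 w with hw0 | hw0
      · have : 0 ≤ w / (1 + w) := by positivity
        rw [abs_of_nonneg hw0, abs_of_nonneg (this.trans g2)]
        linarith
      · have : 2 * w ≤ w / (1 + w) := by
          rw [le_div_iff₀ h0]; nlinarith
        rw [abs_of_neg hw0, abs_of_nonpos (by linarith)]
        linarith
    have hsq : |L ^ 2 - w ^ 2| ≤ 6 * |w| ^ 3 := by
      have : L ^ 2 - w ^ 2 = (L - w) * (L + w) := by ring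
      rw [this, abs_mul]
      have h4 : |L + w| ≤ 3 * |w| := (abs_add_le _ _).trans (by linarith)
      calc |L - w| * |L + w| ≤ (2 * w ^ 2) * (3 * |w|) := by gcongr
        _ = 6 * |w| ^ 3 := by rw [← sq_abs w]; ring
    have e : Complex.exp ((c * L : ℝ) * Complex.I)
        - (1 + (c * Complex.I) * w + (-(c : ℂ) ^ 2 - c * Complex.I) / 2 * (w : ℂ) ^ 2)
        = (Complex.exp ((c * L : ℝ) * Complex.I)
          - (1 + (c * L : ℝ) * Complex.I - ((c * L : ℝ) : ℂ) ^ 2 / 2))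
        + ((c * (L - (w - w ^ 2 / 2)) : ℝ) : ℂ) * Complex.I
        - ((c ^ 2 / 2 * (L ^ 2 - w ^ 2) : ℝ) : ℂ) := by
      push_cast
      ring
    rw [e]
    refine (norm_sub_le _ _).trans ((add_le_add_left (norm_add_le _ _) _).trans ?_)
    rw [norm_mul, Complex.norm_I, mul_one, Complex.norm_real, Complex.norm_real, Real.norm_eq_abs,
      Real.norm_eq_abs, abs_mul, abs_mul]
    have k1 : 4 * |c * L| ^ 3 ≤ 32 * |c| ^ 3 * |w| ^ 3 := by
      rw [abs_mul, mul_pow]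
      calc 4 * (|c| ^ 3 * |L| ^ 3) ≤ 4 * (|c| ^ 3 * (2 * |w|) ^ 3) := by gcongr
        _ = _ := by ring
    have k2 : |c| * |L - (w - w ^ 2 / 2)| ≤ 9 * |c| * |w| ^ 3 := by
      calc _ ≤ |c| * (9 * |w| ^ 3) := by gcongr
        _ = _ := by ring
    have k3 : |c ^ 2 / 2| * |L ^ 2 - w ^ 2| ≤ 3 * c ^ 2 * |w| ^ 3 := by
      rw [abs_of_nonneg (by positivity)]
      calc _ ≤ c ^ 2 / 2 * (6 * |w| ^ 3) := by gcongr
        _ = _ := by ring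
    have k4 : 0 ≤ (8 + 8 + 4 * |c| + (c ^ 2 + |c|)) * |w| ^ 3 := by positivity
    linarith
  · have hw1 : 1 / 2 ≤ |w| := by rw [abs_of_neg (by linarith)]; linarith
    have a0 : 1 ≤ 8 * |w| ^ 3 := by
      calc (1 : ℝ) = 8 * (1 / 2) ^ 3 := by norm_num
        _ ≤ _ := by gcongr
    have a2 : |w| ^ 2 ≤ 2 * |w| ^ 3 := by nlinarith [sq_nonneg |w|]
    have a1 : |w| ≤ 4 * |w| ^ 3 := by nlinarith [abs_nonneg w]
    have n1 : ‖Complex.exp ((c * Real.log (1 + w) : ℝ) * Complex.I)‖ = 1 :=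
      Complex.norm_exp_ofReal_mul_I _
    have n2 : ‖1 + (c * Complex.I) * w + (-(c : ℂ) ^ 2 - c * Complex.I) / 2 * (w : ℂ) ^ 2‖
        ≤ 1 + |c| * |w| + (c ^ 2 + |c|) / 2 * |w| ^ 2 := by
      refine (norm_add_le _ _).trans (add_le_add ((norm_add_le _ _).trans ?_) ?_)
      · simp
      · rw [norm_mul, norm_div, norm_pow, Complex.norm_real, Complex.norm_two, Real.norm_eq_abs]
        gcongr
    refine (norm_sub_le _ _).trans ?_
    rw [n1]
    have b1 : |c| * |w| ≤ |c| * (4 * |w| ^ 3) := by gcongr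
    have b2 : (c ^ 2 + |c|) / 2 * |w| ^ 2 ≤ (c ^ 2 + |c|) / 2 * (2 * |w| ^ 3) := by gcongr
    have k4 : 0 ≤ (32 * |c| ^ 3 + 9 * |c| + 3 * c ^ 2) * |w| ^ 3 := by positivity
    linarith

lemma norm_pow_sub_pow_le_mul {A B : ℂ} (hA : ‖A‖ ≤ 1) (hB : ‖B‖ ≤ 1) (m : ℕ) :
    ‖A ^ m - B ^ m‖ ≤ m * ‖A - B‖ := by
  induction m with
  | zero => simp
  | succ m ih =>
    have e : A ^ (m + 1) - B ^ (m + 1) = A * (A ^ m - B ^ m) + (A - B) * B ^ m := by ring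
    rw [e]
    refine (norm_add_le _ _).trans ?_
    rw [norm_mul, norm_mul, norm_pow]
    have h1 : ‖A‖ * ‖A ^ m - B ^ m‖ ≤ 1 * (m * ‖A - B‖) := by gcongr
    have h2 : ‖A - B‖ * ‖B‖ ^ m ≤ ‖A - B‖ * 1 := by
      gcongr; exact pow_le_one₀ (norm_nonneg _) hB
    push_cast
    linarith

end Taylor

section TiltMoments

variable {v : NNReal}

lemma integrable_absTilt_of [NeZero v] (j : ℕ) {F : ℝ → ℝ}
    (hF : Integrable (fun x => |x| ^ j * F x) (gaussianReal 0 v)) : Integrable F (absTilt v j) := by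
  have hpos := absMoment_pos (NeZero.ne v) j
  rw [absTilt, integrable_withDensity_iff_integrable_smul' (measurable_absTilt_density v j)
    (ae_of_all _ fun x => ENNReal.ofReal_lt_top)]
  have := hF.div_const (absMoment v j)
  refine this.congr (ae_of_all _ fun x => ?_)
  simp only
  rw [ENNReal.toReal_ofReal (by positivity), smul_eq_mul]
  ring

lemma integrable_sq_div_pow_absTilt [NeZero v] (j k : ℕ) (s : ℝ) :
    Integrable (fun x : ℝ => (x ^ 2 / s) ^ k) (absTilt v j) := by
  refine integrable_absTilt_of j ?_
  have := (integrable_abs_pow_gaussianReal v (j + 2 * k)).div_const (s ^ k)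
  refine this.congr (ae_of_all _ fun x => ?_)
  simp only
  rw [div_pow, pow_add, pow_mul, sq_abs]
  ring

lemma integral_sq_div_pow_absTilt [NeZero v] (j k : ℕ) (s : ℝ) :
    ∫ x, (x ^ 2 / s) ^ k ∂(absTilt v j) = absMoment v (j + 2 * k) / absMoment v j / s ^ k := by
  rw [integral_absTilt]
  have e : ∀ x : ℝ, (|x| ^ j / absMoment v j) • (x ^ 2 / s) ^ k
      = |x| ^ (j + 2 * k) / (absMoment v j * s ^ k) := by
    intro x
    rw [smul_eq_mul, div_pow, pow_add, pow_mul |x|, sq_abs, div_mul_div_comm]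
  simp only [e]
  rw [integral_div, ← absMoment, div_div]

lemma integral_centered_pow_absTilt [NeZero v] (j k : ℕ) (s : ℝ) :
    ∫ x, (x ^ 2 / s - 1) ^ k ∂(absTilt v j)
      = ∑ i ∈ Finset.range (k + 1), absMoment v (j + 2 * i) / absMoment v j / s ^ i
        * ((-1) ^ (k - i) * (k.choose i : ℝ)) := by
  have e : ∀ x : ℝ, (x ^ 2 / s - 1) ^ k = ∑ i ∈ Finset.range (k + 1),
      (x ^ 2 / s) ^ i * ((-1) ^ (k - i) * (k.choose i : ℝ)) := by
    intro x
    rw [sub_eq_add_neg, add_pow]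
    exact Finset.sum_congr rfl fun i _ => by ring
  simp only [e]
  rw [integral_finsetSum _ fun i _ => (integrable_sq_div_pow_absTilt j i s).mul_const _]
  refine Finset.sum_congr rfl fun i _ => ?_
  rw [integral_mul_const, integral_sq_div_pow_absTilt]

lemma integrable_centered_pow_absTilt [NeZero v] (j k : ℕ) (s : ℝ) :
    Integrable (fun x : ℝ => (x ^ 2 / s - 1) ^ k) (absTilt v j) := by
  have e : ∀ x : ℝ, (x ^ 2 / s - 1) ^ k = ∑ i ∈ Finset.range (k + 1),
      (x ^ 2 / s) ^ i * ((-1) ^ (k - i) * (k.choose i : ℝ)) := by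
    intro x
    rw [sub_eq_add_neg, add_pow]
    exact Finset.sum_congr rfl fun i _ => by ring
  simp only [e]
  exact integrable_finsetSum _ fun i _ => (integrable_sq_div_pow_absTilt j i s).mul_const _

lemma absMoment_ratio [NeZero v] (j : ℕ) :
    absMoment v (j + 2) = v * (j + 1) * absMoment v j ∧
    absMoment v (j + 4) = v ^ 2 * ((j + 1) * (j + 3)) * absMoment v j ∧
    absMoment v (j + 6) = v ^ 3 * ((j + 1) * (j + 3) * (j + 5)) * absMoment v j ∧
    absMoment v (j + 8) = v ^ 4 * ((j + 1) * (j + 3) * (j + 5) * (j + 7)) * absMoment v j := by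
  have h1 := absMoment_add_two (NeZero.ne v) j
  have h2 := absMoment_add_two (NeZero.ne v) (j + 2)
  have h3 := absMoment_add_two (NeZero.ne v) (j + 4)
  have h4 := absMoment_add_two (NeZero.ne v) (j + 6)
  simp only [add_assoc] at h2 h3 h4
  norm_num at h2 h3 h4
  rw [h3, h2, h1] at h4
  rw [h2, h1] at h3
  rw [h1] at h2
  refine ⟨h1, ?_, ?_, ?_⟩
  · rw [h2]; ring
  · rw [h3]; ring
  · rw [h4]; ring

lemma integral_centered_absTilt [NeZero v] (j : ℕ) :
    ∫ x, (x ^ 2 / (v * (j + 1)) - 1) ∂(absTilt v j) = 0 := by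
  have hpos := absMoment_pos (NeZero.ne v) j
  have hv : (0 : ℝ) < v := NNReal.coe_pos.2 (pos_iff_ne_zero.2 (NeZero.ne v))
  have h := integral_centered_pow_absTilt (v := v) j 1 (v * (j + 1))
  simp only [pow_one] at h
  rw [h]
  obtain ⟨h1, -⟩ := absMoment_ratio (v := v) j
  simp [Finset.sum_range_succ, h1]
  field_simp
  ring

lemma integral_centered_sq_absTilt [NeZero v] (j : ℕ) :
    ∫ x, (x ^ 2 / (v * (j + 1)) - 1) ^ 2 ∂(absTilt v j) = 2 / ((j : ℝ) + 1) := by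
  have hpos := absMoment_pos (NeZero.ne v) j
  have hv : (0 : ℝ) < v := NNReal.coe_pos.2 (pos_iff_ne_zero.2 (NeZero.ne v))
  rw [integral_centered_pow_absTilt (v := v) j 2 (v * (j + 1))]
  obtain ⟨h1, h2, -⟩ := absMoment_ratio (v := v) j
  simp [Finset.sum_range_succ, h1, h2]
  field_simp
  ring

lemma integral_centered_fourth_absTilt [NeZero v] (j : ℕ) :
    ∫ x, (x ^ 2 / (v * (j + 1)) - 1) ^ 4 ∂(absTilt v j)
      = 12 / ((j : ℝ) + 1) ^ 2 + 48 / ((j : ℝ) + 1) ^ 3 := by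
  have hpos := absMoment_pos (NeZero.ne v) j
  have hv : (0 : ℝ) < v := NNReal.coe_pos.2 (pos_iff_ne_zero.2 (NeZero.ne v))
  rw [integral_centered_pow_absTilt (v := v) j 4 (v * (j + 1))]
  obtain ⟨h1, h2, h3, h4⟩ := absMoment_ratio (v := v) j
  simp [Finset.sum_range_succ, h1, h2, h3, h4, Nat.choose]
  field_simp
  ring

end TiltMoments

section TiltChar

variable {v : NNReal}

/-- The characteristic function of the logarithm of the normalised squared tilted variable. -/
noncomputable def tiltChar (v : NNReal) (j : ℕ) (c : ℝ) : ℂ :=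
  ∫ x, Complex.exp ((c * Real.log (x ^ 2 / (v * (j + 1))) : ℝ) * Complex.I) ∂(absTilt v j)

lemma norm_tiltChar_le [NeZero v] (j : ℕ) (c : ℝ) : ‖tiltChar v j c‖ ≤ 1 := by
  refine (norm_integral_le_integral_norm _).trans ?_
  simp only [Complex.norm_exp_ofReal_mul_I]
  simp

lemma norm_tiltChar_sub_le (c : ℝ) : ∃ C : ℝ, 0 ≤ C ∧ ∀ (v : NNReal) (_ : NeZero v) (j : ℕ),
    ‖tiltChar v j c - (1 + (-(c : ℂ) ^ 2 - c * Complex.I) / ((j : ℂ) + 1))‖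
      ≤ C / ((j + 1) * Real.sqrt (j + 1)) := by
  obtain ⟨C, hC, hT⟩ := norm_exp_log_sub_taylor_le c
  refine ⟨C * 31, by positivity, fun v _ j => ?_⟩
  set q : ℂ := -(c : ℂ) ^ 2 - c * Complex.I with hq
  have hv : (0 : ℝ) < v := NNReal.coe_pos.2 (pos_iff_ne_zero.2 (NeZero.ne v))
  set W : ℝ → ℝ := fun x => x ^ 2 / (v * (j + 1)) - 1 with hW
  have hW1 : ∀ x, -1 ≤ W x := fun x => by
    have : 0 ≤ x ^ 2 / (v * (j + 1)) := by positivity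
    simp only [hW]; linarith
  have iW : Integrable W (absTilt v j) := by
    simpa using integrable_centered_pow_absTilt (v := v) j 1 (v * (j + 1))
  have iW2 : Integrable (fun x => W x ^ 2) (absTilt v j) :=
    integrable_centered_pow_absTilt (v := v) j 2 (v * (j + 1))
  have iW4 : Integrable (fun x => W x ^ 4) (absTilt v j) :=
    integrable_centered_pow_absTilt (v := v) j 4 (v * (j + 1))
  have eW : ∫ x, W x ∂(absTilt v j) = 0 := integral_centered_absTilt j
  have eW2 : ∫ x, W x ^ 2 ∂(absTilt v j) = 2 / (j + 1) := integral_centered_sq_absTilt j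
  have eW4 : ∫ x, W x ^ 4 ∂(absTilt v j) = 12 / (j + 1) ^ 2 + 48 / (j + 1) ^ 3 :=
    integral_centered_fourth_absTilt j
  have iE : Integrable (fun x : ℝ =>
      Complex.exp ((c * Real.log (1 + W x) : ℝ) * Complex.I)) (absTilt v j) := by
    refine Integrable.of_bound (C := 1) ?_ (ae_of_all _ fun x => ?_)
    · refine Measurable.aestronglyMeasurable ?_
      simp only [hW]
      fun_prop
    · rw [Complex.norm_exp_ofReal_mul_I]
  have i1 : Integrable (fun x : ℝ => (c * Complex.I) * (W x : ℂ)) (absTilt v j) :=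
    iW.ofReal.const_mul _
  have i2 : Integrable (fun x : ℝ => q / 2 * (W x : ℂ) ^ 2) (absTilt v j) := by
    have := (iW2.ofReal (𝕜 := ℂ)).const_mul (q / 2)
    simpa using this
  have i0 : Integrable (fun _ : ℝ => (1 : ℂ)) (absTilt v j) := integrable_const _
  have i01 : Integrable (fun x : ℝ => 1 + (c * Complex.I) * (W x : ℂ)) (absTilt v j) := i0.add i1
  have iP : Integrable (fun x : ℝ => 1 + (c * Complex.I) * (W x : ℂ) + q / 2 * (W x : ℂ) ^ 2)
      (absTilt v j) := i01.add i2
  have eP : ∫ x, (1 + (c * Complex.I) * (W x : ℂ) + q / 2 * (W x : ℂ) ^ 2) ∂(absTilt v j)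
      = 1 + q / ((j : ℂ) + 1) := by
    have e1 : ∫ x, (W x : ℂ) ∂(absTilt v j) = 0 := by
      rw [integral_complex_ofReal, eW]; simp
    have e2 : ∫ x, (W x : ℂ) ^ 2 ∂(absTilt v j) = 2 / ((j : ℂ) + 1) := by
      have : ∀ x, (W x : ℂ) ^ 2 = ((W x ^ 2 : ℝ) : ℂ) := fun x => by push_cast; rfl
      simp only [this]
      rw [integral_complex_ofReal, eW2]; push_cast; rfl
    rw [integral_add i01 i2, integral_add i0 i1, integral_const_mul, integral_const_mul, e1, e2]
    simp
    ring
  have eT : tiltChar v j c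
      = ∫ x, Complex.exp ((c * Real.log (1 + W x) : ℝ) * Complex.I) ∂(absTilt v j) := by
    rw [tiltChar]
    simp only [hW, add_sub_cancel]
  rw [eT, ← eP, ← integral_sub iE iP]
  set r := Real.sqrt ((j : ℝ) + 1) with hr
  have hr2 : r ^ 2 = j + 1 := Real.sq_sqrt (by positivity)
  have hr1 : 1 ≤ r := by
    rw [hr, Real.one_le_sqrt]; linarith [Nat.cast_nonneg (α := ℝ) j]
  have iB : Integrable (fun x => C * ((r⁻¹ * W x ^ 2 + r * W x ^ 4) / 2)) (absTilt v j) :=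
    (((iW2.const_mul _).add (iW4.const_mul _)).div_const _).const_mul _
  refine (norm_integral_le_of_norm_le iB (ae_of_all _ fun x => (hT (W x) (hW1 x)).trans ?_)).trans ?_
  · have : |W x| ^ 3 ≤ (r⁻¹ * W x ^ 2 + r * W x ^ 4) / 2 := by
      have h4 : W x ^ 4 = |W x| ^ 4 := (Even.pow_abs (by decide) _).symm
      rw [h4, ← sq_abs (W x)]
      have h5 : 0 ≤ r⁻¹ * (|W x| * (1 - r * |W x|)) ^ 2 := by positivity
      have h6 : r⁻¹ * (|W x| * (1 - r * |W x|)) ^ 2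
          = r⁻¹ * |W x| ^ 2 + r * |W x| ^ 4 - 2 * |W x| ^ 3 := by field_simp; ring
      linarith
    gcongr
  · rw [integral_const_mul, integral_div, integral_add (iW2.const_mul _) (iW4.const_mul _),
      integral_const_mul, integral_const_mul, eW2, eW4, ← hr2]
    have e : (r⁻¹ * (2 / r ^ 2) + r * (12 / (r ^ 2) ^ 2 + 48 / (r ^ 2) ^ 3)) / 2
        = (7 + 24 / r ^ 2) / (r ^ 2 * r) := by field_simp; ring
    rw [e, mul_div_assoc]
    gcongr
    have : 24 / r ^ 2 ≤ 24 := div_le_self (by norm_num) (one_le_pow₀ hr1)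
    linarith

lemma tendsto_tiltChar_pow {v : ℕ → NNReal} [∀ n, NeZero (v n)] {j m : ℕ → ℕ} {β : ℝ}
    (hj : Tendsto j atTop atTop)
    (hm : Tendsto (fun n => (m n : ℝ) / ((j n : ℝ) + 1)) atTop (nhds β)) (c : ℝ) :
    Tendsto (fun n => tiltChar (v n) (j n) c ^ m n) atTop
      (nhds (Complex.exp (β * (-(c : ℂ) ^ 2 - c * Complex.I)))) := by
  obtain ⟨C, hC, hT⟩ := norm_tiltChar_sub_le c
  set q : ℂ := -(c : ℂ) ^ 2 - c * Complex.I with hq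
  have hqre : q.re = -c ^ 2 := by simp [hq, ← Complex.ofReal_pow]
  have ha : Tendsto (fun n => (j n : ℝ) + 1) atTop atTop :=
    tendsto_atTop_add_const_right _ _ (tendsto_natCast_atTop_atTop.comp hj)
  have h1 : Tendsto (fun n => Complex.exp (q / ((j n : ℂ) + 1)) ^ m n) atTop
      (nhds (Complex.exp (β * q))) := by
    have e : ∀ n, Complex.exp (q / ((j n : ℂ) + 1)) ^ m n
        = Complex.exp (((m n : ℝ) / ((j n : ℝ) + 1) : ℝ) * q) := by
      intro n
      rw [← Complex.exp_nat_mul]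
      congr 1
      push_cast
      ring
    simp only [e]
    exact (Complex.continuous_exp.tendsto _).comp
      (((Complex.continuous_ofReal.tendsto _).comp hm).mul_const q)
  refine h1.congr_dist ?_
  have hb : Tendsto (fun n => (m n : ℝ) / ((j n : ℝ) + 1) * (C / Real.sqrt ((j n : ℝ) + 1)
      + ‖q‖ ^ 2 / ((j n : ℝ) + 1))) atTop (nhds 0) := by
    have k1 : Tendsto (fun n => C / Real.sqrt ((j n : ℝ) + 1)) atTop (nhds 0) :=
      (Real.tendsto_sqrt_atTop.comp ha).const_div_atTop C
    have k2 : Tendsto (fun n => ‖q‖ ^ 2 / ((j n : ℝ) + 1)) atTop (nhds 0) :=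
      ha.const_div_atTop _
    simpa using hm.mul (k1.add k2)
  refine squeeze_zero' (Eventually.of_forall fun n => dist_nonneg) ?_ hb
  filter_upwards [ha.eventually_ge_atTop (max 1 ‖q‖)] with n hn
  have hn0 : 0 < (j n : ℝ) + 1 := by positivity
  have hnq : ‖q‖ ≤ (j n : ℝ) + 1 := (le_max_right _ _).trans hn
  have hnorm : ‖q / ((j n : ℂ) + 1)‖ = ‖q‖ / ((j n : ℝ) + 1) := by
    rw [norm_div]
    congr 1
    have : ((j n : ℂ) + 1) = (((j n : ℝ) + 1 : ℝ) : ℂ) := by push_cast; rfl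
    rw [this, Complex.norm_real, Real.norm_of_nonneg hn0.le]
  rw [dist_eq_norm]
  have hA : ‖Complex.exp (q / ((j n : ℂ) + 1))‖ ≤ 1 := by
    rw [Complex.norm_exp, Real.exp_le_one_iff]
    have : ((j n : ℂ) + 1) = (((j n : ℝ) + 1 : ℝ) : ℂ) := by push_cast; rfl
    rw [this, Complex.div_ofReal_re, hqre]
    exact div_nonpos_of_nonpos_of_nonneg (by nlinarith [sq_nonneg c]) hn0.le
  refine (norm_pow_sub_pow_le_mul hA (norm_tiltChar_le _ _) _).trans ?_
  have hB := Complex.norm_exp_sub_one_sub_id_le (x := q / ((j n : ℂ) + 1))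
    (by rw [hnorm, div_le_one hn0]; exact hnq)
  have hE := hT (v n) inferInstance (j n)
  have e : Complex.exp (q / ((j n : ℂ) + 1)) - tiltChar (v n) (j n) c
      = (Complex.exp (q / ((j n : ℂ) + 1)) - 1 - q / ((j n : ℂ) + 1))
        - (tiltChar (v n) (j n) c - (1 + q / ((j n : ℂ) + 1))) := by ring
  have hnn : ‖Complex.exp (q / ((j n : ℂ) + 1)) - tiltChar (v n) (j n) c‖
      ≤ (‖q‖ / ((j n : ℝ) + 1)) ^ 2 + C / (((j n : ℝ) + 1) * Real.sqrt ((j n : ℝ) + 1)) := by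
    rw [e]
    refine (norm_sub_le _ _).trans (add_le_add ?_ hE)
    rw [← hnorm]; exact hB
  calc (m n : ℝ) * _ ≤ (m n : ℝ) * ((‖q‖ / ((j n : ℝ) + 1)) ^ 2
        + C / (((j n : ℝ) + 1) * Real.sqrt ((j n : ℝ) + 1))) := by gcongr
    _ = _ := by
      have := Real.sqrt_pos.2 hn0
      field_simp
      ring

end TiltChar

section LogGap

variable {v : NNReal}

lemma ae_ne_zero_absTilt [NeZero v] (j : ℕ) : ∀ᵐ x ∂(absTilt v j), x ≠ 0 := by
  have h1 : absTilt v j ≪ gaussianReal 0 v := withDensity_absolutelyContinuous _ _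
  have := nullSingletonClass_gaussianReal (μ := 0) (NeZero.ne v)
  have h2 : ∀ᵐ x ∂(gaussianReal 0 v), x ≠ 0 := by
    rw [ae_iff]
    simp
  exact h1.ae_le h2

lemma ae_forall_ne_zero_tiltLaw [NeZero v] (m j : ℕ) : ∀ᵐ ξ ∂(tiltLaw v m j), ∀ i, ξ i ≠ 0 := by
  rw [ae_all_iff]
  intro i
  exact (measurePreserving_eval (fun _ : Fin m => absTilt v j) i).quasiMeasurePreserving.ae
    (ae_ne_zero_absTilt j)

/-- The difference of the logarithms of the absolute values of two products. -/
noncomputable def logGap (m : ℕ) (p : (Fin m → ℝ) × (Fin m → ℝ)) : ℝ :=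
  ∑ i, Real.log |p.1 i| - ∑ i, Real.log |p.2 i|

lemma measurable_logGap (m : ℕ) : Measurable (logGap m) := by
  unfold logGap
  fun_prop

lemma integral_exp_log_abs_absTilt [NeZero v] (j : ℕ) (θ : ℝ) :
    ∫ x, Complex.exp ((θ * Real.log |x| : ℝ) * Complex.I) ∂(absTilt v j)
      = Complex.exp ((θ / 2 * Real.log (v * (j + 1)) : ℝ) * Complex.I) * tiltChar v j (θ / 2) := by
  have hv : (0 : ℝ) < v := NNReal.coe_pos.2 (pos_iff_ne_zero.2 (NeZero.ne v))
  rw [tiltChar, ← integral_const_mul]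
  refine integral_congr_ae ?_
  filter_upwards [ae_ne_zero_absTilt (v := v) j] with x hx
  rw [← Complex.exp_add, ← add_mul, ← Complex.ofReal_add]
  congr 3
  rw [Real.log_div (by positivity) (by positivity), Real.log_pow, Real.log_abs]
  push_cast
  ring

lemma charFun_logGap [NeZero v] (m a b : ℕ) (θ : ℝ) :
    charFun (((tiltLaw v m a).prod (tiltLaw v m b)).map (logGap m)) θ
      = Complex.exp ((θ / 2 * (m * (Real.log (a + 1) - Real.log (b + 1))) : ℝ) * Complex.I)
        * tiltChar v a (θ / 2) ^ m * tiltChar v b (-(θ / 2)) ^ m := by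
  have hv : (0 : ℝ) < v := NNReal.coe_pos.2 (pos_iff_ne_zero.2 (NeZero.ne v))
  rw [charFun_apply_real, integral_map (measurable_logGap m).aemeasurable
    (Measurable.aestronglyMeasurable (by fun_prop))]
  have e : ∀ p : (Fin m → ℝ) × (Fin m → ℝ), Complex.exp (θ * logGap m p * Complex.I)
      = (∏ i, Complex.exp ((θ * Real.log |p.1 i| : ℝ) * Complex.I))
        * ∏ i, Complex.exp (((-θ) * Real.log |p.2 i| : ℝ) * Complex.I) := by
    intro p
    rw [← Complex.exp_sum, ← Complex.exp_sum, ← Complex.exp_add, logGap]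
    congr 1
    push_cast
    rw [← Finset.sum_mul, ← Finset.sum_mul, ← Finset.mul_sum, ← Finset.mul_sum]
    ring
  simp only [e]
  rw [integral_prod_mul (fun ξ : Fin m → ℝ => ∏ i, Complex.exp ((θ * Real.log |ξ i| : ℝ) * Complex.I))
    (fun ξ : Fin m → ℝ => ∏ i, Complex.exp (((-θ) * Real.log |ξ i| : ℝ) * Complex.I)), tiltLaw,
    tiltLaw, integral_fintype_prod_eq_prod
      (fun (_ : Fin m) (x : ℝ) => Complex.exp ((θ * Real.log |x| : ℝ) * Complex.I)),
    integral_fintype_prod_eq_prod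
      (fun (_ : Fin m) (x : ℝ) => Complex.exp (((-θ) * Real.log |x| : ℝ) * Complex.I))]
  simp only [integral_exp_log_abs_absTilt, Finset.prod_const, Finset.card_univ, Fintype.card_fin,
    mul_pow, neg_div]
  rw [Real.log_mul hv.ne' (by positivity), Real.log_mul hv.ne' (by positivity)]
  have e2 : Complex.exp ((θ / 2 * (m * (Real.log (a + 1) - Real.log (b + 1))) : ℝ) * Complex.I)
      = Complex.exp ((θ / 2 * (Real.log v + Real.log (a + 1)) : ℝ) * Complex.I) ^ m
        * Complex.exp ((-(θ / 2) * (Real.log v + Real.log (b + 1)) : ℝ) * Complex.I) ^ m := by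
    rw [← Complex.exp_nat_mul, ← Complex.exp_nat_mul, ← Complex.exp_add]
    congr 1
    push_cast
    ring
  rw [e2]
  ring

/-- The law of the logarithmic gap, as a probability measure. -/
noncomputable def logGapLaw (v : NNReal) [NeZero v] (m a b : ℕ) : ProbabilityMeasure ℝ :=
  ⟨((tiltLaw v m a).prod (tiltLaw v m b)).map (logGap m),
    Measure.isProbabilityMeasure_map (measurable_logGap m).aemeasurable⟩

lemma tendsto_logGapLaw {v : ℕ → NNReal} [∀ n, NeZero (v n)] {j m : ℕ → ℕ} {β : ℝ} (hβ : 0 ≤ β)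
    (hj : Tendsto j atTop atTop)
    (hm : Tendsto (fun n => (m n : ℝ) / ((j n : ℝ) + 1)) atTop (nhds β)) :
    Tendsto (fun n => logGapLaw (v n) (m n) (j n + 1) (j n)) atTop
      (nhds ⟨gaussianReal (β / 2) β.toNNReal, inferInstance⟩) := by
  refine ProbabilityMeasure.tendsto_of_tendsto_charFun fun θ => ?_
  have ha : Tendsto (fun n => (j n : ℝ) + 1) atTop atTop :=
    tendsto_atTop_add_const_right _ _ (tendsto_natCast_atTop_atTop.comp hj)
  have hj1 : Tendsto (fun n => j n + 1) atTop atTop := (tendsto_add_atTop_nat 1).comp hj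
  have hq : Tendsto (fun n => ((j n : ℝ) + 1) / ((j n : ℝ) + 2)) atTop (nhds 1) := by
    have h1 : Tendsto (fun n => 1 - 1 / ((j n : ℝ) + 1 + 1)) atTop (nhds (1 - 0)) :=
      tendsto_const_nhds.sub ((tendsto_atTop_add_const_right _ _ ha).const_div_atTop 1)
    rw [sub_zero] at h1
    refine h1.congr fun n => ?_
    have : (j n : ℝ) + 1 + 1 ≠ 0 := by positivity
    have : (j n : ℝ) + 2 ≠ 0 := by positivity
    field_simp
    ring
  have hm1 : Tendsto (fun n => (m n : ℝ) / (((j n + 1 : ℕ) : ℝ) + 1)) atTop (nhds β) := by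
    have := hm.mul hq
    rw [mul_one] at this
    refine this.congr fun n => ?_
    push_cast
    have : (j n : ℝ) + 2 ≠ 0 := by positivity
    field_simp
    ring
  have hlog : Tendsto (fun n => (m n : ℝ) * (Real.log (((j n + 1 : ℕ) : ℝ) + 1)
      - Real.log ((j n : ℝ) + 1))) atTop (nhds β) := by
    have := hm.mul ((Real.tendsto_mul_log_one_add_div_atTop 1).comp ha)
    rw [mul_one] at this
    refine this.congr fun n => ?_
    have h0 : 0 < (j n : ℝ) + 1 := by positivity
    have e : 1 + 1 / ((j n : ℝ) + 1) = (((j n + 1 : ℕ) : ℝ) + 1) / ((j n : ℝ) + 1) := by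
      push_cast; field_simp
    simp only [Function.comp_apply]
    rw [e, Real.log_div (by positivity) h0.ne']
    field_simp
  have h1 := tendsto_tiltChar_pow (v := v) hj1 hm1 (θ / 2)
  have h2 := tendsto_tiltChar_pow (v := v) hj hm (-(θ / 2))
  have h3 : Tendsto (fun n => Complex.exp ((θ / 2 * ((m n : ℝ) * (Real.log (((j n + 1 : ℕ) : ℝ) + 1)
      - Real.log ((j n : ℝ) + 1))) : ℝ) * Complex.I)) atTop
      (nhds (Complex.exp ((θ / 2 * β : ℝ) * Complex.I))) :=
    (Complex.continuous_exp.tendsto _).comp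
      (((Complex.continuous_ofReal.tendsto _).comp (hlog.const_mul _)).mul_const _)
  have h := (h3.mul h1).mul h2
  simp only [logGapLaw, ProbabilityMeasure.coe_mk, charFun_logGap]
  convert h using 2
  rw [charFun_gaussianReal, ← Complex.exp_add, ← Complex.exp_add, Real.coe_toNNReal _ hβ]
  congr 1
  push_cast
  ring

lemma measureReal_gaussianReal_Ioi {β : ℝ} (hβ : 0 < β) :
    (gaussianReal (β / 2) β.toNNReal).real (Set.Ioi 0) = (1 + erf (Real.sqrt (β / 8))) / 2 := by
  have hv : β.toNNReal ≠ 0 := by simpa using hβ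
  have hc : (β.toNNReal : ℝ) = β := Real.coe_toNNReal _ hβ.le
  rw [Measure.real, gaussianReal_apply_eq_integral _ hv, ENNReal.toReal_ofReal
    (integral_nonneg fun x => gaussianPDFReal_nonneg _ _ _)]
  set F : ℝ → ℝ := fun y => Real.exp (-(1 / (2 * β)) * y ^ 2) with hF
  have e1 : ∀ x, gaussianPDFReal (β / 2) β.toNNReal x
      = (Real.sqrt (2 * Real.pi * β))⁻¹ * F (x + -(β / 2)) := by
    intro x
    rw [gaussianPDFReal, hc]
    simp only [hF]
    congr 2
    field_simp
    ring
  simp only [e1]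
  have iF : Integrable F := integrable_exp_neg_mul_sq (by positivity)
  have hshift : ∫ x in Set.Ioi (0 : ℝ), F (x + -(β / 2)) = ∫ y in Set.Ioi (-(β / 2)), F y := by
    have h := (measurePreserving_add_right volume (-(β / 2))).setIntegral_preimage_emb
      (measurableEmbedding_addRight (-(β / 2))) F (Set.Ioi (-(β / 2)))
    rw [← h]
    simp
  have hneg : ∫ y in (-(β / 2))..0, F y = ∫ y in (0 : ℝ)..(β / 2), F y := by
    have h := intervalIntegral.integral_comp_neg (a := 0) (b := β / 2) F
    rw [neg_zero] at h
    rw [← h]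
    simp [hF]
  set c := Real.sqrt (2 * β) with hcdef
  have hcpos : 0 < c := Real.sqrt_pos.2 (by positivity)
  have hc2 : c ^ 2 = 2 * β := Real.sq_sqrt (by positivity)
  have hbc : β / 2 / c = Real.sqrt (β / 8) := by
    symm
    rw [Real.sqrt_eq_iff_mul_self_eq (by positivity) (by positivity)]
    have : β = c ^ 2 / 2 := by linarith
    rw [this]
    field_simp
    norm_num
  have herf : ∫ y in (0 : ℝ)..(β / 2), F y
      = c * ∫ s in (0 : ℝ)..Real.sqrt (β / 8), Real.exp (-s ^ 2) := by
    have h := intervalIntegral.integral_comp_div (a := 0) (b := β / 2)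
      (fun s : ℝ => Real.exp (-s ^ 2)) hcpos.ne'
    rw [zero_div, hbc, smul_eq_mul] at h
    rw [← h]
    congr 1
    funext y
    simp only [hF]
    rw [div_pow, hc2]
    congr 1
    field_simp
  have hsq : Real.sqrt (2 * Real.pi * β) = c * Real.sqrt Real.pi := by
    rw [hcdef, ← Real.sqrt_mul (by positivity)]
    congr 1
    ring
  have hpi : Real.sqrt (Real.pi / (1 / (2 * β))) = c * Real.sqrt Real.pi := by
    rw [← hsq]
    congr 1
    field_simp
  have hspi : 0 < Real.sqrt Real.pi := Real.sqrt_pos.2 Real.pi_pos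
  rw [integral_const_mul, hshift, ← intervalIntegral.integral_interval_add_Ioi (b := 0)
    iF.integrableOn iF.integrableOn, integral_gaussian_Ioi, hneg, herf, hpi, hsq, erf]
  field_simp
  ring

lemma measureReal_gaussianReal_Iio {β : ℝ} (hβ : 0 < β) :
    (gaussianReal (β / 2) β.toNNReal).real (Set.Iio 0) = (1 - erf (Real.sqrt (β / 8))) / 2 := by
  have hv : β.toNNReal ≠ 0 := by simpa using hβ
  have := nullSingletonClass_gaussianReal (μ := β / 2) hv
  have h1 : (gaussianReal (β / 2) β.toNNReal).real (Set.Iio 0)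
      = (gaussianReal (β / 2) β.toNNReal).real (Set.Iic 0) := measureReal_congr Iio_ae_eq_Iic
  rw [h1, ← Set.compl_Ioi, probReal_compl_eq_one_sub measurableSet_Ioi,
    measureReal_gaussianReal_Ioi hβ]
  ring

lemma ae_logGap_pos_iff [NeZero v] (m a b : ℕ) :
    ∀ᵐ p ∂((tiltLaw v m a).prod (tiltLaw v m b)),
      (0 < logGap m p ↔ |∏ i, p.2 i| < |∏ i, p.1 i|) ∧
      (logGap m p < 0 ↔ |∏ i, p.1 i| < |∏ i, p.2 i|) := by
  have h1 : ∀ᵐ p ∂((tiltLaw v m a).prod (tiltLaw v m b)), ∀ i, p.1 i ≠ 0 :=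
    Measure.quasiMeasurePreserving_fst.ae (ae_forall_ne_zero_tiltLaw m a)
  have h2 : ∀ᵐ p ∂((tiltLaw v m a).prod (tiltLaw v m b)), ∀ i, p.2 i ≠ 0 :=
    Measure.quasiMeasurePreserving_snd.ae (ae_forall_ne_zero_tiltLaw m b)
  filter_upwards [h1, h2] with p hp1 hp2
  have q1 : 0 < |∏ i, p.1 i| := abs_pos.2 (Finset.prod_ne_zero_iff.2 fun i _ => hp1 i)
  have q2 : 0 < |∏ i, p.2 i| := abs_pos.2 (Finset.prod_ne_zero_iff.2 fun i _ => hp2 i)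
  have e : logGap m p = Real.log |∏ i, p.1 i| - Real.log |∏ i, p.2 i| := by
    rw [logGap, Finset.abs_prod, Finset.abs_prod, Real.log_prod fun i _ => abs_ne_zero.2 (hp1 i),
      Real.log_prod fun i _ => abs_ne_zero.2 (hp2 i)]
  rw [e, sub_pos, sub_neg, Real.log_lt_log_iff q2 q1, Real.log_lt_log_iff q1 q2]
  exact ⟨Iff.rfl, Iff.rfl⟩

lemma logGapLaw_real_Ioi [NeZero v] (m a b : ℕ) :
    (logGapLaw v m a b : Measure ℝ).real (Set.Ioi 0)
      = ((tiltLaw v m a).prod (tiltLaw v m b)).real {p | |∏ i, p.2 i| < |∏ i, p.1 i|} := by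
  rw [logGapLaw, ProbabilityMeasure.coe_mk, map_measureReal_apply (measurable_logGap m)
    measurableSet_Ioi]
  refine measureReal_congr ?_
  filter_upwards [ae_logGap_pos_iff (v := v) m a b] with p hp
  exact propext hp.1

lemma logGapLaw_real_Iio [NeZero v] (m a b : ℕ) :
    (logGapLaw v m a b : Measure ℝ).real (Set.Iio 0)
      = ((tiltLaw v m b).prod (tiltLaw v m a)).real {p | |∏ i, p.2 i| < |∏ i, p.1 i|} := by
  have hs : MeasurableSet {p : (Fin m → ℝ) × (Fin m → ℝ) | |∏ i, p.2 i| < |∏ i, p.1 i|} :=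
    measurableSet_lt (by fun_prop) (by fun_prop)
  rw [logGapLaw, ProbabilityMeasure.coe_mk, map_measureReal_apply (measurable_logGap m)
    measurableSet_Iio, ← Measure.prod_swap (μ := tiltLaw v m a), map_measureReal_apply
    measurable_swap hs]
  refine measureReal_congr ?_
  filter_upwards [ae_logGap_pos_iff (v := v) m a b] with p hp
  exact propext hp.2

variable {u : ℕ → NNReal} [∀ n, NeZero (u n)] {j m : ℕ → ℕ} {β : ℝ}

lemma tendsto_prob_upper (hβ : 0 < β) (hj : Tendsto j atTop atTop)
    (hm : Tendsto (fun n => (m n : ℝ) / ((j n : ℝ) + 1)) atTop (nhds β)) :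
    Tendsto (fun n => ((tiltLaw (u n) (m n) (j n + 1)).prod (tiltLaw (u n) (m n) (j n))).real
      {p | |∏ i, p.2 i| < |∏ i, p.1 i|}) atTop (nhds ((1 + erf (Real.sqrt (β / 8))) / 2)) := by
  have hv : β.toNNReal ≠ 0 := by simpa using hβ
  have := nullSingletonClass_gaussianReal (μ := β / 2) hv
  have h := ProbabilityMeasure.tendsto_measure_of_null_frontier_of_tendsto'
    (tendsto_logGapLaw (v := u) hβ.le hj hm) (E := Set.Ioi 0) (by simp)
  have h' := (ENNReal.tendsto_toReal (measure_ne_top (gaussianReal (β / 2) β.toNNReal)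
    (Set.Ioi 0))).comp h
  rw [← measureReal_gaussianReal_Ioi hβ]
  exact h'.congr fun n => logGapLaw_real_Ioi _ _ _

lemma tendsto_prob_lower (hβ : 0 < β) (hj : Tendsto j atTop atTop)
    (hm : Tendsto (fun n => (m n : ℝ) / ((j n : ℝ) + 1)) atTop (nhds β)) :
    Tendsto (fun n => ((tiltLaw (u n) (m n) (j n)).prod (tiltLaw (u n) (m n) (j n + 1))).real
      {p | |∏ i, p.2 i| < |∏ i, p.1 i|}) atTop (nhds ((1 - erf (Real.sqrt (β / 8))) / 2)) := by
  have hv : β.toNNReal ≠ 0 := by simpa using hβ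
  have := nullSingletonClass_gaussianReal (μ := β / 2) hv
  have h := ProbabilityMeasure.tendsto_measure_of_null_frontier_of_tendsto'
    (tendsto_logGapLaw (v := u) hβ.le hj hm) (E := Set.Iio 0) (by simp)
  have h' := (ENNReal.tendsto_toReal (measure_ne_top (gaussianReal (β / 2) β.toNNReal)
    (Set.Iio 0))).comp h
  rw [← measureReal_gaussianReal_Iio hβ]
  exact h'.congr fun n => logGapLaw_real_Iio _ _ _

end LogGap

section Concentration

variable {v : NNReal}

lemma integral_prod_sq_tiltLaw [NeZero v] (m a : ℕ) :
    Integrable (fun ξ : Fin m → ℝ => (∏ i, ξ i) ^ 2) (tiltLaw v m a) ∧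
    ∫ ξ, (∏ i, ξ i) ^ 2 ∂(tiltLaw v m a) = (v * (a + 1)) ^ m := by
  have hpos := absMoment_pos (NeZero.ne v) a
  have h1 : ∫ x, x ^ 2 ∂(absTilt v a) = v * (a + 1) := by
    have h := integral_sq_div_pow_absTilt (v := v) a 1 1
    simp only [div_one, pow_one, mul_one] at h
    rw [h, (absMoment_ratio (v := v) a).1]
    field_simp
  have i1 : Integrable (fun x : ℝ => x ^ 2) (absTilt v a) := by
    simpa using integrable_sq_div_pow_absTilt (v := v) a 1 1
  have e : ∀ ξ : Fin m → ℝ, (∏ i, ξ i) ^ 2 = ∏ i, ξ i ^ 2 := fun ξ => (Finset.prod_pow _ _ _).symm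
  simp only [e]
  constructor
  · exact Integrable.fintype_prod (f := fun (_ : Fin m) (x : ℝ) => x ^ 2) fun _ => i1
  · rw [tiltLaw, integral_fintype_prod_eq_prod (fun (_ : Fin m) (x : ℝ) => x ^ 2), h1]
    simp

lemma integral_prod_sq_inv_tiltLaw [NeZero v] (m : ℕ) {a : ℕ} (ha : 2 ≤ a) :
    Integrable (fun ξ : Fin m → ℝ => ((∏ i, ξ i) ^ 2)⁻¹) (tiltLaw v m a) ∧
    ∫ ξ, ((∏ i, ξ i) ^ 2)⁻¹ ∂(tiltLaw v m a) = (((v : ℝ) * ((a : ℝ) - 1))⁻¹) ^ m := by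
  obtain ⟨b, rfl⟩ := Nat.exists_eq_add_of_le' ha
  have hpos := absMoment_pos (NeZero.ne v) b
  have hv : (0 : ℝ) < v := NNReal.coe_pos.2 (pos_iff_ne_zero.2 (NeZero.ne v))
  have hnull := nullSingletonClass_gaussianReal (μ := 0) (NeZero.ne v)
  have h0 : ∀ᵐ x ∂(gaussianReal 0 v), x ≠ 0 := by
    rw [ae_iff]
    simp
  have e1 : ∀ᵐ x ∂(gaussianReal 0 v), |x| ^ b = |x| ^ (b + 2) * (x ^ 2)⁻¹ := by
    filter_upwards [h0] with x hx
    rw [pow_add, sq_abs]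
    field_simp
  have i1 : Integrable (fun x : ℝ => (x ^ 2)⁻¹) (absTilt v (b + 2)) :=
    integrable_absTilt_of _ ((integrable_abs_pow_gaussianReal v b).congr e1)
  have h1 : ∫ x, (x ^ 2)⁻¹ ∂(absTilt v (b + 2)) = (v * (((b + 2 : ℕ) : ℝ) - 1))⁻¹ := by
    rw [integral_absTilt]
    have e2 : ∫ x, (|x| ^ (b + 2) / absMoment v (b + 2)) • (x ^ 2)⁻¹ ∂(gaussianReal 0 v)
        = ∫ x, |x| ^ b / absMoment v (b + 2) ∂(gaussianReal 0 v) := by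
      refine integral_congr_ae ?_
      filter_upwards [e1] with x hx
      rw [hx, smul_eq_mul]
      ring
    rw [e2, integral_div, ← absMoment, absMoment_add_two (NeZero.ne v)]
    have : ((b + 2 : ℕ) : ℝ) - 1 = b + 1 := by push_cast; ring
    rw [this]
    field_simp
  have e : ∀ ξ : Fin m → ℝ, ((∏ i, ξ i) ^ 2)⁻¹ = ∏ i, (ξ i ^ 2)⁻¹ := fun ξ => by
    rw [← Finset.prod_pow, Finset.prod_inv_distrib]
  simp only [e]
  constructor
  · exact Integrable.fintype_prod (f := fun (_ : Fin m) (x : ℝ) => (x ^ 2)⁻¹) fun _ => i1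
  · rw [tiltLaw, integral_fintype_prod_eq_prod (fun (_ : Fin m) (x : ℝ) => (x ^ 2)⁻¹), h1]
    simp

lemma tiltLaw_real_root_ge_le [NeZero v] {m : ℕ} (hm : 0 < m) (a : ℕ) {R : ℝ} (hR : 0 < R) :
    (tiltLaw v m a).real {ξ | R ≤ |∏ i, ξ i| ^ ((1 : ℝ) / m)} ≤ (v * (a + 1) / R ^ 2) ^ m := by
  obtain ⟨hi, he⟩ := integral_prod_sq_tiltLaw (v := v) m a
  have hmk := mul_meas_ge_le_integral_of_nonneg (ae_of_all _ fun ξ => sq_nonneg _) hi ((R ^ 2) ^ m)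
  rw [he] at hmk
  have hsub : {ξ : Fin m → ℝ | R ≤ |∏ i, ξ i| ^ ((1 : ℝ) / m)}
      ⊆ {ξ | (R ^ 2) ^ m ≤ (∏ i, ξ i) ^ 2} := by
    intro ξ hξ
    simp only [Set.mem_ofPred_eq] at hξ ⊢
    rw [← sq_abs (∏ i, ξ i), ← pow_mul, mul_comm, pow_mul]
    refine pow_le_pow_left₀ (by positivity) ?_ 2
    calc R ^ m ≤ (|∏ i, ξ i| ^ ((1 : ℝ) / m)) ^ m := by gcongr
      _ = _ := by rw [one_div, Real.rpow_inv_natCast_pow (abs_nonneg _) hm.ne']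
  rw [div_pow, le_div_iff₀ (by positivity), mul_comm]
  exact (mul_le_mul_of_nonneg_left (measureReal_mono hsub) (by positivity)).trans hmk

lemma tiltLaw_real_root_le_le [NeZero v] {m : ℕ} (hm : 0 < m) {a : ℕ} (ha : 2 ≤ a) {r : ℝ}
    (hr : 0 < r) :
    (tiltLaw v m a).real {ξ | |∏ i, ξ i| ^ ((1 : ℝ) / m) ≤ r} ≤ (r ^ 2 / (v * (a - 1))) ^ m := by
  obtain ⟨hi, he⟩ := integral_prod_sq_inv_tiltLaw (v := v) m ha
  have hmk := mul_meas_ge_le_integral_of_nonneg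
    (ae_of_all _ fun ξ => inv_nonneg.2 (sq_nonneg _)) hi (((r ^ 2) ^ m)⁻¹)
  rw [he] at hmk
  have hsub : {ξ : Fin m → ℝ | |∏ i, ξ i| ^ ((1 : ℝ) / m) ≤ r}
      ≤ᵐ[tiltLaw v m a] {ξ | ((r ^ 2) ^ m)⁻¹ ≤ ((∏ i, ξ i) ^ 2)⁻¹} := by
    filter_upwards [ae_forall_ne_zero_tiltLaw (v := v) m a] with ξ hne hξ
    have hne' : (∏ i, ξ i) ≠ 0 := Finset.prod_ne_zero_iff.2 fun i _ => hne i
    refine inv_anti₀ (by positivity) ?_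
    rw [← sq_abs (∏ i, ξ i), ← pow_mul, mul_comm, pow_mul]
    refine pow_le_pow_left₀ (by positivity) ?_ 2
    have hξ' : |∏ i, ξ i| ^ ((1 : ℝ) / m) ≤ r := hξ
    calc |∏ i, ξ i| = (|∏ i, ξ i| ^ ((1 : ℝ) / m)) ^ m := by
          rw [one_div, Real.rpow_inv_natCast_pow (abs_nonneg _) hm.ne']
      _ ≤ r ^ m := by gcongr
  have h1 : (tiltLaw v m a).real {ξ | |∏ i, ξ i| ^ ((1 : ℝ) / m) ≤ r}
      ≤ (tiltLaw v m a).real {ξ | ((r ^ 2) ^ m)⁻¹ ≤ ((∏ i, ξ i) ^ 2)⁻¹} :=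
    ENNReal.toReal_mono (measure_ne_top _ _) (measure_mono_ae hsub)
  refine h1.trans ?_
  rw [inv_mul_le_iff₀ (by positivity), ← mul_pow, ← div_eq_mul_inv] at hmk
  exact hmk

lemma tendsto_pow_zero_of_tendsto_lt_one {q : ℕ → ℝ} {m : ℕ → ℕ} {l : ℝ} (hl : l < 1)
    (hq : Tendsto q atTop (nhds l)) (hq0 : ∀ᶠ n in atTop, 0 ≤ q n) (hm : Tendsto m atTop atTop) :
    Tendsto (fun n => q n ^ m n) atTop (nhds 0) := by
  obtain ⟨r, hr, hr1⟩ := exists_between (max_lt hl zero_lt_one)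
  have h1 : Tendsto (fun n => r ^ m n) atTop (nhds 0) :=
    (tendsto_pow_atTop_nhds_zero_of_lt_one ((le_max_right _ _).trans hr.le) hr1).comp hm
  refine squeeze_zero' (hq0.mono fun n hn => pow_nonneg hn _) ?_ h1
  filter_upwards [hq0, hq.eventually_lt_const ((le_max_left _ _).trans_lt hr)] with n h0 hn
  exact pow_le_pow_left₀ h0 hn.le _

variable {u : ℕ → NNReal} [∀ n, NeZero (u n)] {a m : ℕ → ℕ} {t : ℝ}

lemma tendsto_integral_root_sub (ht : 0 < t) (hm : Tendsto m atTop atTop)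
    (hu : Tendsto (fun n => (u n : ℝ)) atTop (nhds 0))
    (ha : Tendsto (fun n => (u n : ℝ) * a n) atTop (nhds t)) (ha2 : ∀ᶠ n in atTop, 2 ≤ a n)
    {φ : ℝ → ℝ} (hφ : Continuous φ) {M : ℝ} (hM : ∀ x, |φ x| ≤ M) :
    Tendsto (fun n => ∫ ξ, |φ (|∏ i, ξ i| ^ ((1 : ℝ) / m n)) - φ (Real.sqrt t)|
      ∂(tiltLaw (u n) (m n) (a n))) atTop (nhds 0) := by
  have hM0 : 0 ≤ M := (abs_nonneg _).trans (hM 0)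
  have hst : 0 < Real.sqrt t := Real.sqrt_pos.2 ht
  have hup : ∀ R, Real.sqrt t < R → Tendsto (fun n => (tiltLaw (u n) (m n) (a n)).real
      {ξ | R ≤ |∏ i, ξ i| ^ ((1 : ℝ) / m n)}) atTop (nhds 0) := by
    intro R hR
    have hR0 : 0 < R := hst.trans hR
    have hq : Tendsto (fun n => (u n : ℝ) * (a n + 1) / R ^ 2) atTop (nhds (t / R ^ 2)) := by
      have := (ha.add hu).div_const (R ^ 2)
      rw [add_zero] at this
      exact this.congr fun n => by ring
    have hl : t / R ^ 2 < 1 := by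
      rw [div_lt_one (by positivity), ← Real.sqrt_lt' hR0]; exact hR
    refine squeeze_zero' (Eventually.of_forall fun n => measureReal_nonneg) ?_
      (tendsto_pow_zero_of_tendsto_lt_one hl hq
        (Eventually.of_forall fun n => by positivity) hm)
    filter_upwards [hm.eventually_gt_atTop 0] with n hn
    exact tiltLaw_real_root_ge_le hn _ hR0
  have hlow : ∀ r, 0 < r → r < Real.sqrt t → Tendsto (fun n => (tiltLaw (u n) (m n) (a n)).real
      {ξ | |∏ i, ξ i| ^ ((1 : ℝ) / m n) ≤ r}) atTop (nhds 0) := by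
    intro r hr0 hr
    have hs : Tendsto (fun n => (u n : ℝ) * (a n - 1)) atTop (nhds t) := by
      have := ha.sub hu
      rw [sub_zero] at this
      exact this.congr fun n => by ring
    have hl : r ^ 2 / t < 1 := by
      rw [div_lt_one ht, ← Real.lt_sqrt hr0.le]; exact hr
    refine squeeze_zero' (Eventually.of_forall fun n => measureReal_nonneg) ?_
      (tendsto_pow_zero_of_tendsto_lt_one hl (tendsto_const_nhds.div hs ht.ne')
        ((hs.eventually_const_lt ht).mono fun n hn => div_nonneg (sq_nonneg r) hn.le) hm)
    filter_upwards [hm.eventually_gt_atTop 0, ha2] with n hn hn2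
    exact tiltLaw_real_root_le_le hn hn2 hr0
  rw [Metric.tendsto_atTop']
  intro ε hε
  obtain ⟨δ, hδ, hδφ⟩ := Metric.continuousAt_iff.1 (hφ.continuousAt (x := Real.sqrt t)) (ε / 2)
    (by positivity)
  set δ' := min δ (Real.sqrt t) / 2 with hδ'
  have hmin : 0 < min δ (Real.sqrt t) := lt_min hδ hst
  have hδ0 : 0 < δ' := by positivity
  have hδ1 : δ' < δ := by linarith [min_le_left δ (Real.sqrt t)]
  have hδ2 : δ' < Real.sqrt t := by linarith [min_le_right δ (Real.sqrt t)]
  have hU := hup (Real.sqrt t + δ') (by linarith)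
  have hL := hlow (Real.sqrt t - δ') (by linarith) (by linarith)
  have hsum : Tendsto (fun n => ε / 2
      + (2 * M * (tiltLaw (u n) (m n) (a n)).real {ξ | Real.sqrt t + δ' ≤ |∏ i, ξ i| ^ ((1 : ℝ) / m n)}
      + 2 * M * (tiltLaw (u n) (m n) (a n)).real
        {ξ | |∏ i, ξ i| ^ ((1 : ℝ) / m n) ≤ Real.sqrt t - δ'})) atTop (nhds (ε / 2)) := by
    simpa using ((hU.const_mul (2 * M)).add (hL.const_mul (2 * M))).const_add (ε / 2)
  have hev := hsum.eventually_lt_const (half_lt_self hε)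
  rw [eventually_atTop] at hev
  obtain ⟨N, hN⟩ := hev
  refine ⟨N, fun n hn => ?_⟩
  rw [Real.dist_eq, sub_zero, abs_of_nonneg (integral_nonneg fun ξ => abs_nonneg _)]
  refine lt_of_le_of_lt ?_ (hN n hn.le)
  have hym : Measurable fun ξ : Fin (m n) → ℝ => |∏ i, ξ i| ^ ((1 : ℝ) / m n) := by fun_prop
  have hs1 : MeasurableSet {ξ : Fin (m n) → ℝ | Real.sqrt t + δ' ≤ |∏ i, ξ i| ^ ((1 : ℝ) / m n)} :=
    measurableSet_le measurable_const hym
  have hs2 : MeasurableSet {ξ : Fin (m n) → ℝ | |∏ i, ξ i| ^ ((1 : ℝ) / m n) ≤ Real.sqrt t - δ'} :=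
    measurableSet_le hym measurable_const
  have i1 : Integrable ({ξ : Fin (m n) → ℝ | Real.sqrt t + δ' ≤ |∏ i, ξ i| ^ ((1 : ℝ) / m n)}.indicator
      fun _ => 2 * M) (tiltLaw (u n) (m n) (a n)) := (integrable_const _).indicator hs1
  have i2 : Integrable ({ξ : Fin (m n) → ℝ | |∏ i, ξ i| ^ ((1 : ℝ) / m n) ≤ Real.sqrt t - δ'}.indicator
      fun _ => 2 * M) (tiltLaw (u n) (m n) (a n)) := (integrable_const _).indicator hs2
  have i0 : Integrable (fun _ => ε / 2) (tiltLaw (u n) (m n) (a n)) := integrable_const _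
  have i12 : Integrable (fun ξ =>
      {ξ : Fin (m n) → ℝ | Real.sqrt t + δ' ≤ |∏ i, ξ i| ^ ((1 : ℝ) / m n)}.indicator
        (fun _ => 2 * M) ξ
      + {ξ : Fin (m n) → ℝ | |∏ i, ξ i| ^ ((1 : ℝ) / m n) ≤ Real.sqrt t - δ'}.indicator
        (fun _ => 2 * M) ξ) (tiltLaw (u n) (m n) (a n)) := i1.add i2
  have hval : ∫ ξ, (ε / 2
      + ({ξ : Fin (m n) → ℝ | Real.sqrt t + δ' ≤ |∏ i, ξ i| ^ ((1 : ℝ) / m n)}.indicator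
        (fun _ => 2 * M) ξ
      + {ξ : Fin (m n) → ℝ | |∏ i, ξ i| ^ ((1 : ℝ) / m n) ≤ Real.sqrt t - δ'}.indicator
        (fun _ => 2 * M) ξ)) ∂(tiltLaw (u n) (m n) (a n))
      = ε / 2 + (2 * M * (tiltLaw (u n) (m n) (a n)).real
          {ξ | Real.sqrt t + δ' ≤ |∏ i, ξ i| ^ ((1 : ℝ) / m n)}
        + 2 * M * (tiltLaw (u n) (m n) (a n)).real
          {ξ | |∏ i, ξ i| ^ ((1 : ℝ) / m n) ≤ Real.sqrt t - δ'}) := by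
    rw [integral_add i0 i12, integral_add i1 i2, integral_indicator_const _ hs1,
      integral_indicator_const _ hs2]
    simp [mul_comm]
  rw [← hval]
  refine integral_mono_of_nonneg (ae_of_all _ fun ξ => abs_nonneg _) (i0.add i12)
    (ae_of_all _ fun ξ => ?_)
  have key : ∀ y : ℝ, |φ y - φ (Real.sqrt t)| ≤ ε / 2
      + ({z | Real.sqrt t + δ' ≤ z}.indicator (fun _ => 2 * M) y
      + {z | z ≤ Real.sqrt t - δ'}.indicator (fun _ => 2 * M) y) := by
    intro y
    have hb : |φ y - φ (Real.sqrt t)| ≤ 2 * M := by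
      have h1 := abs_le.1 (hM y)
      have h2 := abs_le.1 (hM (Real.sqrt t))
      rw [abs_le]
      constructor <;> linarith
    simp only [Set.indicator_apply, Set.mem_ofPred_eq]
    split_ifs with c1 c2 c2
    · linarith
    · linarith
    · linarith
    · have : dist y (Real.sqrt t) < δ := by
        rw [Real.dist_eq, abs_lt]
        constructor <;> linarith
      have := hδφ this
      rw [Real.dist_eq] at this
      linarith
  exact key (|∏ i, ξ i| ^ ((1 : ℝ) / m n))

end Concentration

section PartLimits

variable {v : NNReal} {m : ℕ} {h : ℝ → ℝ} {M : ℝ}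

lemma measurableSet_prod_lt_prod (m : ℕ) :
    MeasurableSet {p : (Fin m → ℝ) × (Fin m → ℝ) | |∏ i, p.2 i| < |∏ i, p.1 i|} :=
  measurableSet_lt (by fun_prop) (by fun_prop)

lemma integrable_abs_comp_sub_prod [NeZero v] (hh : Measurable h) (hM : ∀ x, |h x| ≤ M) (c : ℝ)
    (a b : ℕ) : Integrable (fun p : (Fin m → ℝ) × (Fin m → ℝ) => |h |∏ i, p.1 i| - c|)
      ((tiltLaw v m a).prod (tiltLaw v m b)) := by
  refine Integrable.of_bound (C := M + |c|) ?_ (ae_of_all _ fun p => ?_)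
  · have : Measurable fun p : (Fin m → ℝ) × (Fin m → ℝ) => h |∏ i, p.1 i| := by fun_prop
    exact ((this.sub_const c).abs).aestronglyMeasurable
  · rw [Real.norm_eq_abs, abs_abs]
    exact (abs_sub _ _).trans (by linarith [hM |∏ i, p.1 i|])

lemma integral_abs_comp_sub_prod [NeZero v] (c : ℝ) (hh : Measurable h) (a b : ℕ) :
    ∫ p, |h |∏ i, p.1 i| - c| ∂((tiltLaw v m a).prod (tiltLaw v m b))
      = ∫ ξ, |h |∏ i, ξ i| - c| ∂(tiltLaw v m a) := by
  have hmp : MeasurePreserving Prod.fst ((tiltLaw v m a).prod (tiltLaw v m b)) (tiltLaw v m a) :=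
    measurePreserving_fst
  have hme : Measurable fun ξ : Fin m → ℝ => |h |∏ i, ξ i| - c| := by
    have : Measurable fun ξ : Fin m → ℝ => h |∏ i, ξ i| := by fun_prop
    exact (this.sub_const c).abs
  conv_rhs => rw [← hmp.map_eq]
  rw [integral_map hmp.measurable.aemeasurable hme.aestronglyMeasurable]

lemma abs_upperPart_sub_le [NeZero v] (hh : Measurable h) (hM : ∀ x, |h x| ≤ M) (c : ℝ)
    (a b : ℕ) :
    |upperPart v m h a b - c * ((tiltLaw v m a).prod (tiltLaw v m b)).real
        {p | |∏ i, p.2 i| < |∏ i, p.1 i|}|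
      ≤ ∫ ξ, |h |∏ i, ξ i| - c| ∂(tiltLaw v m a) := by
  have hS := measurableSet_prod_lt_prod m
  have hmh : Measurable fun p : (Fin m → ℝ) × (Fin m → ℝ) => h |∏ i, p.1 i| := by fun_prop
  have i1 : Integrable (fun p : (Fin m → ℝ) × (Fin m → ℝ) =>
      if |∏ i, p.2 i| < |∏ i, p.1 i| then h |∏ i, p.1 i| else 0)
      ((tiltLaw v m a).prod (tiltLaw v m b)) := by
    refine Integrable.of_bound (C := M) (Measurable.ite hS hmh measurable_const).aestronglyMeasurable
      (ae_of_all _ fun p => ?_)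
    rw [Real.norm_eq_abs]
    split_ifs
    · exact hM _
    · simpa using (abs_nonneg _).trans (hM 0)
  have i2 : Integrable ({p : (Fin m → ℝ) × (Fin m → ℝ) | |∏ i, p.2 i| < |∏ i, p.1 i|}.indicator
      fun _ => c) ((tiltLaw v m a).prod (tiltLaw v m b)) := (integrable_const _).indicator hS
  have e : upperPart v m h a b - c * ((tiltLaw v m a).prod (tiltLaw v m b)).real
        {p | |∏ i, p.2 i| < |∏ i, p.1 i|}
      = ∫ p, ((if |∏ i, p.2 i| < |∏ i, p.1 i| then h |∏ i, p.1 i| else 0)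
        - {p : (Fin m → ℝ) × (Fin m → ℝ) | |∏ i, p.2 i| < |∏ i, p.1 i|}.indicator
          (fun _ => c) p) ∂((tiltLaw v m a).prod (tiltLaw v m b)) := by
    rw [integral_sub i1 i2, integral_indicator_const _ hS, upperPart, smul_eq_mul, mul_comm c]
  rw [e, ← integral_abs_comp_sub_prod c hh a b]
  refine abs_integral_le_integral_abs.trans ?_
  refine integral_mono (i1.sub i2).abs (integrable_abs_comp_sub_prod hh hM c a b) fun p => ?_
  by_cases hp : |∏ i, p.2 i| < |∏ i, p.1 i| <;> simp [hp]

lemma upperPart_add_lowerPart [NeZero v] (hh : Measurable h) (hM : ∀ x, |h x| ≤ M)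
    (a b : ℕ) :
    upperPart v m h a b + lowerPart v m h a b = ∫ ξ, h |∏ i, ξ i| ∂(tiltLaw v m a) := by
  have hS := measurableSet_prod_lt_prod m
  have hmh : Measurable fun p : (Fin m → ℝ) × (Fin m → ℝ) => h |∏ i, p.1 i| := by fun_prop
  have hmh1 : Measurable fun ξ : Fin m → ℝ => h |∏ i, ξ i| := by fun_prop
  have i1 : Integrable (fun p : (Fin m → ℝ) × (Fin m → ℝ) =>
      if |∏ i, p.2 i| < |∏ i, p.1 i| then h |∏ i, p.1 i| else 0)
      ((tiltLaw v m a).prod (tiltLaw v m b)) := by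
    refine Integrable.of_bound (C := M) (Measurable.ite hS hmh measurable_const).aestronglyMeasurable
      (ae_of_all _ fun p => ?_)
    rw [Real.norm_eq_abs]
    split_ifs
    · exact hM _
    · simpa using (abs_nonneg _).trans (hM 0)
  have i2 : Integrable (fun p : (Fin m → ℝ) × (Fin m → ℝ) =>
      if |∏ i, p.2 i| < |∏ i, p.1 i| then 0 else h |∏ i, p.1 i|)
      ((tiltLaw v m a).prod (tiltLaw v m b)) := by
    refine Integrable.of_bound (C := M) (Measurable.ite hS measurable_const hmh).aestronglyMeasurable
      (ae_of_all _ fun p => ?_)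
    rw [Real.norm_eq_abs]
    split_ifs
    · simpa using (abs_nonneg _).trans (hM 0)
    · exact hM _
  have hmp : MeasurePreserving Prod.fst ((tiltLaw v m a).prod (tiltLaw v m b)) (tiltLaw v m a) :=
    measurePreserving_fst
  rw [upperPart, lowerPart, ← integral_add i1 i2]
  conv_rhs => rw [← hmp.map_eq]
  rw [integral_map hmp.measurable.aemeasurable hmh1.aestronglyMeasurable]
  refine integral_congr_ae (ae_of_all _ fun p => ?_)
  by_cases hp : |∏ i, p.2 i| < |∏ i, p.1 i| <;> simp [hp]

lemma abs_upperPart_lowerPart_le [NeZero v] (hM : ∀ x, |h x| ≤ M) (a b : ℕ) :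
    |upperPart v m h a b| ≤ M ∧ |lowerPart v m h a b| ≤ M := by
  have hM0 : 0 ≤ M := (abs_nonneg _).trans (hM 0)
  constructor
  · rw [upperPart, ← Real.norm_eq_abs]
    refine (norm_integral_le_of_norm_le_const
      (μ := (tiltLaw v m a).prod (tiltLaw v m b)) (C := M) (ae_of_all _ fun p => ?_)).trans_eq ?_
    swap
    · simp
    rw [Real.norm_eq_abs]
    split_ifs
    · exact hM _
    · simpa using hM0
  · rw [lowerPart, ← Real.norm_eq_abs]
    refine (norm_integral_le_of_norm_le_const
      (μ := (tiltLaw v m a).prod (tiltLaw v m b)) (C := M) (ae_of_all _ fun p => ?_)).trans_eq ?_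
    swap
    · simp
    rw [Real.norm_eq_abs]
    split_ifs
    · simpa using hM0
    · exact hM _

lemma abs_densityTerm_le [NeZero v] (hM : ∀ x, |h x| ≤ M) (j : ℕ) :
    |densityTerm v m h j| ≤ 2 * M := by
  rw [densityTerm]
  split_ifs
  · refine (abs_add_le _ _).trans ?_
    linarith [(abs_upperPart_lowerPart_le (v := v) (m := m) hM (j + 1) j).1,
      (abs_upperPart_lowerPart_le (v := v) (m := m) hM j (j + 1)).2]
  · rw [abs_neg]
    refine (abs_add_le _ _).trans ?_
    linarith [(abs_upperPart_lowerPart_le (v := v) (m := m) hM (j + 1) j).2,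
      (abs_upperPart_lowerPart_le (v := v) (m := m) hM j (j + 1)).1]

variable {u : ℕ → NNReal} [∀ n, NeZero (u n)] {a b j μ : ℕ → ℕ} {t β q : ℝ} {φ : ℝ → ℝ}

/-- Concentration turns convergence of the ordering probabilities into convergence of the
corresponding parts of the expectation. -/
lemma tendsto_upperPart_lowerPart (ht : 0 < t) (hμ : Tendsto μ atTop atTop)
    (hu : Tendsto (fun n => (u n : ℝ)) atTop (nhds 0))
    (ha : Tendsto (fun n => (u n : ℝ) * a n) atTop (nhds t)) (ha2 : ∀ᶠ n in atTop, 2 ≤ a n)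
    (hφ : Continuous φ) (hM : ∀ x, |φ x| ≤ M)
    (hq : Tendsto (fun n => ((tiltLaw (u n) (μ n) (a n)).prod (tiltLaw (u n) (μ n) (b n))).real
      {p | |∏ i, p.2 i| < |∏ i, p.1 i|}) atTop (nhds q)) :
    Tendsto (fun n => upperPart (u n) (μ n) (fun r => φ (|r| ^ ((1 : ℝ) / μ n))) (a n) (b n)) atTop
      (nhds (φ (Real.sqrt t) * q)) ∧
    Tendsto (fun n => lowerPart (u n) (μ n) (fun r => φ (|r| ^ ((1 : ℝ) / μ n))) (a n) (b n)) atTop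
      (nhds (φ (Real.sqrt t) * (1 - q))) := by
  have hconc := tendsto_integral_root_sub ht hμ hu ha ha2 hφ hM
  have hme : ∀ n, Measurable fun r : ℝ => φ (|r| ^ ((1 : ℝ) / μ n)) := fun n =>
    hφ.measurable.comp (by fun_prop)
  have hU : Tendsto (fun n => upperPart (u n) (μ n) (fun r => φ (|r| ^ ((1 : ℝ) / μ n)))
      (a n) (b n)) atTop (nhds (φ (Real.sqrt t) * q)) := by
    have h0 : Tendsto (fun n => upperPart (u n) (μ n) (fun r => φ (|r| ^ ((1 : ℝ) / μ n)))
        (a n) (b n) - φ (Real.sqrt t) * ((tiltLaw (u n) (μ n) (a n)).prod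
          (tiltLaw (u n) (μ n) (b n))).real {p | |∏ i, p.2 i| < |∏ i, p.1 i|}) atTop (nhds 0) := by
      refine squeeze_zero_norm (fun n => ?_) hconc
      have := abs_upperPart_sub_le (v := u n) (m := μ n) (hme n) (fun x => hM _)
        (φ (Real.sqrt t)) (a n) (b n)
      simpa only [abs_abs, Real.norm_eq_abs] using this
    have := h0.add (hq.const_mul (φ (Real.sqrt t)))
    simpa using this
  refine ⟨hU, ?_⟩
  have hT : Tendsto (fun n => ∫ ξ, φ (|∏ i, ξ i| ^ ((1 : ℝ) / μ n)) ∂(tiltLaw (u n) (μ n) (a n)))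
      atTop (nhds (φ (Real.sqrt t))) := by
    rw [tendsto_iff_norm_sub_tendsto_zero]
    refine squeeze_zero (fun n => norm_nonneg _) (fun n => ?_) hconc
    have hme' : Measurable fun ξ : Fin (μ n) → ℝ => φ (|∏ i, ξ i| ^ ((1 : ℝ) / μ n)) :=
      (hme n).comp (by fun_prop : Measurable fun ξ : Fin (μ n) → ℝ => ∏ i, ξ i)
    have i1 : Integrable (fun ξ : Fin (μ n) → ℝ => φ (|∏ i, ξ i| ^ ((1 : ℝ) / μ n)))
        (tiltLaw (u n) (μ n) (a n)) :=
      Integrable.of_bound (C := M) hme'.aestronglyMeasurable (ae_of_all _ fun ξ => hM _)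
    have e : ∫ ξ, φ (|∏ i, ξ i| ^ ((1 : ℝ) / μ n)) ∂(tiltLaw (u n) (μ n) (a n)) - φ (Real.sqrt t)
        = ∫ ξ, (φ (|∏ i, ξ i| ^ ((1 : ℝ) / μ n)) - φ (Real.sqrt t))
          ∂(tiltLaw (u n) (μ n) (a n)) := by
      rw [integral_sub i1 (integrable_const _)]
      simp
    rw [e]
    exact abs_integral_le_integral_abs
  have := hT.sub hU
  rw [← mul_one_sub] at this
  refine this.congr fun n => ?_
  have := upperPart_add_lowerPart (v := u n) (m := μ n) (hme n) (fun x => hM _) (a n) (b n)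
  simp only [abs_abs] at this
  rw [← this]
  ring

lemma tendsto_densityTerm (ht : 0 < t) (hβ : 0 < β) (hμ : Tendsto μ atTop atTop)
    (hu : Tendsto (fun n => (u n : ℝ)) atTop (nhds 0)) (hj : Tendsto j atTop atTop)
    (hut : Tendsto (fun n => (u n : ℝ) * j n) atTop (nhds t))
    (hμβ : Tendsto (fun n => (μ n : ℝ) / ((j n : ℝ) + 1)) atTop (nhds β))
    (hφ : Continuous φ) (hM : ∀ x, |φ x| ≤ M) :
    ((∀ n, Even (j n)) → Tendsto (fun n => densityTerm (u n) (μ n)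
      (fun r => φ (|r| ^ ((1 : ℝ) / μ n))) (j n)) atTop
      (nhds (φ (Real.sqrt t) * (1 + erf (Real.sqrt (β / 8)))))) ∧
    ((∀ n, ¬ Even (j n)) → Tendsto (fun n => densityTerm (u n) (μ n)
      (fun r => φ (|r| ^ ((1 : ℝ) / μ n))) (j n)) atTop
      (nhds (φ (Real.sqrt t) * (erf (Real.sqrt (β / 8)) - 1)))) := by
  have hut' : Tendsto (fun n => (u n : ℝ) * ((j n + 1 : ℕ) : ℝ)) atTop (nhds t) := by
    have := hut.add hu
    rw [add_zero] at this
    refine this.congr fun n => ?_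
    push_cast
    ring
  have hj2 : ∀ᶠ n in atTop, 2 ≤ j n := hj.eventually_ge_atTop 2
  obtain ⟨hA1, hA2⟩ := tendsto_upperPart_lowerPart ht hμ hu hut'
    (hj2.mono fun n hn => by omega) hφ hM (tendsto_prob_upper (u := u) hβ hj hμβ)
  obtain ⟨hB1, hB2⟩ := tendsto_upperPart_lowerPart ht hμ hu hut hj2 hφ hM
    (tendsto_prob_lower (u := u) hβ hj hμβ)
  constructor
  · intro hp
    have := hA1.add hB2
    simp only [densityTerm, if_pos (hp _)]
    convert this using 2
    ring
  · intro hp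
    have := (hA2.add hB1).neg
    simp only [densityTerm, if_neg (hp _)]
    convert this using 2
    ring

end PartLimits

section RiemannSum

/-- Riemann sums of uniformly bounded arrays converge to the integral of the pointwise limit. -/
lemma tendsto_riemann_sum {F : ℕ → ℕ → ℝ} {G : ℝ → ℝ} {C : ℝ} (hF : ∀ n i, |F n i| ≤ C)
    (hG : ∀ t : ℝ, 0 < t → t < 1 →
      Tendsto (fun n : ℕ => F n ⌊t * ((n : ℝ) + 1)⌋₊) atTop (nhds (G t))) :
    Tendsto (fun n : ℕ => (∑ i ∈ Finset.range (n + 1), F n i) / ((n : ℝ) + 1)) atTop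
      (nhds (∫ t in (0 : ℝ)..1, G t)) := by
  have hmeas : ∀ n, Measurable fun t : ℝ => F n ⌊t * ((n : ℝ) + 1)⌋₊ := fun n =>
    (measurable_from_nat (f := F n)).comp (Nat.measurable_floor.comp (by fun_prop))
  have hint : ∀ n x y, IntervalIntegrable (fun t : ℝ => F n ⌊t * ((n : ℝ) + 1)⌋₊) volume x y := by
    intro n x y
    refine (intervalIntegrable_const (c := C)).mono_fun (hmeas n).aestronglyMeasurable
      (ae_of_all _ fun t => ?_)
    simpa using (hF n _).trans (le_abs_self C)
  have hpiece : ∀ n i : ℕ, ∫ t in ((i : ℝ) / ((n : ℝ) + 1))..(((i + 1 : ℕ) : ℝ) / ((n : ℝ) + 1)),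
      F n ⌊t * ((n : ℝ) + 1)⌋₊ = F n i / ((n : ℝ) + 1) := by
    intro n i
    have hn : (0 : ℝ) < (n : ℝ) + 1 := by positivity
    have hle : (i : ℝ) / ((n : ℝ) + 1) ≤ ((i + 1 : ℕ) : ℝ) / ((n : ℝ) + 1) := by
      gcongr; simp
    rw [intervalIntegral.integral_of_le hle, integral_Ioc_eq_integral_Ioo,
      setIntegral_congr_fun (g := fun _ => F n i) measurableSet_Ioo]
    · rw [setIntegral_const, measureReal_def, Real.volume_Ioo, ENNReal.toReal_ofReal (by linarith)]
      push_cast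
      rw [smul_eq_mul]
      field_simp
      ring
    · intro t ht
      have h1 : (i : ℝ) ≤ t * ((n : ℝ) + 1) := ((div_lt_iff₀ hn).1 ht.1).le
      have h2 : t * ((n : ℝ) + 1) < (i : ℝ) + 1 := by
        have := (lt_div_iff₀ hn).1 ht.2
        push_cast at this
        exact this
      have : ⌊t * ((n : ℝ) + 1)⌋₊ = i :=
        (Nat.floor_eq_iff ((Nat.cast_nonneg i).trans h1)).2 ⟨h1, h2⟩
      simp only [this]
  have hsum : ∀ n : ℕ, ∫ t in (0 : ℝ)..1, F n ⌊t * ((n : ℝ) + 1)⌋₊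
      = (∑ i ∈ Finset.range (n + 1), F n i) / ((n : ℝ) + 1) := by
    intro n
    have hn : (0 : ℝ) < (n : ℝ) + 1 := by positivity
    have := intervalIntegral.sum_integral_adjacent_intervals
      (f := fun t : ℝ => F n ⌊t * ((n : ℝ) + 1)⌋₊) (μ := volume)
      (a := fun i : ℕ => (i : ℝ) / ((n : ℝ) + 1)) (n := n + 1) fun i _ => hint n _ _
    have e1 : ((n + 1 : ℕ) : ℝ) / ((n : ℝ) + 1) = 1 := by
      push_cast
      exact div_self hn.ne'
    simp only [e1, Nat.cast_zero, zero_div] at this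
    rw [← this, Finset.sum_div]
    exact Finset.sum_congr rfl fun i _ => hpiece n i
  refine Tendsto.congr hsum ?_
  refine intervalIntegral.tendsto_integral_filter_of_dominated_convergence (fun _ => C)
    (Eventually.of_forall fun n => (hmeas n).aestronglyMeasurable)
    (Eventually.of_forall fun n => ae_of_all _ fun t _ => hF n _) intervalIntegrable_const ?_
  have hne : ∀ᵐ t : ℝ, t ≠ 1 := by rw [ae_iff]; simp
  filter_upwards [hne] with t ht1 ht
  rw [Set.uIoc_of_le zero_le_one] at ht
  exact hG t ht.1 (lt_of_le_of_ne ht.2 ht1)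

variable {u : ℕ → NNReal} [∀ n, NeZero (u n)] {μ : ℕ → ℕ} {α M : ℝ} {φ : ℝ → ℝ}

lemma tendsto_densityTerm_pair (hα : 0 < α) (hu : ∀ n, (u n : ℝ) = (2 * ((n : ℝ) + 1))⁻¹)
    (hμ : Tendsto (fun n => (u n : ℝ) * μ n) atTop (nhds α))
    (hφ : Continuous φ) (hM : ∀ x, |φ x| ≤ M) {t : ℝ} (ht : 0 < t) :
    Tendsto (fun n : ℕ =>
      densityTerm (u n) (μ n) (fun r => φ (|r| ^ ((1 : ℝ) / μ n))) (2 * ⌊t * ((n : ℝ) + 1)⌋₊)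
      + densityTerm (u n) (μ n) (fun r => φ (|r| ^ ((1 : ℝ) / μ n)))
        (2 * ⌊t * ((n : ℝ) + 1)⌋₊ + 1)) atTop
      (nhds (2 * (φ (Real.sqrt t) * erf (Real.sqrt (α / (8 * t)))))) := by
  have hn1 : Tendsto (fun n : ℕ => (n : ℝ) + 1) atTop atTop :=
    tendsto_atTop_add_const_right _ _ tendsto_natCast_atTop_atTop
  have hu0 : Tendsto (fun n => (u n : ℝ)) atTop (nhds 0) := by
    simp only [hu]
    exact tendsto_inv_atTop_zero.comp (hn1.const_mul_atTop two_pos)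
  have hupos : ∀ n, 0 < (u n : ℝ) := fun n => by rw [hu]; positivity
  have hμtop : Tendsto μ atTop atTop := by
    have h1 : Tendsto (fun n : ℕ => (2 * ((n : ℝ) + 1)) * ((u n : ℝ) * μ n)) atTop atTop :=
      (hn1.const_mul_atTop two_pos).atTop_mul_pos hα hμ
    refine tendsto_natCast_atTop_iff (R := ℝ).1 (h1.congr fun n => ?_)
    rw [hu]
    have : (n : ℝ) + 1 ≠ 0 := by positivity
    field_simp
  have hfl : Tendsto (fun n : ℕ => ⌊t * ((n : ℝ) + 1)⌋₊) atTop atTop :=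
    tendsto_nat_floor_atTop.comp (hn1.const_mul_atTop ht)
  have hut : Tendsto (fun n : ℕ => (u n : ℝ) * ((2 * ⌊t * ((n : ℝ) + 1)⌋₊ : ℕ) : ℝ)) atTop
      (nhds t) := by
    refine ((tendsto_nat_floor_mul_div_atTop ht.le).comp hn1).congr fun n => ?_
    have : (n : ℝ) + 1 ≠ 0 := by positivity
    simp only [Function.comp, hu]
    push_cast
    field_simp
  have hut1 : Tendsto (fun n : ℕ => (u n : ℝ) * ((2 * ⌊t * ((n : ℝ) + 1)⌋₊ + 1 : ℕ) : ℝ)) atTop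
      (nhds t) := by
    have := hut.add hu0
    rw [add_zero] at this
    refine this.congr fun n => ?_
    push_cast
    ring
  have hratio : ∀ j : ℕ → ℕ, Tendsto (fun n => (u n : ℝ) * j n) atTop (nhds t) →
      Tendsto (fun n => (μ n : ℝ) / ((j n : ℝ) + 1)) atTop (nhds (α / t)) := by
    intro j hj
    have h1 := hj.add hu0
    rw [add_zero] at h1
    refine (hμ.div h1 ht.ne').congr fun n => ?_
    simp only [Pi.div_apply]
    rw [← mul_add_one, mul_div_mul_left _ _ (hupos n).ne']
  have hβ : 0 < α / t := div_pos hα ht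
  have hE := (tendsto_densityTerm ht hβ hμtop hu0
    (tendsto_atTop_mono (fun n => Nat.le_mul_of_pos_left _ two_pos) hfl) hut
    (hratio _ hut) hφ hM).1 fun n => even_two_mul _
  have hO := (tendsto_densityTerm ht hβ hμtop hu0
    (tendsto_atTop_mono (fun n => by omega) hfl) hut1
    (hratio _ hut1) hφ hM).2 fun n => by simp
  have := hE.add hO
  have e : α / t / 8 = α / (8 * t) := by rw [div_div, mul_comm]
  rw [e] at this
  convert this using 2
  ring

lemma sum_range_two_mul_add_one (T : ℕ → ℝ) (n : ℕ) :
    ∑ j ∈ Finset.range (2 * n + 1), T j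
      = (∑ i ∈ Finset.range (n + 1), (T (2 * i) + T (2 * i + 1))) - T (2 * n + 1) := by
  induction n with
  | zero => simp
  | succ n ih =>
    rw [Finset.sum_range_succ (n := n + 1), show 2 * (n + 1) + 1 = 2 * n + 1 + 1 + 1 by ring,
      Finset.sum_range_succ, Finset.sum_range_succ, ih]
    ring_nf

lemma tendsto_sum_densityTerm (hα : 0 < α) (hu : ∀ n, (u n : ℝ) = (2 * ((n : ℝ) + 1))⁻¹)
    (hμ : Tendsto (fun n => (u n : ℝ) * μ n) atTop (nhds α))
    (hφ : Continuous φ) (hM : ∀ x, |φ x| ≤ M) :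
    Tendsto (fun n : ℕ => (∑ j ∈ Finset.range (2 * n + 1),
      densityTerm (u n) (μ n) (fun r => φ (|r| ^ ((1 : ℝ) / μ n))) j) / ((n : ℝ) + 1)) atTop
      (nhds (2 * ∫ t in (0 : ℝ)..1, φ (Real.sqrt t) * erf (Real.sqrt (α / (8 * t))))) := by
  have hb : ∀ n j, |densityTerm (u n) (μ n) (fun r => φ (|r| ^ ((1 : ℝ) / μ n))) j| ≤ 2 * M :=
    fun n j => abs_densityTerm_le (fun x => hM _) j
  have h1 := tendsto_riemann_sum
    (F := fun n i => densityTerm (u n) (μ n) (fun r => φ (|r| ^ ((1 : ℝ) / μ n))) (2 * i)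
      + densityTerm (u n) (μ n) (fun r => φ (|r| ^ ((1 : ℝ) / μ n))) (2 * i + 1))
    (fun n i => (abs_add_le _ _).trans (add_le_add (hb n _) (hb n _)))
    fun t ht _ => tendsto_densityTerm_pair hα hu hμ hφ hM ht
  have h2 : Tendsto (fun n : ℕ => densityTerm (u n) (μ n) (fun r => φ (|r| ^ ((1 : ℝ) / μ n)))
      (2 * n + 1) / ((n : ℝ) + 1)) atTop (nhds 0) := by
    have hz : Tendsto (fun n : ℕ => 2 * M * (1 / ((n : ℝ) + 1))) atTop (nhds 0) := by
      simpa using tendsto_one_div_add_atTop_nhds_zero_nat.const_mul (2 * M)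
    refine squeeze_zero_norm (fun n => ?_) hz
    have hn : (0 : ℝ) < (n : ℝ) + 1 := by positivity
    rw [Real.norm_eq_abs, abs_div, abs_of_pos hn, mul_one_div]
    gcongr
    exact hb n _
  have h3 := h1.sub h2
  rw [sub_zero, intervalIntegral.integral_const_mul] at h3
  refine h3.congr fun n => ?_
  rw [sum_range_two_mul_add_one, sub_div]

end RiemannSum

section LimitDensity

lemma continuous_erf : Continuous erf := by
  unfold erf
  exact continuous_const.mul (intervalIntegral.continuous_primitive
    (fun a b => (by fun_prop : Continuous fun s : ℝ => Real.exp (-s ^ 2)).intervalIntegrable a b) 0)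

lemma erf_pos {x : ℝ} (hx : 0 < x) : 0 < erf x := by
  unfold erf
  refine mul_pos (by positivity) ?_
  exact intervalIntegral.intervalIntegral_pos_of_pos
    ((by fun_prop : Continuous fun s : ℝ => Real.exp (-s ^ 2)).intervalIntegrable _ _)
    (fun s => Real.exp_pos _) hx

lemma abs_erf_le_one {x : ℝ} (hx : 0 ≤ x) : |erf x| ≤ 1 := by
  rcases hx.eq_or_lt with rfl | hx
  · simp [erf]
  have h := measureReal_gaussianReal_Ioi (β := 8 * x ^ 2) (by positivity)
  have e : Real.sqrt (8 * x ^ 2 / 8) = x := by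
    rw [mul_div_cancel_left₀ _ (by norm_num), Real.sqrt_sq hx.le]
  rw [e] at h
  have h1 : (1 + erf x) / 2 ≤ 1 := h ▸ measureReal_le_one
  rw [abs_of_pos (erf_pos hx)]
  linarith

variable {α : ℝ} {φ f : ℝ → ℝ} {M : ℝ}

lemma intervalIntegrable_mul_erf (hφ : Continuous φ) (hM : ∀ x, |φ x| ≤ M) :
    IntervalIntegrable (fun t : ℝ => φ (Real.sqrt t) * erf (Real.sqrt (α / (8 * t)))) volume 0 1 := by
  have hm : Measurable fun t : ℝ => φ (Real.sqrt t) * erf (Real.sqrt (α / (8 * t))) :=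
    (hφ.measurable.comp (by fun_prop)).mul (continuous_erf.measurable.comp (by fun_prop))
  refine (intervalIntegrable_const (c := M)).mono_fun hm.aestronglyMeasurable
    (ae_of_all _ fun t => ?_)
  simp only [norm_mul, Real.norm_eq_abs]
  calc |φ (Real.sqrt t)| * |erf (Real.sqrt (α / (8 * t)))| ≤ M * 1 :=
        mul_le_mul (hM _) (abs_erf_le_one (Real.sqrt_nonneg _)) (abs_nonneg _)
          ((abs_nonneg _).trans (hM 0))
    _ ≤ |M| := by rw [mul_one]; exact le_abs_self M

lemma cFun_pos (hα : 0 < α) : 0 < cFun α := by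
  refine intervalIntegral.intervalIntegral_pos_of_pos_on ?_ (fun t ht => ?_) zero_lt_one
  · simpa using intervalIntegrable_mul_erf (α := α) (φ := fun _ => 1) (M := 1) continuous_const
      fun x => by simp
  · have := ht.1
    exact erf_pos (Real.sqrt_pos.2 (by positivity))

lemma rhoTilde_neg (l : ℝ) : rhoTilde α (-l) = rhoTilde α l := by
  simp only [rhoTilde, abs_neg]

lemma integral_sqrt_mul_erf (φ : ℝ → ℝ) :
    ∫ t in (0 : ℝ)..1, φ (Real.sqrt t) * erf (Real.sqrt (α / (8 * t)))
      = ∫ l in Set.Ioo (0 : ℝ) 1, 2 * l * (φ l * erf (Real.sqrt (α / 8) / l)) := by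
  have himg : (fun l : ℝ => l ^ 2) '' Set.Ioo 0 1 = Set.Ioo 0 1 := by
    ext t
    constructor
    · rintro ⟨l, ⟨h0, h1⟩, rfl⟩
      exact ⟨by positivity, pow_lt_one₀ h0.le h1 two_ne_zero⟩
    · rintro ⟨h0, h1⟩
      exact ⟨Real.sqrt t, ⟨Real.sqrt_pos.2 h0, (Real.sqrt_lt' one_pos).2 (by simpa using h1)⟩,
        Real.sq_sqrt h0.le⟩
  have hcv := integral_image_eq_integral_abs_deriv_smul (s := Set.Ioo (0 : ℝ) 1)
    (f := fun l : ℝ => l ^ 2) (f' := fun l => 2 * l) measurableSet_Ioo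
    (fun l _ => by simpa using (hasDerivAt_pow 2 l).hasDerivWithinAt)
    (fun x hx y hy hxy => (pow_left_inj₀ hx.1.le hy.1.le two_ne_zero).1 hxy)
    (fun t => φ (Real.sqrt t) * erf (Real.sqrt (α / (8 * t))))
  rw [himg] at hcv
  rw [intervalIntegral.integral_of_le zero_le_one, integral_Ioc_eq_integral_Ioo, hcv]
  refine setIntegral_congr_fun measurableSet_Ioo fun l hl => ?_
  have hl0 : 0 < l := hl.1
  simp only [smul_eq_mul]
  rw [abs_of_pos (by positivity), Real.sqrt_sq hl0.le, ← div_div,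
    Real.sqrt_div' _ (sq_nonneg l), Real.sqrt_sq hl0.le]

lemma integral_mul_rhoTilde (hf : Continuous f) (hM : ∀ x, |f x| ≤ M) :
    ∫ l in (-1 : ℝ)..1, f l * rhoTilde α l
      = (∫ t in (0 : ℝ)..1, (f (Real.sqrt t) + f (-Real.sqrt t)) / 2
        * erf (Real.sqrt (α / (8 * t)))) / cFun α := by
  have hmr : Measurable (rhoTilde α) := by
    unfold rhoTilde
    refine Measurable.ite ?_ ?_ measurable_const
    · exact (measurableSet_lt measurable_const measurable_abs).inter
        (measurableSet_lt measurable_abs measurable_const)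
    · exact (by fun_prop : Measurable fun l : ℝ => 1 / cFun α * |l|).mul
        (continuous_erf.measurable.comp (by fun_prop))
  have hbr : ∀ l, |rhoTilde α l| ≤ |1 / cFun α| := by
    intro l
    unfold rhoTilde
    split_ifs with h
    · rw [abs_mul, abs_mul, abs_abs]
      have h1 := abs_erf_le_one (x := Real.sqrt (α / 8) / |l|) (by positivity)
      calc |1 / cFun α| * |l| * |erf (Real.sqrt (α / 8) / |l|)| ≤ |1 / cFun α| * 1 * 1 := by
            gcongr
            exact h.2.le
        _ = _ := by ring
    · simp
  have hM0 : 0 ≤ M := (abs_nonneg _).trans (hM 0)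
  have hint : ∀ g : ℝ → ℝ, Continuous g → (∀ x, |g x| ≤ M) → ∀ a b,
      IntervalIntegrable (fun l => g l * rhoTilde α l) volume a b := by
    intro g hg hgM a b
    refine (intervalIntegrable_const (c := M * |1 / cFun α|)).mono_fun
      (hg.measurable.mul hmr).aestronglyMeasurable (ae_of_all _ fun t => ?_)
    have := (mul_le_mul (hgM t) (hbr t) (abs_nonneg _) hM0).trans (le_abs_self _)
    rwa [← abs_mul] at this
  have hneg : ∫ l in (-1 : ℝ)..0, f l * rhoTilde α l = ∫ l in (0 : ℝ)..1, f (-l) * rhoTilde α l := by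
    have := intervalIntegral.integral_comp_neg (a := (0 : ℝ)) (b := 1)
      fun l => f l * rhoTilde α l
    simp only [rhoTilde_neg, neg_zero] at this
    exact this.symm
  rw [← intervalIntegral.integral_add_adjacent_intervals (hint f hf hM (-1) 0) (hint f hf hM 0 1),
    hneg, ← intervalIntegral.integral_add
      (hint (fun l => f (-l)) (by fun_prop) (fun x => hM _) 0 1) (hint f hf hM 0 1),
    integral_sqrt_mul_erf fun r => (f r + f (-r)) / 2,
    intervalIntegral.integral_of_le zero_le_one, integral_Ioc_eq_integral_Ioo, ← integral_div]
  refine setIntegral_congr_fun measurableSet_Ioo fun l hl => ?_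
  have hl0 : 0 < l := hl.1
  simp only [rhoTilde, abs_of_pos hl0, if_pos (show 0 < l ∧ l < 1 from hl)]
  ring

end LimitDensity

lemma measurable_realSign : Measurable Real.sign := by
  unfold Real.sign
  exact Measurable.ite measurableSet_Iio measurable_const
    (Measurable.ite measurableSet_Ioi measurable_const measurable_const)

lemma symmetrize_comp_signed_root (f : ℝ → ℝ) {m : ℕ} (hm : 0 < m) (r : ℝ) :
    (f (Real.sign r * |r| ^ ((1 : ℝ) / m)) + f (Real.sign (-r) * |-r| ^ ((1 : ℝ) / m))) / 2
      = (f (|r| ^ ((1 : ℝ) / m)) + f (-|r| ^ ((1 : ℝ) / m))) / 2 := by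
  rw [abs_neg, Real.sign_neg]
  rcases lt_trichotomy r 0 with hr | rfl | hr
  · rw [Real.sign_of_neg hr]
    simp [add_comm]
  · simp [Real.zero_rpow (show ((m : ℝ)⁻¹) ≠ 0 by positivity)]
  · rw [Real.sign_of_pos hr]
    simp

/-- The normalized expected linear statistic as a ratio of explicit sums. -/
theorem integral_linearStat_div_EN {N m d : ℕ} (hN : N = d + 2) (hd : Even d) (hm : 0 < m)
    (hpos : 0 < ∑ j ∈ Finset.range (d + 1), densityTerm (1 / (N : NNReal)) m (fun _ => 1) j)
    {f : ℝ → ℝ} (hf : Measurable f) {M : ℝ} (hM : ∀ x, |f x| ≤ M) :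
    (∫ ω, linearStat N (fun x => f (Real.sign x * |x| ^ ((1 : ℝ) / (m : ℝ)))) (prodMatrix N m ω)
      ∂(ensembleMeasure N m)) / EN N m
    = (∑ j ∈ Finset.range (d + 1), densityTerm (1 / (N : NNReal)) m
        (fun r => (f (|r| ^ ((1 : ℝ) / m)) + f (-|r| ^ ((1 : ℝ) / m))) / 2) j)
      / ∑ j ∈ Finset.range (d + 1), densityTerm (1 / (N : NNReal)) m (fun _ => 1) j := by
  obtain ⟨k, rfl⟩ := Nat.exists_eq_add_of_le' hm
  subst hN
  set v : NNReal := 1 / ((d + 2 : ℕ) : NNReal) with hv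
  have hv0 : v ≠ 0 := by positivity
  have : NeZero v := ⟨hv0⟩
  have hg : Measurable fun x : ℝ => f (Real.sign x * |x| ^ ((1 : ℝ) / ((k + 1 : ℕ) : ℝ))) :=
    hf.comp (measurable_realSign.mul
      (by fun_prop : Measurable fun x : ℝ => |x| ^ ((1 : ℝ) / ((k + 1 : ℕ) : ℝ))))
  have hC : 0 < ((d.factorial : ℝ) * (v : ℝ) ^ d * (absMoment v 0 * absMoment v 1)) ^ (k + 1) := by
    have h0 := absMoment_pos hv0 0
    have h1 := absMoment_pos hv0 1
    have hv' : (0 : ℝ) < v := NNReal.coe_pos.2 (pos_iff_ne_zero.2 hv0)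
    positivity
  have hone := integral_mul_rootDensity (v := v) k.succ_pos d (g := fun _ => 1) (M := 1)
    measurable_const (fun x => by simp)
  simp only [one_mul, add_self_div_two] at hone
  have hden : 0 < ∫ ξ, rootDensity v (k + 1) d (∏ i, ξ i) ∂(scalarLaw v (k + 1)) := by
    rw [hone]
    exact mul_pos hC hpos
  have hmain := integral_linearStat_div (v := v) (k := k) hv0 hd hden hg fun x => hM _
  have hnum := integral_mul_rootDensity (v := v) k.succ_pos d hg fun x => hM _
  simp only [symmetrize_comp_signed_root f k.succ_pos] at hnum
  refine hmain.trans ?_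
  rw [hnum, hone, mul_div_mul_left _ _ (ne_of_gt hC)]

/-- In the critical regime `m = αN`, the rescaled density of real
eigenvalues (under `x ↦ sgn(x)|x|^{1/m}`) converges weakly to `ρ̃_α`. -/
theorem rescaled_density_real_eigenvalues_critical (α : ℝ) (hα : 0 < α)
    (f : ℝ → ℝ) (hf_cont : Continuous f) (hf_bdd : ∃ C : ℝ, ∀ x, |f x| ≤ C)
    (m : ℕ → ℕ) (hm : ∀ n, 0 < m n)
    (hlim : Tendsto (fun n : ℕ => (m n : ℝ) / (2 * n : ℕ)) atTop (nhds α)) :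
    Tendsto (fun n : ℕ =>
        (∫ ω, linearStat (2 * n)
            (fun x => f (Real.sign x * |x| ^ ((1 : ℝ) / (m n : ℝ))))
            (prodMatrix (2 * n) (m n) ω)
            ∂(ensembleMeasure (2 * n) (m n))) / EN (2 * n) (m n))
      atTop (nhds (∫ l in (-1 : ℝ)..1, f l * rhoTilde α l)) := by
  obtain ⟨C, hC⟩ := hf_bdd
  rw [← tendsto_add_atTop_iff_nat 1]
  let u : ℕ → NNReal := fun n => 1 / ((2 * (n + 1) : ℕ) : NNReal)
  have hne : ∀ n, NeZero (u n) := fun n => ⟨by simp only [u]; positivity⟩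
  have hu : ∀ n, (u n : ℝ) = (2 * ((n : ℝ) + 1))⁻¹ := fun n => by simp [u]
  have hμ : Tendsto (fun n => (u n : ℝ) * m (n + 1)) atTop (nhds α) := by
    refine ((tendsto_add_atTop_iff_nat 1).2 hlim).congr fun n => ?_
    rw [hu]
    push_cast
    rw [div_eq_mul_inv, mul_comm]
  have hφc : Continuous fun r => (f r + f (-r)) / 2 := by fun_prop
  have hφC : ∀ r, |(f r + f (-r)) / 2| ≤ C := fun r => by
    rw [abs_le]
    constructor <;> linarith [(abs_le.1 (hC r)).1, (abs_le.1 (hC r)).2,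
      (abs_le.1 (hC (-r))).1, (abs_le.1 (hC (-r))).2]
  have hnum := tendsto_sum_densityTerm (u := u) hα hu hμ hφc hφC
  have hden := tendsto_sum_densityTerm (u := u) (φ := fun _ => 1) (M := 1) hα hu hμ
    continuous_const fun x => by simp
  simp only [one_mul] at hden
  have hc := cFun_pos hα
  rw [← cFun] at hden
  have hlimit := hnum.div hden (by positivity)
  rw [mul_div_mul_left _ _ two_ne_zero, ← integral_mul_rhoTilde hf_cont hC] at hlimit
  refine hlimit.congr' ?_
  filter_upwards [hden.eventually_const_lt (show (0 : ℝ) < 2 * cFun α by positivity)] with n hn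
  have hn1 : (0 : ℝ) < (n : ℝ) + 1 := by positivity
  rw [integral_linearStat_div_EN (d := 2 * n) (by ring) (even_two_mul n) (hm (n + 1))
    ((div_pos_iff_of_pos_right hn1).1 hn) hf_cont.measurable hC]
  simp only [Pi.div_apply]
  rw [div_div_div_cancel_right₀ hn1.ne']
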